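/- (Renormalization periodic points.) For every ρ>2 there exists an integer N>1 such that for every k ≥ 1 and every finite sequence ω̄=(ω_0,…,ω_{k−1}) of monotone combinatorial types whose word lengths all satisfy |ω_i^−| ≥ N and |ω_i^+| ≥ N, there exists a C^3 Lorenz map f with negative Schwarzian derivative which is k-times renormalizable with successive types ω_0,…,ω_{k−1} (i.e. R^i[f] is ω_i-renormalizable for 0 ≤ i ≤ k−1) and which is a periodic point of the renormalization operator: R^k[f] = f. -/

import Mathlib

open Set

/-- The Lorenz map `f = (u,v,c,φ,ψ)` with critical exponent `ρ`:
`f(x) = φ(u(1-((c-x)/c)^ρ))` for `x < c` and `f(x) = ψ(1+v(-1+((x-c)/(1-c))^ρ))`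
for `x ≥ c` (by convention, at the critical point `c` we take the right branch). -/
noncomputable def lorenzF (ρ u v c : ℝ) (φ ψ : ℝ → ℝ) : ℝ → ℝ := fun x =>
  if x < c then φ (u * (1 - ((c - x) / c) ^ ρ))
  else ψ (1 + v * (-1 + ((x - c) / (1 - c)) ^ ρ))

/-- The data `(u,v,c,φ,ψ)` of a Cᵏ Lorenz map with critical exponent `ρ > 1`:
`u,v ∈ (0,1]`, `c ∈ (0,1)`, and `φ, ψ` are Cᵏ orientation-preserving
diffeomorphisms of `[0,1]` fixing `0` and `1`. -/
structure IsLorenz (k : ℕ) (ρ u v c : ℝ) (φ ψ : ℝ → ℝ) : Prop where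
  one_lt_rho : 1 < ρ
  u_pos : 0 < u
  u_le_one : u ≤ 1
  v_pos : 0 < v
  v_le_one : v ≤ 1
  c_pos : 0 < c
  c_lt_one : c < 1
  phi_smooth : ContDiffOn ℝ k φ (Icc 0 1)
  psi_smooth : ContDiffOn ℝ k ψ (Icc 0 1)
  phi_zero : φ 0 = 0
  phi_one : φ 1 = 1
  psi_zero : ψ 0 = 0
  psi_one : ψ 1 = 1
  phi_deriv_pos : ∀ x ∈ Icc (0:ℝ) 1, 0 < derivWithin φ (Icc 0 1) x
  psi_deriv_pos : ∀ x ∈ Icc (0:ℝ) 1, 0 < derivWithin ψ (Icc 0 1) x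

/-- `dist[φ] ≤ π`: the distortion bound `log (Dφ(y)/Dφ(x)) ≤ π` for all `x,y ∈ [0,1]`. -/
def DistBound (φ : ℝ → ℝ) (π : ℝ) : Prop :=
  ∀ x ∈ Icc (0:ℝ) 1, ∀ y ∈ Icc (0:ℝ) 1,
    Real.log (derivWithin φ (Icc 0 1) y / derivWithin φ (Icc 0 1) x) ≤ π

/-- `f = (u,v,c,φ,ψ)` is renormalizable of monotone combinatorial type
`(0 1^n, 1 0^m)` with renormalization intervals `L = [p,c)`, `R = (c,q]`,
`C = [p,q]`: `f^{n+1}` maps `L` into `C` fixing `p`, `f^{m+1}` maps `R` into `C`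
fixing `q`, these are first returns (the intermediate iterates of `L` lie in
`(c,1]` and those of `R` in `[0,c)`, all disjoint from `C`), and the rescaled
first return map is a nontrivial Lorenz map (its critical values lie on opposite
sides of its critical point). -/
structure MonotoneRenorm (ρ u v c : ℝ) (φ ψ : ℝ → ℝ) (n m : ℕ) (p q : ℝ) : Prop where
  n_pos : 1 ≤ n
  m_pos : 1 ≤ m
  p_pos : 0 < p
  p_lt_c : p < c
  c_lt_q : c < q
  q_lt_one : q < 1
  left_return : MapsTo (lorenzF ρ u v c φ ψ)^[n + 1] (Ico p c) (Icc p q)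
  left_fix : (lorenzF ρ u v c φ ψ)^[n + 1] p = p
  right_return : MapsTo (lorenzF ρ u v c φ ψ)^[m + 1] (Ioc c q) (Icc p q)
  right_fix : (lorenzF ρ u v c φ ψ)^[m + 1] q = q
  left_iter : ∀ k, 1 ≤ k → k ≤ n →
    (lorenzF ρ u v c φ ψ)^[k] '' Ico p c ⊆ Ioc c 1 ∧
      Disjoint ((lorenzF ρ u v c φ ψ)^[k] '' Ico p c) (Icc p q)
  right_iter : ∀ k, 1 ≤ k → k ≤ m →
    (lorenzF ρ u v c φ ψ)^[k] '' Ioc c q ⊆ Ico 0 c ∧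
      Disjoint ((lorenzF ρ u v c φ ψ)^[k] '' Ioc c q) (Icc p q)
  nontrivial_left : c < (lorenzF ρ u v c φ ψ)^[n] (φ u)
  nontrivial_right : (lorenzF ρ u v c φ ψ)^[m] (ψ (1 - v)) < c

/-- `f` is C³ on `[0,1]∖{c}` with negative Schwarzian derivative
`S_f = f'''/f' - (3/2)(f''/f')² < 0` there. -/
def NegSchwarzian (f : ℝ → ℝ) (c : ℝ) : Prop :=
  ContDiffOn ℝ 3 f (Icc 0 1 \ {c}) ∧
  ∀ x ∈ Icc (0:ℝ) 1 \ {c},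
    derivWithin (derivWithin (derivWithin f (Icc 0 1 \ {c})) (Icc 0 1 \ {c}))
          (Icc 0 1 \ {c}) x / derivWithin f (Icc 0 1 \ {c}) x -
        3 / 2 * (derivWithin (derivWithin f (Icc 0 1 \ {c})) (Icc 0 1 \ {c}) x /
          derivWithin f (Icc 0 1 \ {c}) x) ^ 2 < 0

/-- The renormalization `R[f] = A⁻¹ ∘ P[f] ∘ A` of `f` as a map of `[0,1]`, where
`A(y) = p + (q-p)y` is the orientation-preserving affine bijection from `[0,1]`
onto `C = [p,q]`, and `P[f]` is the first return map: `f^{n+1}` on `L = [p,c)`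
and `f^{m+1}` on `R = (c,q]`. -/
noncomputable def renormF (f : ℝ → ℝ) (n m : ℕ) (p q c : ℝ) : ℝ → ℝ := fun y =>
  if p + (q - p) * y < c then (f^[n + 1] (p + (q - p) * y) - p) / (q - p)
  else (f^[m + 1] (p + (q - p) * y) - p) / (q - p)

section Brouwer

set_option linter.unusedSectionVars false

variable {E : Type*} [NormedAddCommGroup E] [InnerProductSpace ℝ E] [FiniteDimensional ℝ E]

/-- `t ↦ det (1 + tA)` is a polynomial of degree at most the dimension, so its value at `1` is a
fixed affine combination of its values at sufficiently many small nodes. -/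
lemma exists_nodes_det_one_add (t₀ : ℝ) (ht₀ : 0 < t₀) :
    ∃ (s : Finset ℕ) (node w : ℕ → ℝ), (∀ i ∈ s, 0 < node i ∧ node i ≤ t₀) ∧
      ∑ i ∈ s, w i = 1 ∧
      ∀ A : E →L[ℝ] E, (1 + A).det = ∑ i ∈ s, w i * (1 + node i • A).det := by
  classical
  set n := Module.finrank ℝ E
  let b := Module.finBasis ℝ E
  let node : ℕ → ℝ := fun i => t₀ / (i + 1)
  have hinj : Set.InjOn node (Finset.range (n + 1)) := by
    intro i _ j _ hij
    simp only [node] at hij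
    have h1 : (i : ℝ) + 1 ≠ 0 := by positivity
    have h2 : (j : ℝ) + 1 ≠ 0 := by positivity
    rw [div_eq_div_iff h1 h2] at hij
    have := mul_left_cancel₀ ht₀.ne' hij
    have h3 : (j : ℝ) = i := by linarith
    exact_mod_cast h3.symm
  refine ⟨Finset.range (n + 1), node,
    fun i => (Lagrange.basis (Finset.range (n + 1)) node i).eval 1, ?_, ?_, ?_⟩
  · intro i _
    refine ⟨by positivity, ?_⟩
    apply div_le_self ht₀.le
    have : (0 : ℝ) ≤ i := by positivity
    linarith
  · have := Lagrange.sum_basis hinj ⟨0, by simp⟩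
    have h2 := congrArg (Polynomial.eval (1 : ℝ)) this
    simpa [Polynomial.eval_finsetSum] using h2
  · intro A
    let M := LinearMap.toMatrix b b (A : E →ₗ[ℝ] E)
    let P : Polynomial ℝ :=
      Matrix.det ((Polynomial.X : Polynomial ℝ) • M.map Polynomial.C
        + (1 : Matrix (Fin n) (Fin n) ℝ).map Polynomial.C)
    have hP : ∀ t : ℝ, P.eval t = (1 + t • A).det := by
      intro t
      have h1 : (1 + t • A).det = (LinearMap.toMatrix b b ((1 + t • A : E →L[ℝ] E) : E →ₗ[ℝ] E)).det := by
        rw [LinearMap.det_toMatrix]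
      have h2 : LinearMap.toMatrix b b ((1 + t • A : E →L[ℝ] E) : E →ₗ[ℝ] E) = 1 + t • M := by
        have : ((1 + t • A : E →L[ℝ] E) : E →ₗ[ℝ] E) = LinearMap.id + t • (A : E →ₗ[ℝ] E) := by
          ext x; simp
        rw [this, map_add, map_smul, LinearMap.toMatrix_id]
      rw [h1, h2]
      have h3 := RingHom.map_det (Polynomial.evalRingHom t) ((Polynomial.X : Polynomial ℝ) •
        M.map Polynomial.C + (1 : Matrix (Fin n) (Fin n) ℝ).map Polynomial.C)
      rw [Polynomial.coe_evalRingHom] at h3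
      rw [h3]
      congr 1
      ext i j
      by_cases hij : i = j <;> simp [hij] <;> ring
    have hdeg : P.degree < ((Finset.range (n + 1)).card : ℕ) := by
      have h := Polynomial.natDegree_det_X_add_C_le M 1
      rw [Finset.card_range]
      refine lt_of_le_of_lt Polynomial.degree_le_natDegree ?_
      simp only [Fintype.card_fin] at h
      exact_mod_cast Nat.lt_succ_of_le h
    have h := Lagrange.eq_interpolate hinj hdeg
    have h2 := congrArg (Polynomial.eval (1 : ℝ)) h
    rw [hP 1, one_smul] at h2
    rw [h2, Lagrange.interpolate_apply, Polynomial.eval_finsetSum]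
    refine Finset.sum_congr rfl fun i _ => ?_
    rw [Polynomial.eval_mul, Polynomial.eval_C, hP, mul_comm]


/-- A map fixing the complement of the open unit ball, given by a small Lipschitz perturbation of
the identity, maps the open ball bijectively onto itself. -/
lemma image_ball_of_small_lipschitz {g : E → E} {K : NNReal}
    (hg : LipschitzOnWith K g (Metric.closedBall 0 1)) (hg0 : ∀ x, ‖x‖ = 1 → g x = 0)
    {t : ℝ} (ht : 0 < t) (htK : t * K < 1) :
    InjOn (fun x => x + t • g x) (Metric.ball 0 1) ∧
      (fun x => x + t • g x) '' Metric.ball 0 1 = Metric.ball 0 1 := by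
  classical
  let G : E → E := fun x => if ‖x‖ ≤ 1 then g x else 0
  have hGin : ∀ x, ‖x‖ ≤ 1 → G x = g x := fun x hx => by simp [G, hx]
  have hGout : ∀ x, 1 ≤ ‖x‖ → G x = 0 := by
    intro x hx
    by_cases h : ‖x‖ ≤ 1
    · rw [hGin x h, hg0 x (le_antisymm h hx)]
    · simp [G, h]
  have hcross : ∀ x y, ‖x‖ ≤ 1 → 1 ≤ ‖y‖ → ‖G x - G y‖ ≤ K * ‖x - y‖ := by
    intro x y hx hy
    have hc : ContinuousOn (fun τ : ℝ => ‖x + τ • (y - x)‖) (Icc 0 1) := by fun_prop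
    have hmem : (1 : ℝ) ∈ Icc (‖x + (0:ℝ) • (y - x)‖) (‖x + (1:ℝ) • (y - x)‖) := by
      simp [hx, hy]
    obtain ⟨τ, hτ, hτ1⟩ := intermediate_value_Icc zero_le_one hc hmem
    simp only at hτ1
    have h1 := hg.dist_le_mul x (by simpa using hx) (x + τ • (y - x)) (by simp [hτ1])
    rw [hg0 _ hτ1, dist_zero_right, dist_eq_norm] at h1
    rw [hGout y hy, hGin x hx, sub_zero]
    refine h1.trans ?_
    have h2 : ‖x - (x + τ • (y - x))‖ ≤ ‖x - y‖ := by
      have : x - (x + τ • (y - x)) = τ • (x - y) := by module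
      rw [this, norm_smul, Real.norm_eq_abs, abs_of_nonneg hτ.1]
      exact mul_le_of_le_one_left (norm_nonneg _) hτ.2
    gcongr
  have hGlip : ∀ x y, ‖G x - G y‖ ≤ K * ‖x - y‖ := by
    intro x y
    rcases le_total ‖x‖ 1 with hx | hx <;> rcases le_total ‖y‖ 1 with hy | hy
    · have := hg.dist_le_mul x (by simpa using hx) y (by simpa using hy)
      rw [hGin x hx, hGin y hy]
      simpa [dist_eq_norm] using this
    · exact hcross x y hx hy
    · rw [norm_sub_rev, norm_sub_rev x]; exact hcross y x hy hx
    · rw [hGout x hx, hGout y hy, sub_zero, norm_zero]; positivity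
  let H : E → E := fun x => x + t • G x
  have hinj : Function.Injective H := by
    intro x y hxy
    have h1 : x - y = -(t • (G x - G y)) := by
      have : x + t • G x = y + t • G y := hxy
      rw [smul_sub, neg_sub, sub_eq_sub_iff_add_eq_add, this, add_comm]
    have h2 : ‖x - y‖ ≤ t * K * ‖x - y‖ := by
      calc ‖x - y‖ = t * ‖G x - G y‖ := by
            conv_lhs => rw [h1]
            rw [norm_neg, norm_smul, Real.norm_eq_abs, abs_of_pos ht]
        _ ≤ t * (K * ‖x - y‖) := by gcongr; exact hGlip x y
        _ = t * K * ‖x - y‖ := by ring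
    have h3 : ‖x - y‖ = 0 := by nlinarith [norm_nonneg (x - y)]
    exact sub_eq_zero.1 (norm_eq_zero.1 h3)
  have hsurj : Function.Surjective H := by
    intro y
    let k : NNReal := ⟨t, ht.le⟩ * K
    have hk : ContractingWith k (fun x => y - t • G x) := by
      refine ⟨by exact_mod_cast htK, LipschitzWith.of_dist_le_mul fun a b => ?_⟩
      rw [dist_eq_norm, dist_eq_norm]
      have : y - t • G a - (y - t • G b) = -(t • (G a - G b)) := by module
      rw [this, norm_neg, norm_smul, Real.norm_eq_abs, abs_of_pos ht]
      calc t * ‖G a - G b‖ ≤ t * (K * ‖a - b‖) := by gcongr; exact hGlip a b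
        _ = (k : ℝ) * ‖a - b‖ := by
          have : (k : ℝ) = t * K := rfl
          rw [this]; ring
    have hfix := hk.fixedPoint_isFixedPt
    refine ⟨ContractingWith.fixedPoint _ hk, ?_⟩
    · have h : y - t • G (ContractingWith.fixedPoint _ hk) = ContractingWith.fixedPoint _ hk := hfix
      simp only [H]
      rw [eq_comm, ← sub_eq_iff_eq_add]
      exact h
  have heq : ∀ x ∈ Metric.ball (0 : E) 1, x + t • g x = H x := by
    intro x hx
    simp only [H]
    rw [hGin x (by simpa using (mem_ball_zero_iff.1 hx).le)]
  have himg : H '' (Metric.ball 0 1)ᶜ = (Metric.ball 0 1)ᶜ := by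
    have : EqOn H id (Metric.ball 0 1)ᶜ := by
      intro x hx
      have : 1 ≤ ‖x‖ := by simpa using hx
      simp [H, hGout x this]
    rw [this.image_eq, image_id]
  refine ⟨fun x hx y hy hxy => hinj ?_, ?_⟩
  · rw [← heq x hx, ← heq y hy]; exact hxy
  · rw [image_congr heq]
    rw [image_compl_eq ⟨hinj, hsurj⟩] at himg
    exact compl_injective himg

open MeasureTheory in
/-- There is no continuously differentiable retraction of the closed unit ball onto the sphere. -/
lemma no_contDiff_retraction {r : E → E}
    (hr : ∀ x ∈ Metric.closedBall (0 : E) 1, ContDiffAt ℝ 1 r x)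
    (hr1 : ∀ x ∈ Metric.closedBall (0 : E) 1, ‖r x‖ = 1)
    (hrid : ∀ x, ‖x‖ = 1 → r x = x) : False := by
  borelize E
  let μ : Measure E := Measure.addHaar
  let g : E → E := fun x => r x - x
  have hgC : ∀ x ∈ Metric.closedBall (0 : E) 1, ContDiffAt ℝ 1 g x :=
    fun x hx => (hr x hx).sub contDiffAt_id
  obtain ⟨K, hK⟩ := LocallyLipschitzOn.exists_lipschitzOnWith_of_compact
    (isCompact_closedBall (0 : E) 1)
    (ContDiffOn.locallyLipschitzOn (convex_closedBall (0 : E) 1)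
      (fun x hx => (hgC x hx).contDiffWithinAt))
  have hg0 : ∀ x, ‖x‖ = 1 → g x = 0 := fun x hx => by simp [g, hrid x hx]
  have hball : ∀ x ∈ Metric.ball (0 : E) 1, x ∈ Metric.closedBall (0 : E) 1 :=
    fun x hx => Metric.ball_subset_closedBall hx
  have hgd : ∀ x ∈ Metric.ball (0 : E) 1, HasFDerivAt g (fderiv ℝ g x) x := fun x hx =>
    ((hgC x (hball x hx)).differentiableAt one_ne_zero).hasFDerivAt
  have hnorm : ∀ x ∈ Metric.ball (0 : E) 1, ‖fderiv ℝ g x‖ ≤ K := fun x hx =>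
    (hgd x hx).le_of_lipschitzOn (Filter.mem_of_superset (Metric.isOpen_ball.mem_nhds hx)
      Metric.ball_subset_closedBall) hK
  have hdetnhds : ∀ᶠ A : E →L[ℝ] E in nhds 1, 0 < A.det := by
    have hc : ContinuousAt (fun A : E →L[ℝ] E => A.det) 1 :=
      ContinuousLinearMap.continuous_det.continuousAt
    refine hc.eventually (lt_mem_nhds ?_)
    change 0 < LinearMap.det (LinearMap.id : E →ₗ[ℝ] E)
    simp
  obtain ⟨η, hη, hdet⟩ := Metric.eventually_nhds_iff.1 hdetnhds
  let t₀ : ℝ := min 1 η / (2 * (K + 1))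
  have hK0 : (0 : ℝ) ≤ K := K.2
  have ht₀ : 0 < t₀ := by positivity
  have ht₀K : t₀ * K < min 1 η := by
    have hm : 0 < min 1 η := by positivity
    simp only [t₀]
    rw [div_mul_eq_mul_div, div_lt_iff₀ (by positivity)]
    nlinarith
  obtain ⟨s, node, w, hnode, hw, hsum⟩ := exists_nodes_det_one_add (E := E) t₀ ht₀
  have hsmall : ∀ t, 0 < t → t ≤ t₀ → t * K < 1 ∧ t * K < η := fun t _ ht2 => by
    have h1 : t * K ≤ t₀ * K := by gcongr
    exact ⟨lt_of_le_of_lt h1 (ht₀K.trans_le (min_le_left _ _)),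
      lt_of_le_of_lt h1 (ht₀K.trans_le (min_le_right _ _))⟩
  have hfin : μ (Metric.ball (0 : E) 1) ≠ ⊤ := Metric.isBounded_ball.measure_lt_top.ne
  have hintegrable : ∀ t : ℝ, IntegrableOn (fun x => (1 + t • fderiv ℝ g x).det)
      (Metric.ball (0 : E) 1) μ := by
    intro t
    refine IntegrableOn.mono_set (t := Metric.closedBall (0 : E) 1) ?_ Metric.ball_subset_closedBall
    refine ContinuousOn.integrableOn_compact (isCompact_closedBall _ _) ?_
    intro x hx
    have h1 : ContinuousAt (fderiv ℝ g) x := (hgC x hx).continuousAt_fderiv one_ne_zero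
    have h2 : ContinuousAt (fun y => (1 : E →L[ℝ] E) + t • fderiv ℝ g y) x :=
      continuousAt_const.add (h1.const_smul t)
    exact (ContinuousLinearMap.continuous_det.continuousAt.comp h2).continuousWithinAt
  have hvolume : ∀ t, 0 < t → t ≤ t₀ →
      ∫ x in Metric.ball (0 : E) 1, (1 + t • fderiv ℝ g x).det ∂μ
        = μ.real (Metric.ball (0 : E) 1) := by
    intro t ht ht2
    obtain ⟨hinj, himg⟩ := image_ball_of_small_lipschitz hK hg0 ht (hsmall t ht ht2).1
    have hd : ∀ x ∈ Metric.ball (0 : E) 1, HasFDerivWithinAt (fun x => x + t • g x)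
        (1 + t • fderiv ℝ g x) (Metric.ball 0 1) x := fun x hx =>
      ((hasFDerivAt_id x).add ((hgd x hx).const_smul t)).hasFDerivWithinAt
    have h := integral_image_eq_integral_abs_det_fderiv_smul μ Metric.isOpen_ball.measurableSet
      hd hinj (fun _ => (1 : ℝ))
    rw [himg] at h
    simp only [integral_const, smul_eq_mul, mul_one, MeasurableSet.univ,
      measureReal_restrict_apply, univ_inter] at h
    rw [h]
    refine setIntegral_congr_fun Metric.isOpen_ball.measurableSet fun x hx => ?_
    refine (abs_of_pos (hdet ?_)).symm
    rw [dist_eq_norm, add_sub_cancel_left, norm_smul, Real.norm_eq_abs, abs_of_pos ht]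
    refine lt_of_le_of_lt ?_ (hsmall t ht ht2).2
    gcongr
    exact hnorm x hx
  have hone : ∫ x in Metric.ball (0 : E) 1, (1 + fderiv ℝ g x).det ∂μ
      = μ.real (Metric.ball (0 : E) 1) := by
    have h1 : ∀ x, (1 + fderiv ℝ g x).det = ∑ i ∈ s, w i * (1 + node i • fderiv ℝ g x).det :=
      fun x => hsum _
    simp_rw [h1]
    rw [integral_finsetSum _ fun i _ => ((hintegrable (node i)).const_mul (w i))]
    calc ∑ i ∈ s, ∫ x in Metric.ball (0 : E) 1, w i * (1 + node i • fderiv ℝ g x).det ∂μ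
        = ∑ i ∈ s, w i * μ.real (Metric.ball (0 : E) 1) := by
          refine Finset.sum_congr rfl fun i hi => ?_
          rw [integral_const_mul, hvolume _ (hnode i hi).1 (hnode i hi).2]
      _ = _ := by rw [← Finset.sum_mul, hw, one_mul]
  have hzero : ∀ x ∈ Metric.ball (0 : E) 1, (1 + fderiv ℝ g x).det = 0 := by
    intro x hx
    have hrd : HasFDerivAt r (1 + fderiv ℝ g x) x := by
      have h := (hasFDerivAt_id x).add (hgd x hx)
      refine h.congr_of_eventuallyEq (Filter.Eventually.of_forall fun y => ?_)
      simp [g]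
    by_contra hne
    have hin : HasFDerivAt (fun y => inner ℝ (r y) (r y)) _ x := hrd.inner ℝ hrd
    have hcst : HasFDerivAt (fun y => inner ℝ (r y) (r y)) (0 : E →L[ℝ] ℝ) x := by
      refine (hasFDerivAt_const (1 : ℝ) x).congr_of_eventuallyEq ?_
      filter_upwards [Metric.isOpen_ball.mem_nhds hx] with y hy
      rw [real_inner_self_eq_norm_sq, hr1 y (hball y hy), one_pow]
    have heq := hin.unique hcst
    obtain ⟨y, hy⟩ := (ContinuousLinearMap.toContinuousLinearEquivOfDetNeZero _ hne).surjective (r x)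
    rw [ContinuousLinearMap.toContinuousLinearEquivOfDetNeZero_apply] at hy
    have h2 := congrArg (fun L : E →L[ℝ] ℝ => L y) heq
    simp only [ContinuousLinearMap.comp_apply, ContinuousLinearMap.prod_apply,
      fderivInnerCLM_apply, hy, real_inner_self_eq_norm_sq, hr1 x (hball x hx),
      zero_apply] at h2
    norm_num at h2
  rw [setIntegral_eq_zero_of_forall_eq_zero hzero] at hone
  have hpos : 0 < μ.real (Metric.ball (0 : E) 1) :=
    ENNReal.toReal_pos (Metric.measure_ball_pos μ 0 one_pos).ne' hfin
  exact hpos.ne hone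

/-- Brouwer's theorem for smooth self-maps of the unit ball. -/
lemma exists_fixedPoint_of_contDiff {f : E → E} (hf : ContDiff ℝ 1 f) (hf1 : ∀ x, ‖f x‖ ≤ 1) :
    ∃ x, ‖x‖ ≤ 1 ∧ f x = x := by
  by_contra hno
  push Not at hno
  let w : E → E := fun x => x - f x
  let a : E → ℝ := fun x => inner ℝ (w x) (w x)
  let b : E → ℝ := fun x => inner ℝ x (w x)
  let d : E → ℝ := fun x => b x ^ 2 + a x * (1 - inner ℝ x x)
  let r : E → E := fun x => x + ((-b x + √(d x)) / a x) • w x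
  have hw : ContDiff ℝ 1 w := contDiff_id.sub hf
  have ha : ContDiff ℝ 1 a := hw.inner ℝ hw
  have hb : ContDiff ℝ 1 b := contDiff_id.inner ℝ hw
  have hd : ContDiff ℝ 1 d := (hb.pow 2).add (ha.mul (contDiff_const.sub (contDiff_id.inner ℝ contDiff_id)))
  have hapos : ∀ x, ‖x‖ ≤ 1 → 0 < a x := fun x hx => by
    have : w x ≠ 0 := fun h => hno x hx (sub_eq_zero.1 h).symm
    simp only [a]
    rw [real_inner_self_eq_norm_sq]
    have := norm_pos_iff.2 this
    positivity
  have hbpos : ∀ x, ‖x‖ = 1 → 0 < b x := fun x hx => by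
    have h1 := hapos x hx.le
    have h2 : a x = ‖x‖ ^ 2 - 2 * inner ℝ x (f x) + ‖f x‖ ^ 2 := by
      simp only [a, w]; rw [real_inner_self_eq_norm_sq, norm_sub_sq_real]
    have h3 : b x = ‖x‖ ^ 2 - inner ℝ x (f x) := by
      simp only [b, w]; rw [inner_sub_right, real_inner_self_eq_norm_sq]
    have h4 := hf1 x
    have h5 : ‖f x‖ ^ 2 ≤ 1 := by nlinarith [norm_nonneg (f x)]
    rw [hx] at h2 h3
    nlinarith
  have hdpos : ∀ x, ‖x‖ ≤ 1 → 0 < d x := fun x hx => by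
    simp only [d]
    rw [real_inner_self_eq_norm_sq]
    rcases hx.lt_or_eq with h | h
    · have h1 : 0 < 1 - ‖x‖ ^ 2 := by nlinarith [norm_nonneg x]
      have := mul_pos (hapos x hx) h1
      positivity
    · have := hbpos x h
      rw [h]
      simp only [one_pow, sub_self, mul_zero, add_zero]
      positivity
  refine no_contDiff_retraction (r := r) ?_ ?_ ?_
  · intro x hx
    have hx : ‖x‖ ≤ 1 := by simpa using hx
    exact contDiffAt_id.add (((hb.contDiffAt.neg.add
      (hd.contDiffAt.sqrt (hdpos x hx).ne')).div ha.contDiffAt (hapos x hx).ne').smul hw.contDiffAt)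
  · intro x hx
    have hx : ‖x‖ ≤ 1 := by simpa using hx
    have h1 : ‖r x‖ ^ 2 = 1 := by
      have ha0 := (hapos x hx).ne'
      have hs := Real.sq_sqrt (hdpos x hx).le
      have : ‖r x‖ ^ 2 = inner ℝ x x + 2 * ((-b x + √(d x)) / a x) * b x
          + ((-b x + √(d x)) / a x) ^ 2 * a x := by
        simp only [r, a, b]
        rw [norm_add_sq_real, inner_smul_right, norm_smul, mul_pow, Real.norm_eq_abs, sq_abs,
          real_inner_self_eq_norm_sq, real_inner_self_eq_norm_sq]
        ring
      rw [this]
      field_simp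
      have hd' : d x = b x ^ 2 + a x * (1 - inner ℝ x x) := rfl
      nlinarith
    nlinarith [norm_nonneg (r x)]
  · intro x hx
    have h1 : d x = b x ^ 2 := by
      simp only [d]
      rw [real_inner_self_eq_norm_sq, hx]; ring
    simp only [r]
    rw [h1, Real.sqrt_sq (hbpos x hx).le]
    simp

/-- Brouwer's theorem: a continuous map into the unit ball has a fixed point. -/
theorem exists_fixedPoint_of_continuous {f : E → E} (hf : Continuous f) (hf1 : ∀ x, ‖f x‖ ≤ 1) :
    ∃ x, f x = x := by
  by_contra hno
  push Not at hno
  obtain ⟨x₀, -, hx₀⟩ := (isCompact_closedBall (0 : E) 1).exists_isMinOn ⟨0, by simp⟩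
    (f := fun x => ‖f x - x‖) (by fun_prop)
  set m := ‖f x₀ - x₀‖ with hm
  have hmpos : 0 < m := norm_pos_iff.2 (sub_ne_zero.2 (hno x₀))
  obtain ⟨g, hg, hgd, -⟩ := hf.exists_contDiff_approx 1 (ε := fun _ => m / 4)
    continuous_const (fun _ => by positivity)
  obtain ⟨x, hx1, hx⟩ := exists_fixedPoint_of_contDiff (f := fun x => (1 + m / 4)⁻¹ • g x)
    ((by exact_mod_cast hg : ContDiff ℝ 1 g).const_smul _) (fun x => by
      have h1 := hgd x
      rw [dist_eq_norm] at h1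
      have h2 : ‖g x‖ ≤ 1 + m / 4 := by
        calc ‖g x‖ = ‖f x + (g x - f x)‖ := by congr 1; abel
          _ ≤ ‖f x‖ + ‖g x - f x‖ := norm_add_le _ _
          _ ≤ _ := by linarith [hf1 x]
      rw [norm_smul, norm_inv, Real.norm_eq_abs, abs_of_pos (by positivity), inv_mul_le_iff₀ (by positivity)]
      linarith)
  have h3 : m ≤ ‖f x - x‖ := hx₀ (by simpa using hx1)
  have h4 : g x = (1 + m / 4) • x := by
    rw [← hx, smul_smul, mul_inv_cancel₀ (by positivity), one_smul, hx]
  have h5 := hgd x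
  rw [dist_eq_norm, h4] at h5
  have h6 : ‖f x - x‖ ≤ m / 4 + m / 4 := by
    calc ‖f x - x‖ = ‖(m / 4) • x - ((1 + m / 4) • x - f x)‖ := by congr 1; module
      _ ≤ ‖(m / 4) • x‖ + ‖(1 + m / 4) • x - f x‖ := norm_sub_le _ _
      _ ≤ m / 4 * 1 + m / 4 := by
        rw [norm_smul, Real.norm_eq_abs, abs_of_pos (by positivity)]
        gcongr
      _ = _ := by ring
  linarith

/-- Coordinatewise truncation to `[lo, hi]`. -/
def clampTo (lo hi x : ℝ) : ℝ := max lo (min x hi)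

lemma clampTo_mem {lo hi : ℝ} (h : lo ≤ hi) (x : ℝ) : clampTo lo hi x ∈ Icc lo hi :=
  ⟨le_max_left _ _, max_le h (min_le_right _ _)⟩

lemma clampTo_of_mem {lo hi x : ℝ} (h : x ∈ Icc lo hi) : clampTo lo hi x = x := by
  rw [clampTo, min_eq_left h.2, max_eq_right h.1]

lemma continuous_clampTo (lo hi : ℝ) : Continuous (clampTo lo hi) := by
  unfold clampTo; fun_prop

/-- Brouwer's theorem on a finite-dimensional box. -/
lemma exists_fixedPoint_box {ι : Type*} [Fintype ι] {lo hi : ι → ℝ} (hle : ∀ j, lo j ≤ hi j)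
    {T : (ι → ℝ) → ι → ℝ} (hT : ContinuousOn T {x | ∀ j, x j ∈ Icc (lo j) (hi j)})
    (hmem : ∀ x, (∀ j, x j ∈ Icc (lo j) (hi j)) → ∀ j, T x j ∈ Icc (lo j) (hi j)) :
    ∃ x, (∀ j, x j ∈ Icc (lo j) (hi j)) ∧ T x = x := by
  let cl : (ι → ℝ) → ι → ℝ := fun x j => clampTo (lo j) (hi j) (x j)
  have hcl : Continuous cl :=
    continuous_pi fun j => (continuous_clampTo _ _).comp (continuous_apply j)
  have hclm : ∀ x j, cl x j ∈ Icc (lo j) (hi j) := fun x j => clampTo_mem (hle j) _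
  have hTc : Continuous (T ∘ cl) := hT.comp_continuous hcl hclm
  let e := EuclideanSpace.equiv ι ℝ
  obtain ⟨R, hR, hbd⟩ : ∃ R : ℝ, 0 < R ∧ ∀ x, ‖e.symm (T (cl x))‖ ≤ R := by
    have hcomp : IsCompact {x : ι → ℝ | ∀ j, x j ∈ Icc (lo j) (hi j)} := by
      have : {x : ι → ℝ | ∀ j, x j ∈ Icc (lo j) (hi j)} = Set.pi univ fun j => Icc (lo j) (hi j) := by
        ext; simp only [mem_univ_pi, mem_ofPred_eq]
      rw [this]
      exact isCompact_univ_pi fun j => isCompact_Icc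
    obtain ⟨R, hR⟩ := (hcomp.image e.symm.continuous).isBounded.exists_norm_le
    exact ⟨max R 1, by positivity, fun x => (hR _ ⟨_, hmem _ (hclm x), rfl⟩).trans (le_max_left _ _)⟩
  obtain ⟨y, hy⟩ := exists_fixedPoint_of_continuous
    (f := fun y : EuclideanSpace ℝ ι => R⁻¹ • e.symm (T (cl (e (R • y)))))
    (by
      have : Continuous fun y : EuclideanSpace ℝ ι => R⁻¹ • e.symm ((T ∘ cl) (e (R • y))) :=
        (continuous_const_smul R⁻¹).comp
          (e.symm.continuous.comp (hTc.comp (e.continuous.comp (continuous_const_smul R))))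
      exact this)
    (fun y => by
      rw [norm_smul, norm_inv, Real.norm_eq_abs, abs_of_pos hR, inv_mul_le_iff₀ hR, mul_one]
      exact hbd _)
  have hy2 : T (cl (e (R • y))) = e (R • y) := by
    have h : e.symm (T (cl (e (R • y)))) = R • y := by
      conv_rhs => rw [← hy]
      rw [smul_smul, mul_inv_cancel₀ hR.ne', one_smul]
    have h2 := congrArg e h
    rwa [e.apply_symm_apply] at h2
  have hm : ∀ j, e (R • y) j ∈ Icc (lo j) (hi j) := fun j => by
    rw [← hy2]; exact hmem _ (hclm _) j
  refine ⟨e (R • y), hm, ?_⟩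
  have : cl (e (R • y)) = e (R • y) := funext fun j => clampTo_of_mem (hm j)
  rwa [this] at hy2

/-- The Poincaré–Miranda theorem on a (possibly infinite-dimensional) Hilbert cube. -/
theorem exists_zero_of_box {ι : Type*} {lo hi : ι → ℝ} (hle : ∀ j, lo j ≤ hi j)
    {F : (ι → ℝ) → ι → ℝ}
    (hF : ∀ j, ContinuousOn (fun x => F x j) {x | ∀ j, x j ∈ Icc (lo j) (hi j)})
    (hlo : ∀ x, (∀ j, x j ∈ Icc (lo j) (hi j)) → ∀ j, x j = lo j → 0 ≤ F x j)
    (hhi : ∀ x, (∀ j, x j ∈ Icc (lo j) (hi j)) → ∀ j, x j = hi j → F x j ≤ 0) :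
    ∃ x, (∀ j, x j ∈ Icc (lo j) (hi j)) ∧ ∀ j, F x j = 0 := by
  classical
  set B : Set (ι → ℝ) := {x | ∀ j, x j ∈ Icc (lo j) (hi j)} with hB
  have hBc : IsCompact B := by
    have : B = Set.pi univ fun j => Icc (lo j) (hi j) := by
      ext; simp only [mem_univ_pi, mem_ofPred_eq, hB]
    rw [this]
    exact isCompact_univ_pi fun j => isCompact_Icc
  let T : ι → (ι → ℝ) → ℝ := fun j x => clampTo (lo j) (hi j) (x j + F x j)
  have hTc : ∀ j, ContinuousOn (T j) B := fun j =>
    (continuous_clampTo _ _).comp_continuousOn ((continuous_apply j).continuousOn.add (hF j))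
  let K : Finset ι → Set (ι → ℝ) := fun s => {x ∈ B | ∀ j ∈ s, T j x = x j}
  have hKeq : ∀ s, K s = B ∩ ⋂ j ∈ s, {x ∈ B | T j x = x j} := by
    intro s; ext x; simp only [K, mem_ofPred_eq, mem_inter_iff, mem_iInter]
    constructor
    · rintro ⟨h1, h2⟩; exact ⟨h1, fun j hj => ⟨h1, h2 j hj⟩⟩
    · rintro ⟨h1, h2⟩; exact ⟨h1, fun j hj => (h2 j hj).2⟩
  have hKclosed : ∀ s, IsClosed (K s) := by
    intro s
    rw [hKeq]
    refine hBc.isClosed.inter (isClosed_biInter fun j _ => ?_)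
    have hc : ContinuousOn (fun x => T j x - x j) B :=
      (hTc j).sub (continuous_apply j).continuousOn
    have := hc.preimage_isClosed_of_isClosed hBc.isClosed (isClosed_singleton (x := (0 : ℝ)))
    convert this using 1
    ext x; simp [sub_eq_zero]
  have hKne : ∀ s, (K s).Nonempty := by
    intro s
    let ext : (s → ℝ) → ι → ℝ := fun y j => if h : j ∈ s then y ⟨j, h⟩ else lo j
    have hext : Continuous ext := by
      refine continuous_pi fun j => ?_
      by_cases h : j ∈ s
      · simp only [ext, h, dite_true]; exact continuous_apply _
      · simp only [ext, h, dite_false]; exact continuous_const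
    have hextB : ∀ y : s → ℝ, (∀ j : s, y j ∈ Icc (lo j) (hi j)) → ext y ∈ B := by
      intro y hy j
      by_cases h : j ∈ s
      · simp only [ext, h, dite_true]; exact hy ⟨j, h⟩
      · simp only [ext, h, dite_false]; exact ⟨le_rfl, hle j⟩
    obtain ⟨y, hy, hfix⟩ := exists_fixedPoint_box (ι := s) (lo := fun j => lo j)
      (hi := fun j => hi j) (fun j => hle j) (T := fun y j => T j (ext y))
      (continuousOn_pi.2 fun j => (hTc j).comp hext.continuousOn fun y hy => hextB y hy)
      (fun y hy j => clampTo_mem (hle j) _)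
    refine ⟨ext y, hextB y hy, fun j hj => ?_⟩
    have h := congrFun hfix ⟨j, hj⟩
    simp only at h
    rw [h]; simp [ext, hj]
  have hanti : Antitone K := fun s t hst x hx => ⟨hx.1, fun j hj => hx.2 j (hst hj)⟩
  obtain ⟨x, hx⟩ := IsCompact.nonempty_iInter_of_directed_nonempty_isCompact_isClosed K
    hanti.directed_ge hKne
    (fun s => hBc.of_isClosed_subset (hKclosed s) fun x hx => hx.1) hKclosed
  have hxK : ∀ s, x ∈ K s := fun s => mem_iInter.1 hx s
  have hxB : x ∈ B := (hxK ∅).1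
  refine ⟨x, hxB, fun j => ?_⟩
  have hfix : clampTo (lo j) (hi j) (x j + F x j) = x j := (hxK {j}).2 j (by simp)
  have hj := hxB j
  unfold clampTo at hfix
  rcases lt_trichotomy (F x j) 0 with h | h | h
  · rcases hj.1.eq_or_lt with h1 | h1
    · exact absurd (hlo x hxB j h1.symm) (not_le.2 h)
    · rw [min_eq_left (by linarith [hj.2])] at hfix
      rcases max_choice (lo j) (x j + F x j) with h2 | h2 <;> rw [h2] at hfix <;> linarith
  · exact h
  · rcases hj.2.eq_or_lt with h1 | h1
    · exact absurd (hhi x hxB j h1) (not_le.2 h)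
    · rw [max_eq_right (le_min (by linarith [hj.1]) (hle j))] at hfix
      rcases min_choice (x j + F x j) (hi j) with h2 | h2 <;> rw [h2] at hfix <;> linarith

end Brouwer

section NearIdentity

/-- The near-identity map `z + ∑ aⱼ (z^(j+2) - z)` with real coefficients; it fixes `0` and `1`. -/
noncomputable def betaC (a : ℕ → ℝ) (z : ℂ) : ℂ := z + ∑' j, (a j : ℂ) * (z ^ (j + 2) - z)

/-- The restriction of `betaC` to the real line. -/
noncomputable def betaR (a : ℕ → ℝ) (x : ℝ) : ℝ := x + ∑' j, a j * (x ^ (j + 2) - x)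

/-- The coefficient bound which keeps `betaC a` close to the identity. -/
def SmallCoeff (a : ℕ → ℝ) : Prop := ∀ j, |a j| ≤ 1 / 20000 * (1 / 4) ^ (j + 2)

/-- A summable majorant for the terms of `betaC` on the disc of radius `3`. -/
noncomputable def betaMajorant (j : ℕ) : ℝ :=
  1 / 20000 * (9 / 16 * (3 / 4) ^ j + 3 / 16 * (1 / 4) ^ j)

lemma hasSum_betaMajorant : HasSum betaMajorant (1 / 8000) := by
  have h1 := (hasSum_geometric_of_lt_one (r := 3 / 4) (by norm_num) (by norm_num)).mul_left (9 / 16)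
  have h2 := (hasSum_geometric_of_lt_one (r := 1 / 4) (by norm_num) (by norm_num)).mul_left (3 / 16)
  have h := (h1.add h2).mul_left (1 / 20000)
  have e : (1 / 20000 * (9 / 16 * (1 - 3 / 4)⁻¹ + 3 / 16 * (1 - 1 / 4)⁻¹) : ℝ) = 1 / 8000 := by
    norm_num
  rw [e] at h
  exact h

lemma norm_beta_term_le {a : ℕ → ℝ} (ha : SmallCoeff a) {z : ℂ} (hz : ‖z‖ ≤ 3) (j : ℕ) :
    ‖(a j : ℂ) * (z ^ (j + 2) - z)‖ ≤ betaMajorant j := by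
  rw [norm_mul, Complex.norm_real, Real.norm_eq_abs]
  have h1 : ‖z ^ (j + 2) - z‖ ≤ 3 ^ (j + 2) + 3 := by
    refine (norm_sub_le _ _).trans ?_
    rw [norm_pow]
    gcongr
  calc |a j| * ‖z ^ (j + 2) - z‖ ≤ 1 / 20000 * (1 / 4) ^ (j + 2) * (3 ^ (j + 2) + 3) := by
        gcongr; exact ha j
    _ = betaMajorant j := by
        have h : (3 / 4 : ℝ) ^ j = (1 / 4) ^ j * 3 ^ j := by rw [← mul_pow]; norm_num
        rw [betaMajorant, h, pow_add, pow_add]; ring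

lemma betaC_ofReal (a : ℕ → ℝ) (x : ℝ) : betaC a x = betaR a x := by
  simp [betaC, betaR, Complex.ofReal_tsum]

@[simp] lemma betaR_zero (a : ℕ → ℝ) : betaR a 0 = 0 := by simp [betaR]

@[simp] lemma betaR_one (a : ℕ → ℝ) : betaR a 1 = 1 := by simp [betaR]

lemma continuousOn_betaC :
    ContinuousOn (fun p : (ℕ → ℝ) × ℂ => betaC p.1 p.2) {p | SmallCoeff p.1 ∧ ‖p.2‖ ≤ 3} := by
  unfold betaC
  refine continuousOn_snd.add (continuousOn_tsum (u := betaMajorant) (fun j => ?_)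
    hasSum_betaMajorant.summable fun j p hp => norm_beta_term_le hp.1 hp.2 j)
  fun_prop

lemma differentiableOn_betaC {a : ℕ → ℝ} (ha : SmallCoeff a) :
    DifferentiableOn ℂ (betaC a) (Metric.ball 0 3) := by
  refine differentiableOn_id.add (Complex.differentiableOn_tsum_of_summable_norm
    hasSum_betaMajorant.summable (fun j => by fun_prop) Metric.isOpen_ball fun j z hz => ?_)
  exact norm_beta_term_le ha (mem_ball_zero_iff.1 hz).le j

lemma norm_betaC_sub_le {a : ℕ → ℝ} (ha : SmallCoeff a) {z : ℂ} (hz : ‖z‖ ≤ 3) :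
    ‖betaC a z - z‖ ≤ 1 / 8000 := by
  rw [betaC, add_sub_cancel_left]
  exact tsum_of_norm_bounded hasSum_betaMajorant (norm_beta_term_le ha hz)

lemma differentiableAt_betaC {a : ℕ → ℝ} (ha : SmallCoeff a) {z : ℂ} (hz : ‖z‖ < 3) :
    DifferentiableAt ℂ (betaC a) z :=
  (differentiableOn_betaC ha).differentiableAt
    (Metric.isOpen_ball.mem_nhds (mem_ball_zero_iff.2 hz))

lemma norm_iteratedDeriv_betaC_sub_le {a : ℕ → ℝ} (ha : SmallCoeff a) {z : ℂ} (hz : ‖z‖ < 2)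
    (n : ℕ) : ‖iteratedDeriv n (fun w => betaC a w - w) z‖ ≤ n.factorial / 8000 := by
  have hsub : Metric.closedBall z 1 ⊆ Metric.ball 0 3 := by
    intro w hw
    rw [mem_ball_zero_iff]
    have h1 : ‖w - z‖ ≤ 1 := by simpa [dist_eq_norm] using hw
    calc ‖w‖ = ‖z + (w - z)‖ := by congr 1; ring
      _ ≤ ‖z‖ + ‖w - z‖ := norm_add_le _ _
      _ < 3 := by linarith
  have hd : DifferentiableOn ℂ (fun w => betaC a w - w) (Metric.closedBall z 1) :=
    ((differentiableOn_betaC ha).sub differentiableOn_id).mono hsub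
  have h := Complex.norm_iteratedDeriv_le_of_forall_mem_sphere_norm_le (C := 1 / 8000) n one_pos
    (hd.diffContOnCl_ball subset_rfl) (fun w hw => norm_betaC_sub_le ha
      (mem_ball_zero_iff.1 (hsub (Metric.sphere_subset_closedBall hw))).le)
  simpa [div_eq_mul_inv] using h

lemma deriv_betaC_sub {a : ℕ → ℝ} (ha : SmallCoeff a) {z : ℂ} (hz : ‖z‖ < 3) :
    deriv (fun w => betaC a w - w) z = deriv (betaC a) z - 1 := by
  exact ((differentiableAt_betaC ha hz).hasDerivAt.sub (hasDerivAt_id z)).deriv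

lemma norm_deriv_betaC_sub_one_le {a : ℕ → ℝ} (ha : SmallCoeff a) {z : ℂ} (hz : ‖z‖ < 2) :
    ‖deriv (betaC a) z - 1‖ ≤ 1 / 1000 := by
  have h := norm_iteratedDeriv_betaC_sub_le ha hz 1
  rw [iteratedDeriv_one, deriv_betaC_sub ha (by linarith)] at h
  refine h.trans ?_
  norm_num

lemma isOpen_norm_lt (r : ℝ) : IsOpen {z : ℂ | ‖z‖ < r} := isOpen_lt continuous_norm continuous_const

lemma eventuallyEq_deriv_betaC {a : ℕ → ℝ} (ha : SmallCoeff a) {z : ℂ} (hz : ‖z‖ < 2) :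
    deriv (fun w => betaC a w - w) =ᶠ[nhds z] fun w => deriv (betaC a) w - 1 := by
  filter_upwards [(isOpen_norm_lt 2).mem_nhds hz] with w hw
  exact deriv_betaC_sub ha (lt_trans hw (by norm_num))

lemma norm_deriv_deriv_betaC_le {a : ℕ → ℝ} (ha : SmallCoeff a) {z : ℂ} (hz : ‖z‖ < 2) :
    ‖deriv (deriv (betaC a)) z‖ ≤ 1 / 1000 := by
  have h := norm_iteratedDeriv_betaC_sub_le ha hz 2
  rw [iteratedDeriv_succ, iteratedDeriv_one, (eventuallyEq_deriv_betaC ha hz).deriv_eq,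
    deriv_sub_const] at h
  refine h.trans ?_
  norm_num [Nat.factorial]

lemma norm_deriv_deriv_deriv_betaC_le {a : ℕ → ℝ} (ha : SmallCoeff a) {z : ℂ} (hz : ‖z‖ < 2) :
    ‖deriv (deriv (deriv (betaC a))) z‖ ≤ 1 / 1000 := by
  have h := norm_iteratedDeriv_betaC_sub_le ha hz 3
  have h2 : deriv (deriv (fun w => betaC a w - w)) =ᶠ[nhds z] deriv (deriv (betaC a)) := by
    filter_upwards [(isOpen_norm_lt 2).mem_nhds hz] with w hw
    rw [(eventuallyEq_deriv_betaC ha hw).deriv_eq, deriv_sub_const]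
  rw [iteratedDeriv_succ, iteratedDeriv_succ, iteratedDeriv_one, h2.deriv_eq] at h
  refine h.trans ?_
  norm_num [Nat.factorial]

lemma contDiffOn_betaC {a : ℕ → ℝ} (ha : SmallCoeff a) (n : WithTop ℕ∞) :
    ContDiffOn ℂ n (betaC a) (Metric.ball 0 3) :=
  (differentiableOn_betaC ha).contDiffOn Metric.isOpen_ball

lemma convex_norm_lt (r : ℝ) : Convex ℝ {z : ℂ | ‖z‖ < r} := by
  have : {z : ℂ | ‖z‖ < r} = Metric.ball 0 r := by ext; simp
  rw [this]; exact convex_ball _ _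

lemma differentiableAt_deriv_betaC {a : ℕ → ℝ} (ha : SmallCoeff a) {z : ℂ} (hz : ‖z‖ < 3) :
    DifferentiableAt ℂ (deriv (betaC a)) z :=
  ((differentiableOn_betaC ha).deriv Metric.isOpen_ball).differentiableAt
    (Metric.isOpen_ball.mem_nhds (mem_ball_zero_iff.2 hz))

lemma differentiableAt_deriv_deriv_betaC {a : ℕ → ℝ} (ha : SmallCoeff a) {z : ℂ} (hz : ‖z‖ < 3) :
    DifferentiableAt ℂ (deriv (deriv (betaC a))) z :=
  (((differentiableOn_betaC ha).deriv Metric.isOpen_ball).deriv Metric.isOpen_ball).differentiableAt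
    (Metric.isOpen_ball.mem_nhds (mem_ball_zero_iff.2 hz))

/-- `betaC a` differs from the identity by a map of small Lipschitz constant. -/
lemma norm_betaC_sub_sub_le {a : ℕ → ℝ} (ha : SmallCoeff a) {z w : ℂ} (hz : ‖z‖ < 2)
    (hw : ‖w‖ < 2) : ‖betaC a z - betaC a w - (z - w)‖ ≤ 1 / 1000 * ‖z - w‖ := by
  have h := (convex_norm_lt 2).norm_image_sub_le_of_norm_deriv_le (𝕜 := ℂ)
    (f := fun w => betaC a w - w) (C := 1 / 1000) (x := w) (y := z)
    (fun x hx => (differentiableAt_betaC ha (lt_trans hx (by norm_num))).sub differentiableAt_id)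
    (fun x hx => by
      rw [deriv_betaC_sub ha (lt_trans hx (by norm_num))]
      exact norm_deriv_betaC_sub_one_le ha hx) hw hz
  have e : betaC a z - betaC a w - (z - w) = betaC a z - z - (betaC a w - w) := by ring
  rw [e]
  exact h

lemma norm_betaC_sub_le_mul {a : ℕ → ℝ} (ha : SmallCoeff a) {z w : ℂ} (hz : ‖z‖ < 2)
    (hw : ‖w‖ < 2) : ‖betaC a z - betaC a w‖ ≤ (1 + 1 / 1000) * ‖z - w‖ := by
  have h := norm_betaC_sub_sub_le ha hz hw
  calc ‖betaC a z - betaC a w‖ = ‖(betaC a z - betaC a w - (z - w)) + (z - w)‖ := by congr 1; ring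
    _ ≤ _ := (norm_add_le _ _).trans (by linarith)

lemma norm_betaC_taylor_le {a : ℕ → ℝ} (ha : SmallCoeff a) {z w : ℂ} (hz : ‖z‖ < 2)
    (hw : ‖w‖ < 2) :
    ‖betaC a z - betaC a w - deriv (betaC a) w * (z - w)‖ ≤ 1 / 1000 * ‖z - w‖ ^ 2 := by
  have hlip : ∀ x, ‖x‖ < 2 → ‖deriv (betaC a) x - deriv (betaC a) w‖ ≤ 1 / 1000 * ‖x - w‖ :=
    fun x hx => (convex_norm_lt 2).norm_image_sub_le_of_norm_deriv_le (𝕜 := ℂ)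
      (fun y hy => differentiableAt_deriv_betaC ha (lt_trans hy (by norm_num)))
      (fun y hy => norm_deriv_deriv_betaC_le ha hy) hw hx
  have hseg : ∀ x ∈ segment ℝ w z, ‖x‖ < 2 := fun x hx =>
    (convex_norm_lt 2).segment_subset hw hz hx
  have hd : ∀ x ∈ segment ℝ w z, DifferentiableAt ℂ (betaC a) x := fun x hx =>
    differentiableAt_betaC ha ((hseg x hx).trans (by norm_num))
  have h := (convex_segment w z).norm_image_sub_le_of_norm_deriv_le (𝕜 := ℂ)
    (f := fun x => betaC a x - deriv (betaC a) w * x) (C := 1 / 1000 * ‖z - w‖) (x := w) (y := z)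
    (fun x hx => (hd x hx).sub (differentiableAt_id.const_mul _))
    (fun x hx => by
      have hdx := ((hd x hx).hasDerivAt.sub ((hasDerivAt_id x).const_mul (deriv (betaC a) w))).deriv
      rw [mul_one] at hdx
      refine (congrArg norm hdx).trans_le ?_
      refine (hlip x (hseg x hx)).trans ?_
      have := norm_sub_le_of_mem_segment hx
      gcongr)
    (left_mem_segment _ _ _) (right_mem_segment _ _ _)
  calc _ = ‖betaC a z - deriv (betaC a) w * z - (betaC a w - deriv (betaC a) w * w)‖ := by
        congr 1; ring
    _ ≤ _ := h
    _ = _ := by ring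

lemma abs_betaR_sub_sub_le {a : ℕ → ℝ} (ha : SmallCoeff a) {x y : ℝ} (hx : |x| < 2)
    (hy : |y| < 2) : |betaR a x - betaR a y - (x - y)| ≤ 1 / 1000 * |x - y| := by
  have h := norm_betaC_sub_sub_le ha (z := x) (w := y) (by simpa using hx) (by simpa using hy)
  rw [betaC_ofReal, betaC_ofReal] at h
  have e1 : ((betaR a x : ℂ) - betaR a y - (x - y)) = ((betaR a x - betaR a y - (x - y) : ℝ) : ℂ) := by
    push_cast; ring
  have e2 : ((x : ℂ) - y) = ((x - y : ℝ) : ℂ) := by push_cast; ring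
  rw [e1, e2, Complex.norm_real, Complex.norm_real] at h
  exact h

lemma betaR_sub_ge {a : ℕ → ℝ} (ha : SmallCoeff a) {x y : ℝ} (hx : |x| < 2) (hy : |y| < 2)
    (hxy : y ≤ x) : 999 / 1000 * (x - y) ≤ betaR a x - betaR a y := by
  have h := abs_le.1 (abs_betaR_sub_sub_le ha hx hy)
  rw [abs_of_nonneg (sub_nonneg.2 hxy)] at h
  linarith [h.1]

lemma betaR_sub_le {a : ℕ → ℝ} (ha : SmallCoeff a) {x y : ℝ} (hx : |x| < 2) (hy : |y| < 2)
    (hxy : y ≤ x) : betaR a x - betaR a y ≤ 1001 / 1000 * (x - y) := by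
  have h := abs_le.1 (abs_betaR_sub_sub_le ha hx hy)
  rw [abs_of_nonneg (sub_nonneg.2 hxy)] at h
  linarith [h.2]

lemma abs_betaR_sub_le {a : ℕ → ℝ} (ha : SmallCoeff a) {x : ℝ} (hx : x ∈ Icc (0 : ℝ) 1) :
    |betaR a x - x| ≤ 1 / 1000 * (x * (1 - x)) := by
  have hx0 := hx.1
  have hx1 : 0 ≤ 1 - x := by linarith [hx.2]
  have hterm : ∀ j : ℕ, ‖a j * (x ^ (j + 2) - x)‖ ≤
      1 / 20000 * (1 / 16) * (x * (1 - x)) * (1 / 2) ^ j := by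
    intro j
    rw [norm_mul, Real.norm_eq_abs, Real.norm_eq_abs]
    have h1 := one_add_mul_le_pow (a := x - 1) (by linarith) (j + 1)
    rw [add_sub_cancel] at h1
    have h2 : x ^ (j + 1) ≤ 1 := pow_le_one₀ hx.1 hx.2
    have h3 : |x ^ (j + 2) - x| ≤ (j + 1) * (x * (1 - x)) := by
      have : x ^ (j + 2) - x = -(x * (1 - x ^ (j + 1))) := by ring
      rw [this, abs_neg, abs_of_nonneg (mul_nonneg hx0 (by linarith))]
      push_cast at h1
      nlinarith
    have h4 : ((j : ℝ) + 1) ≤ 2 ^ j := by exact_mod_cast Nat.lt_two_pow_self (n := j)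
    calc |a j| * |x ^ (j + 2) - x| ≤ 1 / 20000 * (1 / 4) ^ (j + 2) * (2 ^ j * (x * (1 - x))) := by
          have : 0 ≤ x * (1 - x) := mul_nonneg hx0 hx1
          gcongr
          · exact ha j
          · exact h3.trans (by gcongr)
      _ = _ := by
          have h : (1 / 2 : ℝ) ^ j = (1 / 4) ^ j * 2 ^ j := by rw [← mul_pow]; norm_num
          rw [h, pow_add]; ring
  rw [betaR, add_sub_cancel_left, ← Real.norm_eq_abs]
  refine (tsum_of_norm_bounded ((hasSum_geometric_of_lt_one (r := 1 / 2) (by norm_num)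
    (by norm_num)).mul_left _) hterm).trans ?_
  have : 0 ≤ x * (1 - x) := mul_nonneg hx0 hx1
  norm_num
  nlinarith

end NearIdentity

section InverseBranch

lemma norm_cpow_le_of_near_one {w : ℂ} (hw : ‖w - 1‖ ≤ 1 / 10) {p : ℝ} (hp : -2 ≤ p) (hp0 : p ≤ 0) :
    ‖w ^ (p : ℂ)‖ ≤ 100 / 81 := by
  have h1 : 9 / 10 ≤ ‖w‖ := by
    have : ‖(1 : ℂ)‖ ≤ ‖w‖ + ‖w - 1‖ := by
      calc ‖(1 : ℂ)‖ = ‖w - (w - 1)‖ := by congr 1; ring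
        _ ≤ _ := norm_sub_le _ _
    rw [norm_one] at this
    linarith
  have hw0 : w ≠ 0 := norm_pos_iff.1 (by linarith)
  rw [Complex.norm_cpow_of_ne_zero hw0]
  simp only [Complex.ofReal_re, Complex.ofReal_im, mul_zero, Real.exp_zero, div_one]
  calc ‖w‖ ^ p ≤ (9 / 10 : ℝ) ^ p := Real.rpow_le_rpow_of_nonpos (by norm_num) h1 hp0
    _ ≤ (9 / 10 : ℝ) ^ (-2 : ℝ) :=
        Real.rpow_le_rpow_of_exponent_ge (by norm_num) (by norm_num) hp
    _ = 100 / 81 := by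
        rw [Real.rpow_neg (by norm_num), Real.rpow_two]; norm_num

lemma mem_slitPlane_of_near_one {w : ℂ} (hw : ‖w - 1‖ ≤ 1 / 10) : w ∈ Complex.slitPlane := by
  left
  have h := (Complex.abs_re_le_norm (w - 1)).trans hw
  simp only [Complex.sub_re, Complex.one_re] at h
  linarith [(abs_le.1 h).1]

lemma convex_near_one : Convex ℝ {w : ℂ | ‖w - 1‖ ≤ 1 / 10} := by
  have : {w : ℂ | ‖w - 1‖ ≤ 1 / 10} = Metric.closedBall 1 (1 / 10) := by
    ext; simp [dist_eq_norm]
  rw [this]; exact convex_closedBall _ _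

lemma hasDerivAt_cpow_of_near_one {w : ℂ} (hw : ‖w - 1‖ ≤ 1 / 10) (p : ℂ) :
    HasDerivAt (fun z : ℂ => z ^ p) (p * w ^ (p - 1)) w := by
  simpa using (hasDerivAt_id w).cpow_const (c := p) (mem_slitPlane_of_near_one hw)

lemma norm_cpow_sub_one_le {w : ℂ} (hw : ‖w - 1‖ ≤ 1 / 10) {p : ℝ} (hp : -1 ≤ p) (hp1 : p ≤ 1) :
    ‖w ^ (p : ℂ) - 1‖ ≤ |p| * (100 / 81) * ‖w - 1‖ := by
  have h := convex_near_one.norm_image_sub_le_of_norm_hasDerivWithin_le (𝕜 := ℂ)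
    (f := fun z : ℂ => z ^ (p : ℂ)) (f' := fun z => p * z ^ ((p : ℂ) - 1))
    (C := |p| * (100 / 81)) (x := 1) (y := w)
    (fun x hx => (hasDerivAt_cpow_of_near_one hx _).hasDerivWithinAt)
    (fun x hx => by
      have e : ((p : ℂ) - 1) = ((p - 1 : ℝ) : ℂ) := by push_cast; ring
      rw [norm_mul, Complex.norm_real, Real.norm_eq_abs, e]
      gcongr
      exact norm_cpow_le_of_near_one hx (by linarith) (by linarith))
    (show ‖(1 : ℂ) - 1‖ ≤ 1 / 10 by norm_num) hw
  simpa using h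

lemma norm_cpow_taylor_le {w : ℂ} (hw : ‖w - 1‖ ≤ 1 / 10) {s : ℝ} (hs : 0 < s) (hs1 : s < 1 / 2) :
    ‖w ^ (s : ℂ) - 1 - s * (w - 1)‖ ≤ 2 * s * ‖w - 1‖ ^ 2 := by
  have hseg : ∀ x ∈ segment ℝ 1 w, ‖x - 1‖ ≤ 1 / 10 := fun x hx =>
    convex_near_one.segment_subset (by norm_num) hw hx
  have h := (convex_segment 1 w).norm_image_sub_le_of_norm_hasDerivWithin_le (𝕜 := ℂ)
    (f := fun z : ℂ => z ^ (s : ℂ) - s * z) (f' := fun z => s * z ^ ((s : ℂ) - 1) - s * 1)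
    (C := 2 * s * ‖w - 1‖) (x := 1) (y := w)
    (fun x hx => ((hasDerivAt_cpow_of_near_one (hseg x hx) _).sub
      ((hasDerivAt_id x).const_mul _)).hasDerivWithinAt)
    (fun x hx => by
      have e : ((s : ℂ) - 1) = ((s - 1 : ℝ) : ℂ) := by push_cast; ring
      rw [← mul_sub, norm_mul, Complex.norm_real, Real.norm_eq_abs, abs_of_pos hs, e]
      have h1 := norm_cpow_sub_one_le (hseg x hx) (p := s - 1) (by linarith) (by linarith)
      have h2 := norm_sub_le_of_mem_segment hx
      rw [abs_of_neg (by linarith : s - 1 < 0)] at h1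
      have h3 : ‖x ^ ((s - 1 : ℝ) : ℂ) - 1‖ ≤ 2 * ‖w - 1‖ := by
        refine h1.trans ?_
        have h4 : -(s - 1) * (100 / 81) ≤ 2 := by linarith
        gcongr
      calc s * ‖x ^ ((s - 1 : ℝ) : ℂ) - 1‖ ≤ s * (2 * ‖w - 1‖) := by gcongr
        _ = _ := by ring)
    (left_mem_segment _ _ _) (right_mem_segment _ _ _)
  calc _ = ‖w ^ (s : ℂ) - s * w - (1 ^ (s : ℂ) - s * 1)‖ := by
        rw [Complex.one_cpow]; congr 1; ring
    _ ≤ _ := h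
    _ = _ := by ring

lemma ofReal_mul_cpow {r : ℝ} (hr : 0 < r) {w : ℂ} (hw : w ≠ 0) (p : ℝ) :
    ((r : ℂ) * w) ^ (p : ℂ) = ((r ^ p : ℝ) : ℂ) * w ^ (p : ℂ) := by
  have hr' : (r : ℂ) ≠ 0 := by exact_mod_cast hr.ne'
  rw [Complex.ofReal_cpow hr.le, Complex.cpow_def_of_ne_zero (mul_ne_zero hr' hw),
    Complex.cpow_def_of_ne_zero hr', Complex.cpow_def_of_ne_zero hw, Complex.log_ofReal_mul hr hw,
    ← Complex.exp_add, Complex.ofReal_log hr.le, add_mul]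

/-- The affine part of an inverse branch. -/
noncomputable def levelC (v : ℝ) (a : ℕ → ℝ) (x : ℂ) : ℂ := 1 - (1 - betaC a x) / v

/-- The affine part of an inverse branch on the real line. -/
noncomputable def levelR (v : ℝ) (a : ℕ → ℝ) (x : ℝ) : ℝ := 1 - (1 - betaR a x) / v

/-- The inverse of the right branch of a Lorenz map with critical exponent `1 / s`. -/
noncomputable def invC (s c v : ℝ) (a : ℕ → ℝ) (x : ℂ) : ℂ :=
  c + (1 - c) * levelC v a x ^ (s : ℂ)

/-- The inverse of the right branch on the real line. -/
noncomputable def invR (s c v : ℝ) (a : ℕ → ℝ) (x : ℝ) : ℝ :=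
  c + (1 - c) * levelR v a x ^ s

/-- The derivative of `invC` at a real point. -/
noncomputable def multC (s c v : ℝ) (a : ℕ → ℝ) (x : ℝ) : ℂ :=
  (((1 - c) * s * levelR v a x ^ (s - 1) / v : ℝ) : ℂ) * deriv (betaC a) x

/-- The standing assumptions on the parameters of a branch. -/
structure BranchData (s c v : ℝ) (a : ℕ → ℝ) : Prop where
  s_pos : 0 < s
  s_lt : s < 1 / 2
  c_pos : 0 < c
  c_lt : c < 1
  v_pos : 0 < v
  v_le : v ≤ 1
  v_ge : 1 - c ≤ v * (1 - 9 / 10 * c)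
  small : SmallCoeff a

lemma levelC_ofReal (v : ℝ) (a : ℕ → ℝ) (x : ℝ) : levelC v a x = levelR v a x := by
  rw [levelC, betaC_ofReal, levelR]; push_cast; ring

lemma invC_ofReal {s c v : ℝ} {a : ℕ → ℝ} {x : ℝ} (h : 0 ≤ levelR v a x) :
    invC s c v a x = invR s c v a x := by
  rw [invC, invR, levelC_ofReal]
  push_cast
  rw [Complex.ofReal_cpow h]

namespace BranchData

variable {s c v : ℝ} {a : ℕ → ℝ}

lemma level_le_one (h : BranchData s c v a) {x : ℝ} (hx0 : 0 ≤ x) (hx : x ≤ 1) :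
    levelR v a x ≤ 1 := by
  have h1 := betaR_sub_ge h.small (x := 1) (y := x) (by norm_num) (by rw [abs_of_nonneg hx0]; linarith) hx
  rw [betaR_one] at h1
  have : 0 ≤ (1 - betaR a x) / v := div_nonneg (by linarith) h.v_pos.le
  unfold levelR; linarith

lemma level_ge (h : BranchData s c v a) {x : ℝ} (hx0 : c ≤ x) (hx : x ≤ 1) :
    899 / 1000 * x ≤ levelR v a x := by
  have hc := h.c_pos
  have hc1 := h.c_lt
  have h1 := (abs_le.1 (abs_betaR_sub_le h.small ⟨hc.le.trans hx0, hx⟩)).1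
  have h2 : (1 - betaR a x) / v ≤ 1 - 899 / 1000 * x := by
    rw [div_le_iff₀ h.v_pos]
    have hv := h.v_ge
    have hx1 : 0 ≤ 1 - x := by linarith
    -- `(1 - x) (1 - κ c) ≤ (1 - κ x) (1 - c)`
    have h3 : (1 - x) ≤ v * (1 - 9 / 10 * x) := by
      have h4 : (1 - x) * (1 - 9 / 10 * c) ≤ (1 - 9 / 10 * x) * (1 - c) := by nlinarith
      have h5 : (1 - 9 / 10 * x) * (1 - c) ≤ (1 - 9 / 10 * x) * (v * (1 - 9 / 10 * c)) := by
        apply mul_le_mul_of_nonneg_left hv; linarith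
      have h6 : 0 < 1 - 9 / 10 * c := by linarith
      by_contra hcon
      push Not at hcon
      nlinarith
    have h7 : 1 - betaR a x ≤ (1 - x) * (1 + 1 / 1000 * x) := by nlinarith
    have h8 : (1 - x) * (1 + 1 / 1000 * x) ≤ v * (1 - 9 / 10 * x) * (1 + 1 / 1000 * x) := by
      apply mul_le_mul_of_nonneg_right h3; linarith
    have h9 : (1 - 9 / 10 * x) * (1 + 1 / 1000 * x) ≤ 1 - 899 / 1000 * x := by nlinarith
    have := h.v_pos
    nlinarith
  unfold levelR; linarith

lemma level_pos (h : BranchData s c v a) {x : ℝ} (hx0 : c ≤ x) (hx : x ≤ 1) :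
    0 < levelR v a x :=
  lt_of_lt_of_le (by linarith [h.c_pos]) (h.level_ge hx0 hx)

lemma inv_mem (h : BranchData s c v a) {x : ℝ} (hx0 : c ≤ x) (hx : x ≤ 1) :
    c ≤ invR s c v a x ∧ invR s c v a x ≤ 1 ∧ levelR v a x ^ s ≤ invR s c v a x := by
  have h1 := h.level_pos hx0 hx
  have h2 := h.level_le_one (h.c_pos.le.trans hx0) hx
  have h3 : levelR v a x ^ s ≤ 1 := Real.rpow_le_one h1.le h2 h.s_pos.le
  have h4 : 0 ≤ levelR v a x ^ s := Real.rpow_nonneg h1.le _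
  have hc := h.c_pos
  have hc1 := h.c_lt
  unfold invR
  refine ⟨by nlinarith, by nlinarith, by nlinarith⟩

/-- The quotient of levels along a complex perturbation of a real point is close to `1`. -/
lemma level_ratio (h : BranchData s c v a) {x R : ℝ} {e : ℂ} (hx0 : c ≤ x) (hx : x ≤ 1)
    (hR : R ≤ 1 / 20) (he : ‖e‖ ≤ R * (1 - c) * x) :
    ∃ w : ℂ, levelC v a (x + e) = levelR v a x * w ∧ ‖w - 1‖ ≤ 1 / 10 ∧
      ‖w - 1‖ ≤ 1001 / 1000 * ‖e‖ / (v * levelR v a x) ∧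
      ‖w - 1 - deriv (betaC a) x * e / (v * levelR v a x)‖
        ≤ 1 / 1000 * ‖e‖ ^ 2 / (v * levelR v a x) ∧
      ‖e‖ / (v * levelR v a x) ≤ 1000 / 899 * ((1 - c) / v) * R ∧ (1 - c) / v ≤ 1 := by
  have hc := h.c_pos
  have hc1 := h.c_lt
  have hv := h.v_pos
  have hY := h.level_pos hx0 hx
  have hYge := h.level_ge hx0 hx
  have hxpos : 0 < x := by linarith
  have hR0 : 0 ≤ R := by
    have h1 : 0 ≤ R * ((1 - c) * x) := by rw [← mul_assoc]; exact (norm_nonneg e).trans he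
    have h2 : 0 < (1 - c) * x := mul_pos (by linarith) hxpos
    exact nonneg_of_mul_nonneg_left h1 h2
  have hcv : (1 - c) / v ≤ 1 := by
    rw [div_le_one hv]
    have := h.v_ge
    nlinarith
  have he1 : ‖e‖ ≤ 1 / 20 := by
    refine he.trans ?_
    have h1 : (1 - c) * x ≤ 1 := by nlinarith
    have h2 : 0 ≤ (1 - c) * x := mul_nonneg (by linarith) hxpos.le
    nlinarith
  have hq : ‖e‖ / (v * levelR v a x) ≤ 1000 / 899 * ((1 - c) / v) * R := by
    rw [div_le_iff₀ (by positivity)]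
    have : 1000 / 899 * ((1 - c) / v) * R * (v * levelR v a x)
        = 1000 / 899 * (1 - c) * R * levelR v a x := by field_simp
    rw [this]
    have h1 : 0 ≤ (1 - c) * R := mul_nonneg (by linarith) hR0
    nlinarith
  have hxn : ‖(x : ℂ)‖ < 2 := by
    rw [Complex.norm_real, Real.norm_eq_abs, abs_of_pos hxpos]; linarith
  have hxe : ‖(x : ℂ) + e‖ < 2 := by
    refine (norm_add_le _ _).trans_lt ?_
    rw [Complex.norm_real, Real.norm_eq_abs, abs_of_pos hxpos]; linarith
  have hYne : ((levelR v a x : ℝ) : ℂ) ≠ 0 := by exact_mod_cast hY.ne'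
  have hvne : (v : ℂ) ≠ 0 := by exact_mod_cast hv.ne'
  have hnv : ‖((v : ℂ) * levelR v a x)‖ = v * levelR v a x := by
    rw [norm_mul, Complex.norm_real, Complex.norm_real, Real.norm_eq_abs, Real.norm_eq_abs,
      abs_of_pos hv, abs_of_pos hY]
  have hw1 : levelC v a (x + e) / levelR v a x - 1
      = (betaC a (x + e) - betaC a x) / (v * levelR v a x) := by
    have : levelC v a (x + e) = levelR v a x + (betaC a (x + e) - betaC a x) / v := by
      rw [← levelC_ofReal, levelC, levelC]; ring
    rw [this]
    field_simp
    ring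
  have hw2 : ‖levelC v a (x + e) / levelR v a x - 1‖ ≤ 1001 / 1000 * ‖e‖ / (v * levelR v a x) := by
    rw [hw1, norm_div, hnv]
    have h1 := norm_betaC_sub_le_mul h.small hxe hxn
    rw [add_sub_cancel_left] at h1
    gcongr
    linarith
  refine ⟨levelC v a (x + e) / levelR v a x, by field_simp, ?_, hw2, ?_, hq, hcv⟩
  · refine hw2.trans ?_
    have h1 : (1 - c) / v * R ≤ R := mul_le_of_le_one_left hR0 hcv
    rw [mul_div_assoc]
    linarith
  · have h1 := norm_betaC_taylor_le h.small hxe hxn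
    rw [add_sub_cancel_left] at h1
    rw [hw1, ← sub_div, norm_div, hnv]
    gcongr

/-- One step of the perturbed orbit: contraction of the relative error and linear approximation. -/
lemma inv_step (h : BranchData s c v a) {x R : ℝ} {e : ℂ} (hx0 : c ≤ x) (hx : x ≤ 1)
    (hR : R ≤ 1 / 20) (he : ‖e‖ ≤ R * (1 - c) * x) :
    levelC v a (x + e) ∈ Complex.slitPlane ∧
    ‖invC s c v a (x + e) - invR s c v a x‖
      ≤ 3 / 4 * ((1 - c) / v) * R * (1 - c) * invR s c v a x ∧
    ‖invC s c v a (x + e) - invR s c v a x - multC s c v a x * e‖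
      ≤ 5 * R * (‖multC s c v a x‖ * ‖e‖) := by
  obtain ⟨w, hw, hw10, hwe, hwt, heR, hcv⟩ := h.level_ratio hx0 hx hR he
  have hc := h.c_pos
  have hc1 : 0 < 1 - c := by linarith [h.c_lt]
  have hv := h.v_pos
  have hs := h.s_pos
  have hs2 := h.s_lt
  have hY := h.level_pos hx0 hx
  obtain ⟨-, -, hinv⟩ := h.inv_mem hx0 hx
  have hxpos : 0 < x := by linarith
  have hR0 : 0 ≤ R := by
    have h1 : 0 ≤ R * ((1 - c) * x) := by rw [← mul_assoc]; exact (norm_nonneg e).trans he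
    exact nonneg_of_mul_nonneg_left h1 (mul_pos hc1 hxpos)
  set Y := levelR v a x with hYdef
  have hwslit := mem_slitPlane_of_near_one hw10
  have hw0 : w ≠ 0 := Complex.slitPlane_ne_zero hwslit
  have hYs : 0 < Y ^ s := Real.rpow_pos_of_pos hY s
  have hdiff : invC s c v a (x + e) - invR s c v a x
      = (((1 - c) * Y ^ s : ℝ) : ℂ) * (w ^ (s : ℂ) - 1) := by
    rw [invC, hw, ofReal_mul_cpow hY hw0, invR, ← hYdef]
    push_cast; ring
  have hcY : ‖(((1 - c) * Y ^ s : ℝ) : ℂ)‖ = (1 - c) * Y ^ s := by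
    rw [Complex.norm_real, Real.norm_eq_abs, abs_of_pos (by positivity)]
  refine ⟨?_, ?_, ?_⟩
  · rw [hw]
    rw [Complex.mem_slitPlane_iff] at hwslit ⊢
    rw [Complex.re_ofReal_mul, Complex.im_ofReal_mul]
    exact hwslit.imp (fun h => mul_pos hY h) (fun h => mul_ne_zero hY.ne' h)
  · rw [hdiff, norm_mul, hcY]
    have h1 := norm_cpow_sub_one_le hw10 (p := s) (by linarith) (by linarith)
    rw [abs_of_pos hs] at h1
    have h2 : ‖w - 1‖ ≤ 1001 / 1000 * (1000 / 899 * ((1 - c) / v) * R) := by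
      refine hwe.trans ?_
      rw [mul_div_assoc]
      gcongr
    have hk : 0 ≤ (1 - c) / v * R := by positivity
    have h3 : ‖w ^ (s : ℂ) - 1‖ ≤ 3 / 4 * ((1 - c) / v) * R := by
      calc ‖w ^ (s : ℂ) - 1‖ ≤ s * (100 / 81) * ‖w - 1‖ := h1
        _ ≤ 1 / 2 * (100 / 81) * (1001 / 1000 * (1000 / 899 * ((1 - c) / v) * R)) := by gcongr
        _ ≤ _ := by nlinarith
    have hi0 : 0 ≤ invR s c v a x := hYs.le.trans hinv
    calc (1 - c) * Y ^ s * ‖w ^ (s : ℂ) - 1‖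
        ≤ (1 - c) * invR s c v a x * (3 / 4 * ((1 - c) / v) * R) := by gcongr
      _ = _ := by ring
  · set B := deriv (betaC a) x with hB
    have hxn : ‖(x : ℂ)‖ < 2 := by
      rw [Complex.norm_real, Real.norm_eq_abs, abs_of_pos hxpos]; linarith
    have hB1 : 999 / 1000 ≤ ‖B‖ := by
      have h1 := norm_deriv_betaC_sub_one_le h.small hxn
      have : ‖(1 : ℂ)‖ ≤ ‖B‖ + ‖B - 1‖ := by
        calc ‖(1 : ℂ)‖ = ‖B - (B - 1)‖ := by congr 1; ring
          _ ≤ _ := norm_sub_le _ _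
      rw [norm_one] at this
      linarith
    have hYs1 : Y ^ s = Y ^ (s - 1) * Y := by
      rw [← Real.rpow_add_one hY.ne']; ring_nf
    have hYs1pos : 0 < Y ^ (s - 1) := Real.rpow_pos_of_pos hY _
    have hvne : (v : ℂ) ≠ 0 := by exact_mod_cast hv.ne'
    have hYne : (Y : ℂ) ≠ 0 := by exact_mod_cast hY.ne'
    have hlin : multC s c v a x * e
        = (((1 - c) * Y ^ s : ℝ) : ℂ) * (s * (B * e / (v * Y))) := by
      rw [multC, ← hYdef, ← hB, hYs1]
      push_cast
      field_simp
    have hmult : ‖multC s c v a x‖ = (1 - c) * s * Y ^ (s - 1) / v * ‖B‖ := by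
      rw [multC, norm_mul, Complex.norm_real, Real.norm_eq_abs, abs_of_pos (by positivity)]
    have hsplit : invC s c v a (x + e) - invR s c v a x - multC s c v a x * e
        = (((1 - c) * Y ^ s : ℝ) : ℂ) * ((w ^ (s : ℂ) - 1 - s * (w - 1))
          + s * (w - 1 - B * e / (v * Y))) := by
      rw [hdiff, hlin]; ring
    rw [hsplit, norm_mul, hcY]
    have h1 := norm_cpow_taylor_le hw10 hs hs2
    have h2 : ‖(s : ℂ) * (w - 1 - B * e / (v * Y))‖ ≤ s * (1 / 1000 * ‖e‖ ^ 2 / (v * Y)) := by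
      rw [norm_mul, Complex.norm_real, Real.norm_eq_abs, abs_of_pos hs]
      gcongr
    set t := ‖e‖ / (v * Y) with ht
    have ht0 : 0 ≤ t := by positivity
    have hwt' : ‖w - 1‖ ≤ 1001 / 1000 * t := by rw [ht, ← mul_div_assoc]; exact hwe
    have het : ‖e‖ = t * (v * Y) := by rw [ht]; field_simp
    have htR : t ≤ 1000 / 899 * R := by
      refine heR.trans ?_
      have := mul_le_of_le_one_left hR0 hcv
      linarith
    have heR' : ‖e‖ ≤ R := by
      refine he.trans ?_
      have h1 : (1 - c) * x ≤ 1 := by nlinarith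
      rw [mul_assoc]
      exact mul_le_of_le_one_right hR0 h1
    have h3 : ‖w ^ (s : ℂ) - 1 - s * (w - 1) + s * (w - 1 - B * e / (v * Y))‖
        ≤ s * t * (4 * R) := by
      refine (norm_add_le _ _).trans ?_
      have h4 : 2 * s * ‖w - 1‖ ^ 2 ≤ 2 * s * ((1001 / 1000 * t) * (1001 / 1000 * (1000 / 899 * R))) := by
        rw [sq]
        gcongr
        exact hwt'.trans (by gcongr)
      have h5 : s * (1 / 1000 * ‖e‖ ^ 2 / (v * Y)) ≤ s * (1 / 1000 * (R * t)) := by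
        have : 1 / 1000 * ‖e‖ ^ 2 / (v * Y) = 1 / 1000 * (‖e‖ * t) := by rw [ht]; ring
        rw [this]
        gcongr
      have h6 : 0 ≤ s * t * R := by positivity
      nlinarith
    rw [hmult, het]
    calc (1 - c) * Y ^ s * ‖w ^ (s : ℂ) - 1 - s * (w - 1) + s * (w - 1 - B * e / (v * Y))‖
        ≤ (1 - c) * Y ^ s * (s * t * (4 * R)) := by gcongr
      _ = 4 * R * ((1 - c) * s * Y ^ s * t) := by ring
      _ ≤ 5 * R * (999 / 1000 * ((1 - c) * s * Y ^ s * t)) := by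
          have : 0 ≤ R * ((1 - c) * s * Y ^ s * t) := by positivity
          nlinarith
      _ ≤ 5 * R * (‖B‖ * ((1 - c) * s * Y ^ s * t)) := by gcongr
      _ = 5 * R * (‖B‖ * ((1 - c) * s * (Y ^ (s - 1) * Y) * t)) := by rw [← hYs1]
      _ = 5 * R * ((1 - c) * s * Y ^ (s - 1) / v * ‖B‖ * (t * (v * Y))) := by
          have hvv : v * v⁻¹ = 1 := mul_inv_cancel₀ hv.ne'
          rw [div_eq_mul_inv]
          linear_combination (-(5 * R * (‖B‖ * ((1 - c) * s * (Y ^ (s - 1) * Y) * t)))) * hvv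

lemma norm_mult_ge (h : BranchData s c v a) {x : ℝ} (hx0 : c ≤ x) (hx : x ≤ 1) :
    9 / 10 * s * (1 - c) ≤ ‖multC s c v a x‖ := by
  have hc1 : 0 < 1 - c := by linarith [h.c_lt]
  have hxpos : 0 < x := by linarith [h.c_pos]
  have hs := h.s_pos
  have hv := h.v_pos
  have hY := h.level_pos hx0 hx
  have hxn : ‖(x : ℂ)‖ < 2 := by
    rw [Complex.norm_real, Real.norm_eq_abs, abs_of_pos hxpos]; linarith
  have h1 := norm_deriv_betaC_sub_one_le h.small hxn
  have hB1 : 999 / 1000 ≤ ‖deriv (betaC a) x‖ := by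
    have : ‖(1 : ℂ)‖ ≤ ‖deriv (betaC a) x‖ + ‖deriv (betaC a) x - 1‖ := by
      calc ‖(1 : ℂ)‖ = ‖deriv (betaC a) x - (deriv (betaC a) x - 1)‖ := by congr 1; ring
        _ ≤ _ := norm_sub_le _ _
    rw [norm_one] at this
    linarith
  have hYs : 1 ≤ levelR v a x ^ (s - 1) :=
    Real.one_le_rpow_of_pos_of_le_one_of_nonpos hY (h.level_le_one hxpos.le hx)
      (by linarith [h.s_lt])
  rw [multC, norm_mul, Complex.norm_real, Real.norm_eq_abs, abs_of_pos (by positivity)]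
  have h2 : (1 - c) * s ≤ (1 - c) * s * levelR v a x ^ (s - 1) / v := by
    rw [le_div_iff₀ hv]
    have h3 : 0 < (1 - c) * s := by positivity
    have h4 := h.v_le
    nlinarith
  calc 9 / 10 * s * (1 - c) ≤ (1 - c) * s * (999 / 1000) := by
        have : 0 < (1 - c) * s := by positivity
        nlinarith
    _ ≤ _ := by gcongr

end BranchData

end InverseBranch

section OrbitEstimates

/-- The product of the multipliers along the orbit of the critical point. -/
noncomputable def orbitMult (s c v : ℝ) (a : ℕ → ℝ) (n : ℕ) : ℂ :=
  ∏ i ∈ Finset.range n, multC s c v a ((invR s c v a)^[i] c)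

namespace BranchData

variable {s c v : ℝ} {a : ℕ → ℝ}

lemma orbit_mem (h : BranchData s c v a) {x : ℝ} (hx0 : c ≤ x) (hx : x ≤ 1) (j : ℕ) :
    c ≤ (invR s c v a)^[j] x ∧ (invR s c v a)^[j] x ≤ 1 := by
  induction j with
  | zero => exact ⟨hx0, hx⟩
  | succ j ih =>
    rw [Function.iterate_succ_apply']
    exact ⟨(h.inv_mem ih.1 ih.2).1, (h.inv_mem ih.1 ih.2).2.1⟩

lemma ratio_le_one (h : BranchData s c v a) : (1 - c) / v ≤ 1 := by
  rw [div_le_one h.v_pos]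
  have := h.v_ge
  have := h.v_pos
  have := h.c_pos
  nlinarith

lemma norm_orbitMult_ge (h : BranchData s c v a) (n : ℕ) :
    (9 / 10 * s * (1 - c)) ^ n ≤ ‖orbitMult s c v a n‖ := by
  have hc1 : 0 < 1 - c := by linarith [h.c_lt]
  have hs := h.s_pos
  induction n with
  | zero => simp [orbitMult]
  | succ n ih =>
    have h1 := h.orbit_mem le_rfl h.c_lt.le n
    have h2 := h.norm_mult_ge h1.1 h1.2
    have h3 : orbitMult s c v a (n + 1)
        = orbitMult s c v a n * multC s c v a ((invR s c v a)^[n] c) :=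
      Finset.prod_range_succ _ _
    rw [h3, norm_mul, pow_succ]
    gcongr

/-- Control of a complex orbit starting close to the critical point. -/
lemma orbit_estimates (h : BranchData s c v a) {R : ℝ} {e : ℂ} (hR : R ≤ 1 / 40)
    (he : ‖e‖ ≤ R * (1 - c) * c) (j : ℕ) :
    levelC v a ((invC s c v a)^[j] (c + e)) ∈ Complex.slitPlane ∧
    ‖(invC s c v a)^[j] (c + e) - ((invR s c v a)^[j] c : ℝ)‖
      ≤ (3 / 4 * ((1 - c) / v)) ^ j * R * (1 - c) * (invR s c v a)^[j] c ∧
    ‖(invC s c v a)^[j] (c + e) - ((invR s c v a)^[j] c : ℝ) - orbitMult s c v a j * e‖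
      ≤ 40 * R * (1 - (3 / 4) ^ j) * (‖orbitMult s c v a j‖ * ‖e‖) := by
  have hc := h.c_pos
  have hc1 : 0 < 1 - c := by linarith [h.c_lt]
  have hR0 : 0 ≤ R := by
    have h1 : 0 ≤ R * ((1 - c) * c) := by rw [← mul_assoc]; exact (norm_nonneg e).trans he
    exact nonneg_of_mul_nonneg_left h1 (mul_pos hc1 hc)
  have hv := h.v_pos
  have hq0 : 0 ≤ 3 / 4 * ((1 - c) / v) := by positivity
  have hq1 : 3 / 4 * ((1 - c) / v) ≤ 3 / 4 := by linarith [h.ratio_le_one]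
  -- the relative error at each time is at most `R`, so `inv_step` applies
  have key : ∀ j, ‖(invC s c v a)^[j] (c + e) - ((invR s c v a)^[j] c : ℝ)‖
        ≤ (3 / 4 * ((1 - c) / v)) ^ j * R * (1 - c) * (invR s c v a)^[j] c ∧
      ‖(invC s c v a)^[j] (c + e) - ((invR s c v a)^[j] c : ℝ) - orbitMult s c v a j * e‖
        ≤ 40 * R * (1 - (3 / 4) ^ j) * (‖orbitMult s c v a j‖ * ‖e‖) := by
    intro j
    induction j with
    | zero => simpa [orbitMult] using he
    | succ j ih =>
      obtain ⟨ih1, ih2⟩ := ih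
      obtain ⟨hX0, hX1⟩ := h.orbit_mem le_rfl h.c_lt.le j
      have hpow : (3 / 4 * ((1 - c) / v)) ^ j ≤ (3 / 4) ^ j := pow_le_pow_left₀ hq0 hq1 j
      have hpow1 : ((3 : ℝ) / 4) ^ j ≤ 1 := pow_le_one₀ (by norm_num) (by norm_num)
      have hpow0 : (0 : ℝ) < (3 / 4) ^ j := by positivity
      have hRj : (3 / 4 * ((1 - c) / v)) ^ j * R ≤ 1 / 20 := by nlinarith
      have hmult : orbitMult s c v a (j + 1)
          = orbitMult s c v a j * multC s c v a ((invR s c v a)^[j] c) :=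
        Finset.prod_range_succ _ _
      rw [Function.iterate_succ_apply', Function.iterate_succ_apply', hmult]
      set X := (invR s c v a)^[j] c
      set Z := (invC s c v a)^[j] (c + e)
      set d := orbitMult s c v a j
      obtain ⟨-, h1, h2⟩ := h.inv_step hX0 hX1 hRj ih1
      rw [add_sub_cancel] at h1 h2
      refine ⟨h1.trans_eq (by ring), ?_⟩
      set γ := multC s c v a X
      have h3 : ‖Z - X‖ ≤ 2 * (‖d‖ * ‖e‖) := by
        have h4 : ‖Z - X‖ ≤ ‖Z - X - d * e‖ + ‖d‖ * ‖e‖ := by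
          rw [← norm_mul]
          calc ‖Z - X‖ = ‖(Z - X - d * e) + d * e‖ := by congr 1; ring
            _ ≤ _ := norm_add_le _ _
        have h5 : 40 * R * (1 - (3 / 4) ^ j) * (‖d‖ * ‖e‖) ≤ 1 * (‖d‖ * ‖e‖) := by
          gcongr
          nlinarith
        linarith
      have h6 : ‖invC s c v a Z - invR s c v a X - γ * (Z - X)‖
          ≤ 5 * ((3 / 4) ^ j * R) * (‖γ‖ * (2 * (‖d‖ * ‖e‖))) := by
        refine h2.trans ?_
        gcongr
      calc ‖invC s c v a Z - invR s c v a X - d * γ * e‖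
          = ‖(invC s c v a Z - invR s c v a X - γ * (Z - X)) + γ * (Z - X - d * e)‖ := by
            congr 1; ring
        _ ≤ 5 * ((3 / 4) ^ j * R) * (‖γ‖ * (2 * (‖d‖ * ‖e‖)))
            + ‖γ‖ * (40 * R * (1 - (3 / 4) ^ j) * (‖d‖ * ‖e‖)) := by
            refine (norm_add_le _ _).trans (add_le_add h6 ?_)
            rw [norm_mul]
            gcongr
        _ = _ := by rw [norm_mul, pow_succ]; ring
  refine ⟨?_, key j⟩
  obtain ⟨hX0, hX1⟩ := h.orbit_mem le_rfl h.c_lt.le j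
  have hpow : (3 / 4 * ((1 - c) / v)) ^ j ≤ 1 := pow_le_one₀ hq0 (by linarith)
  have h1 := (h.inv_step hX0 hX1 (R := (3 / 4 * ((1 - c) / v)) ^ j * R) (by nlinarith)
    (key j).1).1
  rwa [add_sub_cancel] at h1

/-- The orbit multiplier is controlled by the contraction rate of the inverse branch. -/
lemma norm_orbitMult_le (h : BranchData s c v a) (n : ℕ) :
    ‖orbitMult s c v a n‖ ≤ 2 * (3 / 4 * ((1 - c) / v)) ^ n * (invR s c v a)^[n] c / c := by
  have hc := h.c_pos
  have hc1 : 0 < 1 - c := by linarith [h.c_lt]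
  have he : ‖((1 / 80 * (1 - c) * c : ℝ) : ℂ)‖ = 1 / 80 * (1 - c) * c := by
    rw [Complex.norm_real, Real.norm_eq_abs, abs_of_pos (by positivity)]
  obtain ⟨-, h1, h2⟩ := h.orbit_estimates (R := 1 / 80) (by norm_num) he.le n
  set E := ((1 / 80 * (1 - c) * c : ℝ) : ℂ)
  set d := orbitMult s c v a n
  set X := (invR s c v a)^[n] c
  set Z := (invC s c v a)^[n] (c + E)
  have h3 : ‖d‖ * ‖E‖ ≤ ‖Z - X‖ + ‖Z - X - d * E‖ := by
    rw [← norm_mul]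
    calc ‖d * E‖ = ‖(Z - X) - (Z - X - d * E)‖ := by congr 1; ring
      _ ≤ _ := norm_sub_le _ _
  have hpow : (0 : ℝ) < (3 / 4) ^ n := by positivity
  have h4 : 40 * (1 / 80 : ℝ) * (1 - (3 / 4) ^ n) * (‖d‖ * ‖E‖) ≤ 1 / 2 * (‖d‖ * ‖E‖) := by
    gcongr
    linarith
  rw [he] at h3 h4 h2
  rw [le_div_iff₀ hc]
  have h5 : ‖d‖ * (1 / 80 * (1 - c) * c)
      ≤ 2 * ((3 / 4 * ((1 - c) / v)) ^ n * (1 / 80) * (1 - c) * X) := by linarith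
  have h6 : (1 / 80 * (1 - c)) * (‖d‖ * c)
      ≤ (1 / 80 * (1 - c)) * (2 * (3 / 4 * ((1 - c) / v)) ^ n * X) := by
    calc _ = ‖d‖ * (1 / 80 * (1 - c) * c) := by ring
      _ ≤ _ := h5
      _ = _ := by ring
  exact le_of_mul_le_mul_left h6 (by positivity)

end BranchData

end OrbitEstimates

section PullBack

/-- An inverse orbit of length `n`, started at the point of relative coordinate `d - z`
near the critical point. -/
noncomputable def preC (s c v : ℝ) (a : ℕ → ℝ) (l d : ℝ) (n : ℕ) (z : ℂ) : ℂ :=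
  (invC s c v a)^[n] (c + l * (d - z))

/-- The real version of `preC`. -/
noncomputable def preR (s c v : ℝ) (a : ℕ → ℝ) (l d : ℝ) (n : ℕ) (z : ℝ) : ℝ :=
  (invR s c v a)^[n] (c + l * (d - z))

/-- The (unnormalized) inverse diffeomorphism of the renormalized branch. -/
noncomputable def pullC (s c v : ℝ) (a α : ℕ → ℝ) (l d : ℝ) (n : ℕ) (z : ℂ) : ℂ :=
  betaC α (1 - preC s c v a l d n z)

/-- The real version of `pullC`. -/
noncomputable def pullR (s c v : ℝ) (a α : ℕ → ℝ) (l d : ℝ) (n : ℕ) (z : ℝ) : ℝ :=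
  betaR α (1 - preR s c v a l d n z)

/-- Standing assumptions for pulling back along an inverse branch. -/
structure PullData (s c v : ℝ) (a α : ℕ → ℝ) (l d : ℝ) : Prop extends BranchData s c v a where
  small' : SmallCoeff α
  l_pos : 0 < l
  l_le : l ≤ 1 / 1000000000 * (c * (1 - c))
  c'_nonneg : 0 ≤ d
  c'_le : d ≤ 1

/-- The linear coefficient of `pullC`. -/
noncomputable def pullSlope (s c v : ℝ) (a α : ℕ → ℝ) (l : ℝ) (n : ℕ) : ℂ :=
  deriv (betaC α) (1 - ((invR s c v a)^[n] c : ℝ)) * orbitMult s c v a n * l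

lemma differentiableAt_invC {s c v : ℝ} {a : ℕ → ℝ} (ha : SmallCoeff a) {z : ℂ} (hz : ‖z‖ < 3)
    (hl : levelC v a z ∈ Complex.slitPlane) : DifferentiableAt ℂ (invC s c v a) z := by
  have h1 : DifferentiableAt ℂ (levelC v a) z := by
    unfold levelC
    exact (((differentiableAt_betaC ha hz).const_sub _).div_const _).const_sub _
  unfold invC
  exact ((h1.cpow_const hl).const_mul _).const_add _

namespace PullData

variable {s c v : ℝ} {a α : ℕ → ℝ} {l c' : ℝ}

lemma norm_start_le (h : PullData s c v a α l c') {z : ℂ} (hz : ‖z‖ ≤ 5) :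
    ‖(l : ℂ) * (c' - z)‖ ≤ 6 / 1000000000 * (1 - c) * c := by
  have h1 : ‖(c' : ℂ) - z‖ ≤ 6 := by
    refine (norm_sub_le _ _).trans ?_
    rw [Complex.norm_real, Real.norm_eq_abs, abs_of_nonneg h.c'_nonneg]
    linarith [h.c'_le]
  rw [norm_mul, Complex.norm_real, Real.norm_eq_abs, abs_of_pos h.l_pos]
  have h2 := h.l_le
  have h3 := h.l_pos
  nlinarith

lemma norm_pre_sub_le (h : PullData s c v a α l c') {z : ℂ} (hz : ‖z‖ ≤ 5) (j : ℕ) :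
    ‖preC s c v a l c' j z - ((invR s c v a)^[j] c : ℝ)‖ ≤ 6 / 1000000000 := by
  have h1 := (h.orbit_estimates (by norm_num) (h.norm_start_le hz) j).2.1
  refine h1.trans ?_
  have hc := h.c_pos
  have hc1 : 0 < 1 - c := by linarith [h.c_lt]
  have hv := h.v_pos
  obtain ⟨hX0, hX1⟩ := h.orbit_mem le_rfl h.c_lt.le j
  have hq : (3 / 4 * ((1 - c) / v)) ^ j ≤ 1 :=
    pow_le_one₀ (by positivity) (by linarith [h.ratio_le_one])
  calc (3 / 4 * ((1 - c) / v)) ^ j * (6 / 1000000000) * (1 - c) * (invR s c v a)^[j] c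
      ≤ 1 * (6 / 1000000000) * 1 * 1 := by
        gcongr
        · linarith
        · linarith
    _ = _ := by norm_num

lemma level_pre_mem (h : PullData s c v a α l c') {z : ℂ} (hz : ‖z‖ ≤ 5) (j : ℕ) :
    levelC v a (preC s c v a l c' j z) ∈ Complex.slitPlane :=
  (h.orbit_estimates (by norm_num) (h.norm_start_le hz) j).1

lemma norm_pre_lt (h : PullData s c v a α l c') {z : ℂ} (hz : ‖z‖ ≤ 5) (j : ℕ) :
    ‖preC s c v a l c' j z‖ < 2 := by
  have h1 := h.norm_pre_sub_le hz j
  obtain ⟨hX0, hX1⟩ := h.orbit_mem le_rfl h.c_lt.le j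
  have h2 : ‖(((invR s c v a)^[j] c : ℝ) : ℂ)‖ ≤ 1 := by
    rw [Complex.norm_real, Real.norm_eq_abs, abs_of_nonneg (h.c_pos.le.trans hX0)]
    exact hX1
  have h3 := norm_sub_norm_le (preC s c v a l c' j z) ((invR s c v a)^[j] c : ℝ)
  linarith

lemma norm_one_sub_pre_lt (h : PullData s c v a α l c') {z : ℂ} (hz : ‖z‖ ≤ 5) (j : ℕ) :
    ‖1 - preC s c v a l c' j z‖ < 2 := by
  have h1 := h.norm_pre_sub_le hz j
  obtain ⟨hX0, hX1⟩ := h.orbit_mem le_rfl h.c_lt.le j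
  have h2 : ‖(1 : ℂ) - (((invR s c v a)^[j] c : ℝ) : ℂ)‖ ≤ 1 := by
    rw [← Complex.ofReal_one, ← Complex.ofReal_sub, Complex.norm_real, Real.norm_eq_abs,
      abs_of_nonneg (by linarith)]
    linarith [h.c_pos]
  calc ‖1 - preC s c v a l c' j z‖
      = ‖(1 - (((invR s c v a)^[j] c : ℝ) : ℂ))
          - (preC s c v a l c' j z - ((invR s c v a)^[j] c : ℝ))‖ := by congr 1; ring
    _ ≤ _ := norm_sub_le _ _
    _ < 2 := by linarith

lemma pre_ofReal (h : PullData s c v a α l c') {x : ℝ} (hx : |x| ≤ 5) (j : ℕ) :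
    preC s c v a l c' j x = preR s c v a l c' j x ∧
      0 < levelR v a (preR s c v a l c' j x) := by
  have hx' : ‖(x : ℂ)‖ ≤ 5 := by rwa [Complex.norm_real]
  have hpos : ∀ j, preC s c v a l c' j x = preR s c v a l c' j x →
      0 < levelR v a (preR s c v a l c' j x) := by
    intro j hj
    have h1 := h.level_pre_mem hx' j
    rwa [hj, levelC_ofReal, Complex.ofReal_mem_slitPlane] at h1
  have : preC s c v a l c' j x = preR s c v a l c' j x := by
    induction j with
    | zero => simp [preC, preR]
    | succ j ih =>
      have h2 := hpos j ih
      unfold preC preR at ih h2 ⊢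
      rw [Function.iterate_succ_apply', Function.iterate_succ_apply', ih, invC_ofReal h2.le]
  exact ⟨this, hpos j this⟩

lemma pull_ofReal (h : PullData s c v a α l c') {x : ℝ} (hx : |x| ≤ 5) (n : ℕ) :
    pullC s c v a α l c' n x = pullR s c v a α l c' n x := by
  rw [pullC, pullR, (h.pre_ofReal hx n).1, ← Complex.ofReal_one, ← Complex.ofReal_sub,
    betaC_ofReal]

lemma differentiableAt_pre (h : PullData s c v a α l c') {z : ℂ} (hz : ‖z‖ ≤ 5) (n : ℕ) :
    DifferentiableAt ℂ (preC s c v a l c' n) z := by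
  induction n with
  | zero =>
    show DifferentiableAt ℂ (fun z : ℂ => (c : ℂ) + l * (c' - z)) z
    fun_prop
  | succ n ih =>
    have h1 : preC s c v a l c' (n + 1) = fun z => invC s c v a (preC s c v a l c' n z) := by
      ext z
      simp only [preC, Function.iterate_succ_apply']
    rw [h1]
    exact (differentiableAt_invC h.small (by linarith [h.norm_pre_lt hz n])
      (h.level_pre_mem hz n)).comp z ih

lemma differentiableAt_pull (h : PullData s c v a α l c') {z : ℂ} (hz : ‖z‖ ≤ 5) (n : ℕ) :
    DifferentiableAt ℂ (pullC s c v a α l c' n) z := by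
  unfold pullC
  exact (differentiableAt_betaC h.small' (by linarith [h.norm_one_sub_pre_lt hz n])).comp z
    ((h.differentiableAt_pre hz n).const_sub _)

lemma norm_one_sub_orbit_lt (h : PullData s c v a α l c') (n : ℕ) :
    ‖(1 : ℂ) - (((invR s c v a)^[n] c : ℝ) : ℂ)‖ < 2 := by
  obtain ⟨hX0, hX1⟩ := h.orbit_mem le_rfl h.c_lt.le n
  rw [← Complex.ofReal_one, ← Complex.ofReal_sub, Complex.norm_real, Real.norm_eq_abs,
    abs_of_nonneg (by linarith)]
  linarith [h.c_pos]

lemma norm_deriv_beta_bounds (h : PullData s c v a α l c') (n : ℕ) :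
    999 / 1000 ≤ ‖deriv (betaC α) (1 - ((invR s c v a)^[n] c : ℝ))‖ ∧
    ‖deriv (betaC α) (1 - ((invR s c v a)^[n] c : ℝ))‖ ≤ 1001 / 1000 := by
  have h1 := norm_deriv_betaC_sub_one_le h.small' (h.norm_one_sub_orbit_lt n)
  set B := deriv (betaC α) (1 - ((invR s c v a)^[n] c : ℝ))
  have h2 := norm_sub_norm_le B 1
  have h3 := norm_sub_norm_le 1 B
  rw [norm_sub_rev] at h3
  rw [norm_one] at h2 h3
  constructor <;> linarith

lemma pullSlope_ne_zero (h : PullData s c v a α l c') (n : ℕ) :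
    pullSlope s c v a α l n ≠ 0 := by
  have h1 := (h.norm_deriv_beta_bounds n).1
  have hc1 : 0 < 1 - c := by linarith [h.c_lt]
  have hs := h.s_pos
  have h2 : 0 < ‖orbitMult s c v a n‖ :=
    lt_of_lt_of_le (by positivity) (h.norm_orbitMult_ge n)
  unfold pullSlope
  refine mul_ne_zero (mul_ne_zero (norm_pos_iff.1 (by linarith)) (norm_pos_iff.1 h2)) ?_
  exact_mod_cast h.l_pos.ne'

lemma norm_pull_sub_linear_le (h : PullData s c v a α l c') {z : ℂ} (hz : ‖z‖ ≤ 5) (n : ℕ) :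
    ‖pullC s c v a α l c' n z - betaC α (1 - ((invR s c v a)^[n] c : ℝ))
      - pullSlope s c v a α l n * (z - c')‖ ≤ 2 / 1000000 * ‖pullSlope s c v a α l n‖ := by
  obtain ⟨-, -, h1⟩ := h.orbit_estimates (by norm_num) (h.norm_start_le hz) n
  have h2 := h.norm_pre_sub_le hz n
  have h3 := norm_betaC_taylor_le h.small' (h.norm_one_sub_pre_lt hz n)
    (h.norm_one_sub_orbit_lt n)
  obtain ⟨hB, -⟩ := h.norm_deriv_beta_bounds n
  have hz' : ‖(c' : ℂ) - z‖ ≤ 6 := by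
    refine (norm_sub_le _ _).trans ?_
    rw [Complex.norm_real, Real.norm_eq_abs, abs_of_nonneg h.c'_nonneg]
    linarith [h.c'_le]
  have hl := h.l_pos
  have hel : ‖(l : ℂ) * (c' - z)‖ ≤ 6 * l := by
    rw [norm_mul, Complex.norm_real, Real.norm_eq_abs, abs_of_pos hl]
    nlinarith
  unfold pullC pullSlope
  change ‖preC s c v a l c' n z - _ - _‖ ≤ _ at h1
  set Z := preC s c v a l c' n z
  set X : ℂ := (((invR s c v a)^[n] c : ℝ) : ℂ)
  set B := deriv (betaC α) (1 - X)
  set d := orbitMult s c v a n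
  set e := (l : ℂ) * (c' - z) with he
  have hpow : (0 : ℝ) < (3 / 4) ^ n := by positivity
  have h1' : ‖Z - X - d * e‖ ≤ 240 / 1000000000 * (‖d‖ * ‖e‖) := by
    refine h1.trans ?_
    gcongr
    nlinarith
  have h4 : ‖Z - X‖ ≤ 2 * (‖d‖ * ‖e‖) := by
    have : ‖Z - X‖ ≤ ‖Z - X - d * e‖ + ‖d‖ * ‖e‖ := by
      rw [← norm_mul]
      calc ‖Z - X‖ = ‖(Z - X - d * e) + d * e‖ := by congr 1; ring
        _ ≤ _ := norm_add_le _ _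
    have h0 : 0 ≤ ‖d‖ * ‖e‖ := by positivity
    linarith
  have h5 : ‖1 - Z - (1 - X)‖ = ‖Z - X‖ := by
    rw [show 1 - Z - (1 - X) = -(Z - X) by ring, norm_neg]
  rw [h5] at h3
  have h6 : ‖Z - X‖ ^ 2 ≤ 6 / 1000000000 * (2 * (‖d‖ * ‖e‖)) := by
    rw [sq]; gcongr
  have h7 : ‖d‖ * ‖e‖ ≤ 6 * (‖d‖ * l) := by
    have := mul_le_mul_of_nonneg_left hel (norm_nonneg d)
    linarith
  have hK : ‖B * d * l‖ = ‖B‖ * (‖d‖ * l) := by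
    rw [norm_mul, norm_mul, Complex.norm_real, Real.norm_eq_abs, abs_of_pos hl, mul_assoc]
  rw [hK]
  have h8 : betaC α (1 - Z) - betaC α (1 - X) - B * d * l * (z - c')
      = (betaC α (1 - Z) - betaC α (1 - X) - B * (1 - Z - (1 - X)))
        - B * (Z - X - d * e) := by
    rw [he]; ring
  rw [h8]
  refine (norm_sub_le _ _).trans ?_
  rw [norm_mul]
  have hdl : 0 ≤ ‖d‖ * l := by positivity
  have h9 : ‖B‖ * ‖Z - X - d * e‖ ≤ ‖B‖ * (1500 / 1000000000 * (‖d‖ * l)) := by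
    gcongr
    linarith
  have h10 : ‖d‖ * l ≤ 1000 / 999 * (‖B‖ * (‖d‖ * l)) := by nlinarith
  linarith

lemma norm_pull_sub_sub_le (h : PullData s c v a α l c') {z w : ℂ} (hz : ‖z‖ ≤ 5) (hw : ‖w‖ ≤ 5)
    (n : ℕ) :
    ‖pullC s c v a α l c' n z - pullC s c v a α l c' n w - pullSlope s c v a α l n * (z - w)‖
      ≤ 4 / 1000000 * ‖pullSlope s c v a α l n‖ := by
  have h1 := h.norm_pull_sub_linear_le hz n
  have h2 := h.norm_pull_sub_linear_le hw n
  set K := pullSlope s c v a α l n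
  set y := betaC α (1 - ((invR s c v a)^[n] c : ℝ))
  calc _ = ‖(pullC s c v a α l c' n z - y - K * (z - c'))
        - (pullC s c v a α l c' n w - y - K * (w - c'))‖ := by congr 1; ring
    _ ≤ _ := norm_sub_le _ _
    _ ≤ _ := by linarith

lemma norm_pull_gap_bounds (h : PullData s c v a α l c') (n : ℕ) :
    999 / 1000 * ‖pullSlope s c v a α l n‖
      ≤ ‖pullC s c v a α l c' n 1 - pullC s c v a α l c' n 0‖ ∧
    ‖pullC s c v a α l c' n 1 - pullC s c v a α l c' n 0‖
      ≤ 1001 / 1000 * ‖pullSlope s c v a α l n‖ := by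
  have h1 := h.norm_pull_sub_sub_le (z := 1) (w := 0) (by simp) (by simp) n
  rw [sub_zero, mul_one] at h1
  set K := pullSlope s c v a α l n
  set g := pullC s c v a α l c' n 1 - pullC s c v a α l c' n 0
  have h2 := norm_sub_norm_le g K
  have h3 := norm_sub_norm_le K g
  rw [norm_sub_rev K g] at h3
  have := norm_nonneg K
  constructor <;> linarith

/-- The normalized pull-back is uniformly close to the identity on a large disc. -/
lemma norm_normalized_pull_sub_le (h : PullData s c v a α l c') {z : ℂ} (hz : ‖z‖ ≤ 5) (n : ℕ) :
    ‖(pullC s c v a α l c' n z - pullC s c v a α l c' n 0)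
      / (pullC s c v a α l c' n 1 - pullC s c v a α l c' n 0) - z‖ ≤ 1 / 20000 := by
  have h1 := h.norm_pull_sub_sub_le (z := 1) (w := 0) (by simp) (by simp) n
  have h2 := h.norm_pull_sub_sub_le (w := 0) hz (by simp) n
  have h3 := (h.norm_pull_gap_bounds n).1
  have hK : 0 < ‖pullSlope s c v a α l n‖ := norm_pos_iff.2 (h.pullSlope_ne_zero n)
  rw [sub_zero, mul_one] at h1
  rw [sub_zero] at h2
  set K := pullSlope s c v a α l n
  set g := pullC s c v a α l c' n 1 - pullC s c v a α l c' n 0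
  set f := pullC s c v a α l c' n z - pullC s c v a α l c' n 0
  have hg : 0 < ‖g‖ := by linarith
  have hg0 : g ≠ 0 := norm_pos_iff.1 hg
  have h4 : f / g - z = ((f - K * z) - z * (g - K)) / g := by
    field_simp
    ring
  rw [h4, norm_div, div_le_iff₀ hg]
  have h5 : ‖z * (g - K)‖ ≤ 5 * (4 / 1000000 * ‖K‖) := by
    rw [norm_mul]; gcongr
  have h6 := norm_sub_le (f - K * z) (z * (g - K))
  linarith

end PullData

end PullBack

section PullBackReal

lemma levelR_lt_levelR {v : ℝ} {a : ℕ → ℝ} (ha : SmallCoeff a) (hv : 0 < v) {x y : ℝ}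
    (hx0 : 0 ≤ x) (hxy : x < y) (hy : y < 2) : levelR v a x < levelR v a y := by
  have h1 := betaR_sub_ge ha (x := y) (y := x) (by rw [abs_of_nonneg (by linarith)]; exact hy)
    (by rw [abs_of_nonneg hx0]; linarith) hxy.le
  unfold levelR
  have h2 : (1 - betaR a y) / v < (1 - betaR a x) / v := by
    gcongr
    linarith
  linarith

/-- The parameter `1 - Q` at the critical point of the renormalized branch. -/
noncomputable def newV (s c v : ℝ) (a α : ℕ → ℝ) (l c' : ℝ) (n : ℕ) (v' : ℝ) : ℝ :=
  1 - ((1 - v') * pullR s c v a α l c' n 1 + v' * pullR s c v a α l c' n 0)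

namespace BranchData

variable {s c v : ℝ} {a : ℕ → ℝ}

lemma one_sub_level_le (h : BranchData s c v a) {x : ℝ} (hx0 : 0 ≤ x) (hx : x ≤ 1) :
    (1 - levelR v a x) * (1 - c) ≤ 1001 / 1000 * (1 - 9 / 10 * c) * (1 - x) := by
  have h1 := (abs_le.1 (abs_betaR_sub_le h.small ⟨hx0, hx⟩)).1
  have hv := h.v_pos
  have hc1 := h.c_lt
  have h2 : 1 - betaR a x ≤ 1001 / 1000 * (1 - x) := by nlinarith
  have h3 : (1 - levelR v a x) * v = 1 - betaR a x := by unfold levelR; field_simp; ring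
  have h4 := h.v_ge
  have h5 : 0 ≤ 1 - levelR v a x := by
    linarith [h.level_le_one hx0 hx]
  calc (1 - levelR v a x) * (1 - c) ≤ (1 - levelR v a x) * (v * (1 - 9 / 10 * c)) := by gcongr
    _ = (1 - 9 / 10 * c) * (1 - betaR a x) := by rw [← h3]; ring
    _ ≤ (1 - 9 / 10 * c) * (1001 / 1000 * (1 - x)) := by
        apply mul_le_mul_of_nonneg_left h2; linarith
    _ = _ := by ring

lemma sqrt_level_le (h : BranchData s c v a) {x : ℝ} (hx0 : 0 ≤ x) (hx : x ≤ 1)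
    (hl : 0 < levelR v a x) : √(levelR v a x) ≤ levelR v a x ^ s := by
  rw [Real.sqrt_eq_rpow]
  exact Real.rpow_le_rpow_of_exponent_ge hl (h.level_le_one hx0 hx) h.s_lt.le

/-- Contraction of the inverse branch towards its fixed point `1`. -/
lemma one_sub_inv_le (h : BranchData s c v a) (hc : 1 / 200 ≤ c) {x : ℝ} (hx0 : 0 ≤ x)
    (hx : x ≤ 1) (hxc : 1 - x ≤ 1000001 / 1000000 * (1 - c)) (hl : 0 < levelR v a x) :
    1 - invR s c v a x ≤ 95 / 100 * (1 - x) := by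
  have h1 := h.one_sub_level_le hx0 hx
  have h2 := h.sqrt_level_le hx0 hx hl
  have hc1 : 0 < 1 - c := by linarith [h.c_lt]
  have h3 : 1 - invR s c v a x = (1 - c) * (1 - levelR v a x ^ s) := by unfold invR; ring
  rw [h3]
  have h4 := h.level_le_one hx0 hx
  set Y := levelR v a x
  have h5 : (1 - Y) * (1 - c) ≤ 9966 / 10000 * (1 - x) := by
    refine h1.trans ?_
    have : 1001 / 1000 * (1 - 9 / 10 * c) ≤ 9966 / 10000 := by linarith
    exact mul_le_mul_of_nonneg_right this (by linarith)
  have h6 : 1 - Y ≤ 9967 / 10000 := by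
    have : (1 - Y) * (1 - c) ≤ 9967 / 10000 * (1 - c) := by nlinarith
    exact le_of_mul_le_mul_right this hc1
  have h7 : 57 / 1000 ≤ √Y := by
    apply Real.le_sqrt_of_sq_le
    linarith
  have h8 : (1 - √Y) * (1057 / 1000) ≤ 1 - Y := by
    have h9 : √Y * √Y = Y := Real.mul_self_sqrt hl.le
    have h10 : √Y ≤ 1 := Real.sqrt_le_one.2 h4
    nlinarith
  have h11 : (1 - c) * (1 - Y ^ s) ≤ (1 - c) * (1 - √Y) := by gcongr
  nlinarith

end BranchData

namespace PullData

variable {s c v : ℝ} {a α : ℕ → ℝ} {l c' : ℝ}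

lemma start_bounds (h : PullData s c v a α l c') {z : ℝ} (hz : z ∈ Icc (0 : ℝ) 1) :
    999999 / 1000000 * c ≤ c + l * (c' - z) ∧
      1 - (c + l * (c' - z)) ≤ 1000001 / 1000000 * (1 - c) ∧
      0 < 1 - (c + l * (c' - z)) := by
  have h1 := h.l_le
  have h2 := h.l_pos
  have h3 := h.c_pos
  have h4 : 0 < 1 - c := by linarith [h.c_lt]
  have h5 : |l * (c' - z)| ≤ 1 / 1000000000 * (c * (1 - c)) := by
    rw [abs_mul, abs_of_pos h2]
    have : |c' - z| ≤ 1 := by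
      rw [abs_le]
      constructor <;> linarith [h.c'_nonneg, h.c'_le, hz.1, hz.2]
    nlinarith
  have h6 := abs_le.1 h5
  have h7 : c * (1 - c) ≤ c := by nlinarith
  have h8 : c * (1 - c) ≤ 1 - c := by nlinarith
  refine ⟨by linarith, by linarith, by linarith⟩

lemma abs_le_five {z : ℝ} (hz : z ∈ Icc (0 : ℝ) 1) : |z| ≤ 5 := by
  rw [abs_of_nonneg hz.1]; linarith [hz.2]

lemma pre_succ (n : ℕ) (z : ℝ) :
    preR s c v a l c' (n + 1) z = invR s c v a (preR s c v a l c' n z) :=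
  Function.iterate_succ_apply' _ _ _

lemma pre_bounds (h : PullData s c v a α l c') {z : ℝ} (hz : z ∈ Icc (0 : ℝ) 1) (n : ℕ) :
    999999 / 1000000 * c ≤ preR s c v a l c' n z ∧ preR s c v a l c' n z < 1 := by
  induction n with
  | zero =>
    have := h.start_bounds hz
    exact ⟨this.1, by simpa [preR] using this.2.2⟩
  | succ n ih =>
    have h1 := (h.pre_ofReal (abs_le_five hz) n).2
    have hc1 : 0 < 1 - c := by linarith [h.c_lt]
    have hc := h.c_pos
    have h2 : levelR v a (preR s c v a l c' n z) < 1 := by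
      have h3 := levelR_lt_levelR h.small h.v_pos (y := 1) (by linarith) ih.2 (by norm_num)
      simpa [levelR] using h3
    rw [pre_succ]
    unfold invR
    have h3 : levelR v a (preR s c v a l c' n z) ^ s < 1 := Real.rpow_lt_one h1.le h2 h.s_pos
    have h4 : 0 < levelR v a (preR s c v a l c' n z) ^ s := Real.rpow_pos_of_pos h1 _
    constructor <;> nlinarith

lemma pre_pos (h : PullData s c v a α l c') {z : ℝ} (hz : z ∈ Icc (0 : ℝ) 1) (n : ℕ) :
    0 < preR s c v a l c' n z :=
  lt_of_lt_of_le (by linarith [h.c_pos]) (h.pre_bounds hz n).1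

lemma pre_strictAnti (h : PullData s c v a α l c') {z w : ℝ} (hz : z ∈ Icc (0 : ℝ) 1)
    (hw : w ∈ Icc (0 : ℝ) 1) (hzw : z < w) (n : ℕ) :
    preR s c v a l c' n w < preR s c v a l c' n z := by
  induction n with
  | zero =>
    have := h.l_pos
    show c + l * (c' - w) < c + l * (c' - z)
    nlinarith
  | succ n ih =>
    rw [pre_succ, pre_succ]
    have h1 := (h.pre_ofReal (abs_le_five hw) n).2
    have h2 := levelR_lt_levelR h.small h.v_pos (h.pre_pos hw n).le ih
      (by linarith [(h.pre_bounds hz n).2])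
    have h3 := Real.rpow_lt_rpow h1.le h2 h.s_pos
    have hc1 : 0 < 1 - c := by linarith [h.c_lt]
    unfold invR
    nlinarith

lemma pull_strictMono (h : PullData s c v a α l c') {z w : ℝ} (hz : z ∈ Icc (0 : ℝ) 1)
    (hw : w ∈ Icc (0 : ℝ) 1) (hzw : z < w) (n : ℕ) :
    pullR s c v a α l c' n z < pullR s c v a α l c' n w := by
  have h1 := h.pre_strictAnti hz hw hzw n
  have h2 := h.pre_pos hw n
  have h3 := h.pre_bounds hz n
  have h4 := betaR_sub_ge h.small' (x := 1 - preR s c v a l c' n w)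
    (y := 1 - preR s c v a l c' n z) (by rw [abs_lt]; constructor <;> linarith)
    (by rw [abs_lt]; constructor <;> linarith) (by linarith)
  unfold pullR
  linarith

lemma pull_bounds (h : PullData s c v a α l c') {z : ℝ} (hz : z ∈ Icc (0 : ℝ) 1) (n : ℕ) :
    0 ≤ pullR s c v a α l c' n z ∧ pullR s c v a α l c' n z ≤ 1 - 999 / 1000 * preR s c v a l c' n z
      ∧ pullR s c v a α l c' n z ≤ 1001 / 1000 * (1 - preR s c v a l c' n z) := by
  have h2 := h.pre_pos hz n
  have h3 := h.pre_bounds hz n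
  have h4 := abs_le.1 (abs_betaR_sub_le h.small' (x := 1 - preR s c v a l c' n z)
    ⟨by linarith, by linarith⟩)
  unfold pullR
  set X := preR s c v a l c' n z
  refine ⟨by nlinarith, by nlinarith, by nlinarith⟩

/-- `newV` is squeezed between the values at the two ends. -/
lemma newV_bounds (h : PullData s c v a α l c') {v' : ℝ} (hv' : v' ∈ Icc (0 : ℝ) 1) (n : ℕ) :
    1 - pullR s c v a α l c' n 1 ≤ newV s c v a α l c' n v' ∧ newV s c v a α l c' n v' ≤ 1 := by
  have h1 := h.pull_strictMono (z := 0) (w := 1) (by simp) (by simp) one_pos n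
  have h2 := (h.pull_bounds (z := 0) (by simp) n).1
  unfold newV
  constructor <;> nlinarith [hv'.1, hv'.2]

lemma newV_ge_pre (h : PullData s c v a α l c') {v' : ℝ} (hv' : v' ∈ Icc (0 : ℝ) 1) (n : ℕ) :
    999 / 1000 * preR s c v a l c' n 1 ≤ newV s c v a α l c' n v' := by
  have h1 := (h.newV_bounds hv' n).1
  have h2 := (h.pull_bounds (z := 1) (by simp) n).2.1
  linarith

lemma newV_pos (h : PullData s c v a α l c') {v' : ℝ} (hv' : v' ∈ Icc (0 : ℝ) 1) (n : ℕ) :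
    0 < newV s c v a α l c' n v' := by
  have h1 := h.newV_ge_pre hv' n
  have h2 := h.pre_pos (z := 1) (by simp) n
  linarith

lemma newV_ge_orbit (h : PullData s c v a α l c') {v' : ℝ} (hv' : v' ∈ Icc (0 : ℝ) 1) (n : ℕ) :
    9 / 10 * (invR s c v a)^[n] c ≤ newV s c v a α l c' n v' := by
  refine le_trans ?_ (h.newV_ge_pre hv' n)
  have h1 := (h.orbit_estimates (by norm_num) (h.norm_start_le (z := (1 : ℝ)) (by simp)) n).2.1
  change ‖preC s c v a l c' n ((1 : ℝ) : ℂ) - _‖ ≤ _ at h1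
  rw [(h.pre_ofReal (x := 1) (by norm_num) n).1, ← Complex.ofReal_sub, Complex.norm_real,
    Real.norm_eq_abs] at h1
  have hc := h.c_pos
  have hc1 : 0 < 1 - c := by linarith [h.c_lt]
  have hv := h.v_pos
  obtain ⟨hX0, hX1⟩ := h.orbit_mem le_rfl h.c_lt.le n
  have hq : (3 / 4 * ((1 - c) / v)) ^ n ≤ 1 :=
    pow_le_one₀ (by positivity) (by linarith [h.ratio_le_one])
  set X := (invR s c v a)^[n] c
  have h2 : (3 / 4 * ((1 - c) / v)) ^ n * (6 / 1000000000) * (1 - c) * X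
      ≤ 1 * (6 / 1000000000) * 1 * X := by
    gcongr
    · linarith
    · linarith
  have := (abs_le.1 h1).1
  linarith

lemma pre_ge_sqrt (h : PullData s c v a α l c') {n : ℕ} (hn : 1 ≤ n) :
    89 / 100 * √c ≤ preR s c v a l c' n 1 := by
  obtain ⟨m, rfl⟩ := Nat.exists_eq_add_of_le' hn
  have hx := h.pre_bounds (z := 1) (by simp) m
  have hl := (h.pre_ofReal (x := 1) (by norm_num) m).2
  have hpos := h.pre_pos (z := 1) (by simp) m
  rw [pre_succ]
  set x := preR s c v a l c' m 1
  have hc := h.c_pos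
  have hc1 : 0 < 1 - c := by linarith [h.c_lt]
  have h1 : (89 / 100) ^ 2 * c ≤ levelR v a x := by
    rcases le_total c x with hcx | hcx
    · have := h.level_ge hcx hx.2.le
      linarith
    · -- compare with the level at the critical point
      have h2 := h.level_ge le_rfl h.c_lt.le
      have h3 := betaR_sub_le h.small (x := c) (y := x)
        (by rw [abs_of_pos hc]; linarith) (by rw [abs_of_pos hpos]; linarith) hcx
      have h4 : levelR v a c - levelR v a x = (betaR a c - betaR a x) / v := by
        unfold levelR; ring
      have h5 : (betaR a c - betaR a x) / v ≤ 1 / 100000 * c := by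
        rw [div_le_iff₀ h.v_pos]
        -- `c - x ≤ l` is tiny compared with `c (1 - c) ≤ c v`
        have h6 := h.ratio_le_one
        rw [div_le_one h.v_pos] at h6
        have h7 : c - x ≤ 1 / 1000000000 * (c * (1 - c)) := by
          rcases Nat.eq_zero_or_pos m with hm | hm
          · have : x = c + l * (c' - 1) := by simp only [x, hm]; rfl
            have h8 := h.l_le
            have h9 := h.l_pos
            have h10 := h.c'_nonneg
            nlinarith
          · obtain ⟨m', rfl⟩ := Nat.exists_eq_add_of_le' hm
            have hl' := (h.pre_ofReal (x := 1) (by norm_num) m').2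
            have : c ≤ x := by
              simp only [x, pre_succ]
              unfold invR
              have := mul_nonneg hc1.le (Real.rpow_nonneg hl'.le s)
              linarith
            have h8 : 0 < c * (1 - c) := by positivity
            linarith
        have h8 : c * (1 - c) ≤ c * v := by gcongr
        nlinarith
      linarith
  have h2 := h.sqrt_level_le hpos.le hx.2.le hl
  have h3 : 89 / 100 * √c ≤ √(levelR v a x) := by
    calc 89 / 100 * √c = √((89 / 100) ^ 2 * c) := by
          rw [Real.sqrt_mul (by norm_num), Real.sqrt_sq (by norm_num)]
      _ ≤ _ := Real.sqrt_le_sqrt h1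
  have h4 : levelR v a x ^ s ≤ 1 :=
    Real.rpow_le_one hl.le (h.level_le_one hpos.le hx.2.le) h.s_pos.le
  unfold invR
  nlinarith

lemma newV_ge_sqrt (h : PullData s c v a α l c') {v' : ℝ} (hv' : v' ∈ Icc (0 : ℝ) 1) {n : ℕ}
    (hn : 1 ≤ n) : 88 / 100 * √c ≤ newV s c v a α l c' n v' := by
  have h1 := h.newV_ge_pre hv' n
  have h2 := h.pre_ge_sqrt hn
  have := Real.sqrt_nonneg c
  linarith

lemma one_sub_pre_le (h : PullData s c v a α l c') (hc : 1 / 200 ≤ c) (n : ℕ) :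
    1 - preR s c v a l c' n 1 ≤ (95 / 100) ^ n * (1000001 / 1000000 * (1 - c)) := by
  induction n with
  | zero => simpa [preR] using (h.start_bounds (z := 1) (by simp)).2.1
  | succ n ih =>
    have hc1 : 0 < 1 - c := by linarith [h.c_lt]
    have h1 := h.one_sub_inv_le hc (h.pre_pos (z := 1) (by simp) n).le
      (h.pre_bounds (z := 1) (by simp) n).2.le
      (ih.trans (mul_le_of_le_one_left (by positivity)
        (pow_le_one₀ (by norm_num) (by norm_num))))
      (h.pre_ofReal (x := 1) (by norm_num) n).2
    rw [pre_succ, pow_succ]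
    linarith

/-- The renormalized parameter satisfies the invariance condition of `BranchData`. -/
lemma le_newV_mul (h : PullData s c v a α l c') {v' : ℝ} (hv' : v' ∈ Icc (0 : ℝ) 1) {n : ℕ}
    (hn : 60 ≤ n) : c ≤ newV s c v a α l c' n v' * (1 - 9 / 10 * (1 - c)) := by
  have hc := h.c_pos
  have hc1 : 0 < 1 - c := by linarith [h.c_lt]
  rcases le_total (1 / 200) c with hcc | hcc
  · have h1 := h.one_sub_pre_le hcc n
    have h2 : ((95 : ℝ) / 100) ^ n ≤ 95 / 1000 :=
      (pow_le_pow_of_le_one (by norm_num) (by norm_num) hn).trans (by norm_num)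
    have h3 := (h.newV_bounds hv' n).1
    have h4 := (h.pull_bounds (z := 1) (by simp) n).2.2
    have h5 : (95 / 100) ^ n * (1000001 / 1000000 * (1 - c))
        ≤ 95 / 1000 * (1000001 / 1000000 * (1 - c)) := by gcongr
    have h6 : 1 - newV s c v a α l c' n v' ≤ 1 / 10 * (1 - c) := by linarith
    nlinarith
  · have h1 := h.newV_ge_sqrt hv' (n := n) (by omega)
    have h2 : √c ≤ 88 / 1000 := by
      rw [Real.sqrt_le_left (by norm_num)]
      linarith
    have h3 : √c * √c = c := Real.mul_self_sqrt hc.le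
    have h4 := Real.sqrt_nonneg c
    nlinarith

lemma gap_eq (h : PullData s c v a α l c') (n : ℕ) :
    pullR s c v a α l c' n 1 - pullR s c v a α l c' n 0
      = ‖pullC s c v a α l c' n 1 - pullC s c v a α l c' n 0‖ := by
  have h1 := h.pull_strictMono (z := 0) (w := 1) (by simp) (by simp) one_pos n
  have h2 := h.pull_ofReal (x := 1) (by norm_num) n
  have h3 := h.pull_ofReal (x := 0) (by norm_num) n
  rw [Complex.ofReal_one] at h2
  rw [Complex.ofReal_zero] at h3
  rw [h2, h3, ← Complex.ofReal_sub, Complex.norm_real, Real.norm_eq_abs, abs_of_pos (by linarith)]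

lemma gap_ge (h : PullData s c v a α l c') (n : ℕ) :
    4 / 10 * (9 / 10 * s * (1 - c)) ^ n * l
      ≤ pullR s c v a α l c' n 1 - pullR s c v a α l c' n 0 := by
  rw [h.gap_eq]
  refine le_trans ?_ (h.norm_pull_gap_bounds n).1
  have hl := h.l_pos
  have h1 := h.norm_orbitMult_ge n
  have hc1 : 0 < 1 - c := by linarith [h.c_lt]
  have hs := h.s_pos
  have hB := (h.norm_deriv_beta_bounds n).1
  rw [pullSlope, norm_mul, norm_mul, Complex.norm_real, Real.norm_eq_abs, abs_of_pos hl]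
  calc 4 / 10 * (9 / 10 * s * (1 - c)) ^ n * l
      ≤ 999 / 1000 * (999 / 1000) * (9 / 10 * s * (1 - c)) ^ n * l := by
        gcongr
        norm_num
    _ = 999 / 1000 * (999 / 1000 * (9 / 10 * s * (1 - c)) ^ n * l) := by ring
    _ ≤ _ := by gcongr

lemma gap_le (h : PullData s c v a α l c') {v' : ℝ} (hv' : v' ∈ Icc (0 : ℝ) 1) (n : ℕ) :
    (pullR s c v a α l c' n 1 - pullR s c v a α l c' n 0) * c
      ≤ 3 * (3 / 4 * ((1 - c) / v)) ^ n * l * newV s c v a α l c' n v' := by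
  have hc := h.c_pos
  have hc1 : 0 < 1 - c := by linarith [h.c_lt]
  have hv := h.v_pos
  have hl := h.l_pos
  have h1 := (h.norm_pull_gap_bounds n).2
  rw [← h.gap_eq] at h1
  have h2 := h.norm_orbitMult_le n
  rw [le_div_iff₀ hc] at h2
  have hB := (h.norm_deriv_beta_bounds n).2
  rw [pullSlope, norm_mul, norm_mul, Complex.norm_real, Real.norm_eq_abs, abs_of_pos hl] at h1
  have h3 := h.newV_ge_orbit hv' n
  set X := (invR s c v a)^[n] c
  set B := ‖deriv (betaC α) (1 - (X : ℝ))‖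
  set d := ‖orbitMult s c v a n‖
  have hd : 0 ≤ d := norm_nonneg _
  calc (pullR s c v a α l c' n 1 - pullR s c v a α l c' n 0) * c
      ≤ (1001 / 1000 * (B * d * l)) * c := by gcongr
    _ ≤ (1001 / 1000 * (1001 / 1000 * d * l)) * c := by gcongr
    _ = 1001 / 1000 * (1001 / 1000) * l * (d * c) := by ring
    _ ≤ 1001 / 1000 * (1001 / 1000) * l * (2 * (3 / 4 * ((1 - c) / v)) ^ n * X) := by gcongr
    _ ≤ 1001 / 1000 * (1001 / 1000) * l
        * (2 * (3 / 4 * ((1 - c) / v)) ^ n * (10 / 9 * newV s c v a α l c' n v')) := by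
        gcongr
        linarith
    _ = (1001 / 1000 * (1001 / 1000) * 2 * (10 / 9))
        * ((3 / 4 * ((1 - c) / v)) ^ n * l * newV s c v a α l c' n v') := by ring
    _ ≤ 3 * ((3 / 4 * ((1 - c) / v)) ^ n * l * newV s c v a α l c' n v') := by
        have := h.newV_pos hv' n
        gcongr
        norm_num
    _ = _ := by ring

end PullData

end PullBackReal

section TaylorCoefficients

/-- The Taylor coefficients at `0`, computed on the circle of radius `4`. -/
noncomputable def taylorCoeff (f : ℂ → ℂ) (n : ℕ) : ℂ :=
  (2 * Real.pi * Complex.I : ℂ)⁻¹ • ∮ z in C(0, 4), (z⁻¹) ^ n • z⁻¹ • f z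

lemma norm_taylorCoeff_le {f : ℂ → ℂ} {ε : ℝ} (hf : ∀ z, ‖z‖ ≤ 5 → ‖f z‖ ≤ ε) (n : ℕ) :
    ‖taylorCoeff f n‖ ≤ ε * (1 / 4) ^ n := by
  have h := circleIntegral.norm_two_pi_i_inv_smul_integral_le_of_norm_le_const
    (f := fun z => (z⁻¹) ^ n • z⁻¹ • f z) (c := 0) (R := 4) (C := (1 / 4) ^ n * (1 / 4 * ε))
    (by norm_num) (by
      intro z hz
      have hz4 : ‖z‖ = 4 := by simpa using hz
      rw [norm_smul, norm_smul, norm_pow, norm_inv, hz4, ← one_div]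
      gcongr
      exact hf z (by linarith))
  refine h.trans_eq ?_
  ring

lemma hasSum_taylorCoeff {f : ℂ → ℂ} (hf : ∀ z, ‖z‖ ≤ 5 → DifferentiableAt ℂ f z) {z : ℂ}
    (hz : ‖z‖ < 4) : HasSum (fun n => taylorCoeff f n * z ^ n) (f z) := by
  have h1 : DiffContOnCl ℂ f (Metric.ball 0 (4 : NNReal)) := by
    apply DifferentiableOn.diffContOnCl
    intro w hw
    refine (hf w ?_).differentiableWithinAt
    have := Metric.closure_ball_subset_closedBall hw
    have h4 : ‖w‖ ≤ ((4 : NNReal) : ℝ) := by simpa using this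
    have : ((4 : NNReal) : ℝ) = 4 := by norm_num
    linarith
  have h2 := h1.hasFPowerSeriesOnBall (by norm_num)
  have h3 := h2.hasSum (y := z) (by
    rw [Metric.mem_eball, edist_zero_right, enorm_eq_nnnorm]
    norm_cast)
  rw [zero_add] at h3
  have h4 : (fun n => taylorCoeff f n * z ^ n)
      = fun n => cauchyPowerSeries f 0 (4 : NNReal) n fun _ => z := by
    ext n
    rw [cauchyPowerSeries_apply, taylorCoeff, smul_eq_mul, smul_eq_mul, mul_assoc]
    congr 1
    rw [mul_comm, ← circleIntegral.integral_const_mul]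
    congr 1
    ext w
    simp only [sub_zero, smul_eq_mul, div_eq_mul_inv, mul_pow]
    ring
  rw [h4]
  exact h3

/-- A holomorphic function near the closed disc which is real on `[0,1]` and vanishes at both ends
is recovered there from the real parts of its Taylor coefficients. -/
lemma betaR_taylorCoeff {f : ℂ → ℂ} (hf : ∀ z, ‖z‖ ≤ 5 → DifferentiableAt ℂ f z)
    (h0 : f 0 = 0) (h1 : f 1 = 0) {x y : ℝ} (hx : x ∈ Icc (0 : ℝ) 1) (hxy : f x = y) :
    betaR (fun j => (taylorCoeff f (j + 2)).re) x = x + y := by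
  have hs1 := hasSum_taylorCoeff hf (z := 1) (by norm_num)
  have hsx := hasSum_taylorCoeff hf (z := x) (by
    rw [Complex.norm_real, Real.norm_eq_abs, abs_of_nonneg hx.1]; linarith [hx.2])
  have hs0 := hasSum_taylorCoeff hf (z := 0) (by norm_num)
  have hc0 : taylorCoeff f 0 = 0 := by
    have h2 : HasSum (fun n => taylorCoeff f n * (0 : ℂ) ^ n) (taylorCoeff f 0 * (0 : ℂ) ^ 0) :=
      hasSum_single 0 (fun n hn => by simp [hn])
    have := hs0.unique h2
    rw [h0] at this
    simpa using this.symm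
  have h3 := hsx.sub (hs1.mul_left (x : ℂ))
  rw [h1, mul_zero, sub_zero, hxy] at h3
  rw [← hasSum_nat_add_iff' 2] at h3
  simp only [Finset.sum_range_succ, Finset.sum_range_zero, hc0] at h3
  have h4 := Complex.hasSum_re h3
  have h5 : HasSum (fun j => (taylorCoeff f (j + 2)).re * (x ^ (j + 2) - x)) y := by
    convert h4 using 1
    · ext j
      have : taylorCoeff f (j + 2) * (x : ℂ) ^ (j + 2) - x * (taylorCoeff f (j + 2) * 1 ^ (j + 2))
          = taylorCoeff f (j + 2) * ((x ^ (j + 2) - x : ℝ) : ℂ) := by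
        push_cast; ring
      rw [this, Complex.re_mul_ofReal]
    · simp
      ring
  rw [betaR, h5.tsum_eq]

lemma continuous_taylorCoeff {P : Type*} [TopologicalSpace P] {f : P → ℂ → ℂ}
    (hf : Continuous fun q : P × {z : ℂ // ‖z‖ ≤ 5} => f q.1 q.2) (n : ℕ) :
    Continuous fun p => taylorCoeff (f p) n := by
  unfold taylorCoeff circleIntegral
  refine (continuous_const_smul _).comp ?_
  apply intervalIntegral.continuous_parametric_intervalIntegral_of_continuous'
  have hmap : Continuous fun q : P × ℝ => circleMap 0 4 q.2 :=
    (continuous_circleMap 0 4).comp continuous_snd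
  have hne : ∀ q : P × ℝ, circleMap 0 4 q.2 ≠ 0 := fun q => circleMap_ne_center (by norm_num)
  have hinv : Continuous fun q : P × ℝ => (circleMap 0 4 q.2)⁻¹ := hmap.inv₀ hne
  have hnorm : ∀ θ, ‖circleMap 0 4 θ‖ ≤ 5 := fun θ => by
    rw [norm_circleMap_zero]; norm_num
  have hq : Continuous fun q : P × ℝ =>
      ((q.1, ⟨circleMap 0 4 q.2, hnorm q.2⟩) : P × {z : ℂ // ‖z‖ ≤ 5}) :=
    continuous_fst.prodMk (hmap.subtype_mk _)
  have hff : Continuous fun q : P × ℝ => f q.1 (circleMap 0 4 q.2) :=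
    hf.comp hq
  simp only [Function.uncurry_def, deriv_circleMap]
  exact (hmap.mul continuous_const).smul ((hinv.pow n).smul (hinv.smul hff))

end TaylorCoefficients

section ParameterContinuity

variable {P : Type*} [TopologicalSpace P]

lemma Continuous.betaC_comp {a : P → ℕ → ℝ} {z : P → ℂ} (ha : Continuous a) (hz : Continuous z)
    (hs : ∀ p, SmallCoeff (a p)) (hn : ∀ p, ‖z p‖ ≤ 3) :
    Continuous fun p => betaC (a p) (z p) :=
  continuousOn_betaC.comp_continuous (ha.prodMk hz) fun p => ⟨hs p, hn p⟩

lemma Continuous.invC_comp (s : ℝ) {c v : P → ℝ} {a : P → ℕ → ℝ} {z : P → ℂ} (hc : Continuous c)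
    (hv : Continuous v) (hv0 : ∀ p, v p ≠ 0) (ha : Continuous a) (hz : Continuous z)
    (hs : ∀ p, SmallCoeff (a p)) (hn : ∀ p, ‖z p‖ ≤ 3)
    (hl : ∀ p, levelC (v p) (a p) (z p) ∈ Complex.slitPlane) :
    Continuous fun p => invC s (c p) (v p) (a p) (z p) := by
  have h1 := ha.betaC_comp hz hs hn
  have hc' : Continuous fun p => ((c p : ℝ) : ℂ) := Complex.continuous_ofReal.comp hc
  have hv' : Continuous fun p => ((v p : ℝ) : ℂ) := Complex.continuous_ofReal.comp hv
  have h2 : Continuous fun p => levelC (v p) (a p) (z p) :=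
    continuous_const.sub ((continuous_const.sub h1).div hv' fun p => by exact_mod_cast hv0 p)
  have h3 : Continuous fun p => levelC (v p) (a p) (z p) ^ (s : ℂ) :=
    h2.cpow continuous_const hl
  exact hc'.add ((continuous_const.sub hc').mul h3)

lemma Continuous.preC_comp {s : ℝ} {c v l c' : P → ℝ} {a α : P → ℕ → ℝ} {z : P → ℂ}
    (hc : Continuous c) (hv : Continuous v) (hl : Continuous l) (hc' : Continuous c')
    (ha : Continuous a) (hz : Continuous z)
    (h : ∀ p, PullData s (c p) (v p) (a p) (α p) (l p) (c' p)) (hn : ∀ p, ‖z p‖ ≤ 5) (n : ℕ) :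
    Continuous fun p => preC s (c p) (v p) (a p) (l p) (c' p) n (z p) := by
  induction n with
  | zero =>
    show Continuous fun p => ((c p : ℝ) : ℂ) + l p * (c' p - z p)
    fun_prop
  | succ n ih =>
    have h1 : (fun p => preC s (c p) (v p) (a p) (l p) (c' p) (n + 1) (z p))
        = fun p => invC s (c p) (v p) (a p) (preC s (c p) (v p) (a p) (l p) (c' p) n (z p)) := by
      ext p
      simp only [preC, Function.iterate_succ_apply']
    rw [h1]
    exact Continuous.invC_comp s hc hv (fun p => (h p).v_pos.ne') ha ih (fun p => (h p).small)
      (fun p => by linarith [(h p).norm_pre_lt (hn p) n]) fun p => (h p).level_pre_mem (hn p) n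

lemma Continuous.pullC_comp {s : ℝ} {c v l c' : P → ℝ} {a α : P → ℕ → ℝ} {z : P → ℂ}
    (hc : Continuous c) (hv : Continuous v) (hl : Continuous l) (hc' : Continuous c')
    (ha : Continuous a) (hα : Continuous α) (hz : Continuous z)
    (h : ∀ p, PullData s (c p) (v p) (a p) (α p) (l p) (c' p)) (hn : ∀ p, ‖z p‖ ≤ 5) (n : ℕ) :
    Continuous fun p => pullC s (c p) (v p) (a p) (α p) (l p) (c' p) n (z p) :=
  hα.betaC_comp (continuous_const.sub (hc.preC_comp hv hl hc' ha hz h hn n))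
    (fun p => (h p).small') fun p => by linarith [(h p).norm_one_sub_pre_lt (hn p) n]

lemma Continuous.pullR_comp {s : ℝ} {c v l c' : P → ℝ} {a α : P → ℕ → ℝ} {x : ℝ}
    (hc : Continuous c) (hv : Continuous v) (hl : Continuous l) (hc' : Continuous c')
    (ha : Continuous a) (hα : Continuous α) (hx : x ∈ Icc (0 : ℝ) 1)
    (h : ∀ p, PullData s (c p) (v p) (a p) (α p) (l p) (c' p)) (n : ℕ) :
    Continuous fun p => pullR s (c p) (v p) (a p) (α p) (l p) (c' p) n x := by
  have hx5 := PullData.abs_le_five hx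
  have h1 : (fun p => pullR s (c p) (v p) (a p) (α p) (l p) (c' p) n x)
      = fun p => (pullC s (c p) (v p) (a p) (α p) (l p) (c' p) n x).re := by
    ext p
    rw [(h p).pull_ofReal hx5, Complex.ofReal_re]
  rw [h1]
  exact Complex.continuous_re.comp (hc.pullC_comp hv hl hc' ha hα continuous_const h
    (fun p => by rwa [Complex.norm_real]) n)

/-- The normalized pull-back minus the identity. -/
noncomputable def pullDefect (s c v : ℝ) (a α : ℕ → ℝ) (l c' : ℝ) (n : ℕ) (z : ℂ) : ℂ :=
  (pullC s c v a α l c' n z - pullC s c v a α l c' n 0)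
    / (pullC s c v a α l c' n 1 - pullC s c v a α l c' n 0) - z

lemma PullData.pull_gap_ne_zero {s c v : ℝ} {a α : ℕ → ℝ} {l c' : ℝ}
    (h : PullData s c v a α l c') (n : ℕ) :
    pullC s c v a α l c' n 1 - pullC s c v a α l c' n 0 ≠ 0 := by
  have h1 := h.pull_strictMono (z := 0) (w := 1) (by simp) (by simp) one_pos n
  rw [← norm_pos_iff, ← h.gap_eq]
  linarith

lemma Continuous.taylorCoeff_pullDefect {s : ℝ} {c v l c' : P → ℝ} {a α : P → ℕ → ℝ}
    (hc : Continuous c) (hv : Continuous v) (hl : Continuous l) (hc' : Continuous c')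
    (ha : Continuous a) (hα : Continuous α)
    (h : ∀ p, PullData s (c p) (v p) (a p) (α p) (l p) (c' p)) (n j : ℕ) :
    Continuous fun p =>
      taylorCoeff (pullDefect s (c p) (v p) (a p) (α p) (l p) (c' p) n) j := by
  apply continuous_taylorCoeff
  have hfst : Continuous (Prod.fst : P × {z : ℂ // ‖z‖ ≤ 5} → P) := continuous_fst
  have hz : Continuous fun q : P × {z : ℂ // ‖z‖ ≤ 5} => (q.2 : ℂ) := by fun_prop
  have key : ∀ z : P × {z : ℂ // ‖z‖ ≤ 5} → ℂ, Continuous z → (∀ q, ‖z q‖ ≤ 5) →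
      Continuous fun q : P × {z : ℂ // ‖z‖ ≤ 5} =>
        pullC s (c q.1) (v q.1) (a q.1) (α q.1) (l q.1) (c' q.1) n (z q) := fun z hz hn =>
    (hc.comp hfst).pullC_comp (hv.comp hfst) (hl.comp hfst) (hc'.comp hfst) (ha.comp hfst)
      (hα.comp hfst) hz (fun q => h q.1) hn n
  have h0 := key (fun _ => 0) continuous_const (by simp)
  have h1 := key (fun _ => 1) continuous_const (by simp)
  have hz' := key (fun q => q.2) hz fun q => q.2.2
  exact ((hz'.sub h0).div (h1.sub h0) fun q => (h q.1).pull_gap_ne_zero n).sub hz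

end ParameterContinuity

section Scale

/-- The contribution of one branch to the scaling equation of the renormalization. -/
noncomputable def branchScale (s c v : ℝ) (a α : ℕ → ℝ) (l c' : ℝ) (n : ℕ) (v' : ℝ) : ℝ :=
  (v' * ((pullR s c v a α l c' n 1 - pullR s c v a α l c' n 0) / l)
    / newV s c v a α l c' n v') ^ s * c

namespace PullData

variable {s c v : ℝ} {a α : ℕ → ℝ} {l c' : ℝ}

lemma scale_base_nonneg (h : PullData s c v a α l c') {v' : ℝ} (hv' : v' ∈ Icc (0 : ℝ) 1) (n : ℕ) :
    0 ≤ v' * ((pullR s c v a α l c' n 1 - pullR s c v a α l c' n 0) / l)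
      / newV s c v a α l c' n v' := by
  have h1 := h.pull_strictMono (z := 0) (w := 1) (by simp) (by simp) one_pos n
  have h2 := h.newV_pos hv' n
  exact div_nonneg (mul_nonneg hv'.1 (div_nonneg (by linarith) h.l_pos.le)) h2.le

lemma branchScale_nonneg (h : PullData s c v a α l c') {v' : ℝ} (hv' : v' ∈ Icc (0 : ℝ) 1)
    (n : ℕ) : 0 ≤ branchScale s c v a α l c' n v' :=
  mul_nonneg (Real.rpow_nonneg (h.scale_base_nonneg hv' n) _) h.c_pos.le

lemma scale_base_le (h : PullData s c v a α l c') {v' : ℝ} (hv' : v' ∈ Icc (0 : ℝ) 1) (n : ℕ) :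
    v' * ((pullR s c v a α l c' n 1 - pullR s c v a α l c' n 0) / l)
      / newV s c v a α l c' n v' ≤ 3 * (3 / 4) ^ n * ((1 - c) / v) ^ n / c := by
  have h1 := h.pull_strictMono (z := 0) (w := 1) (by simp) (by simp) one_pos n
  have h2 := h.newV_pos hv' n
  have h3 := h.gap_le hv' n
  have hl := h.l_pos
  have hc := h.c_pos
  set g := pullR s c v a α l c' n 1 - pullR s c v a α l c' n 0
  rw [div_le_div_iff₀ h2 hc]
  have h4 : v' * (g / l) ≤ g / l := mul_le_of_le_one_left (div_nonneg (by linarith) hl.le) hv'.2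
  calc v' * (g / l) * c ≤ g / l * c := by gcongr
    _ = g * c / l := by ring
    _ ≤ 3 * (3 / 4 * ((1 - c) / v)) ^ n * l * newV s c v a α l c' n v' / l := by gcongr
    _ = _ := by rw [mul_pow]; field_simp

lemma rate_sq_le (h : PullData s c v a α l c') (hv : √(1 - c) / 4 ≤ v) :
    ((1 - c) / v) ^ 2 ≤ 16 * (1 - c) := by
  have hc1 : 0 < 1 - c := by linarith [h.c_lt]
  have hv0 := h.v_pos
  have h1 : √(1 - c) * √(1 - c) = 1 - c := Real.mul_self_sqrt hc1.le
  have h2 := Real.sqrt_nonneg (1 - c)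
  rw [div_pow, div_le_iff₀ (by positivity)]
  have h3 : 1 - c ≤ 16 * v ^ 2 := by nlinarith
  nlinarith

lemma rate_rpow_le (h : PullData s c v a α l c') (hv : √(1 - c) / 4 ≤ v) {n : ℕ} {t : ℝ}
    (ht : 0 ≤ t) (hn : 2 * t ≤ n * s) :
    (((1 - c) / v) ^ n) ^ s ≤ (16 * (1 - c)) ^ t := by
  have hc1 : 0 < 1 - c := by linarith [h.c_lt]
  have hμ : 0 < (1 - c) / v := div_pos hc1 h.v_pos
  calc (((1 - c) / v) ^ n) ^ s = ((1 - c) / v) ^ (n * s) := by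
        rw [← Real.rpow_natCast, ← Real.rpow_mul hμ.le]
    _ ≤ ((1 - c) / v) ^ (2 * t) := Real.rpow_le_rpow_of_exponent_ge hμ h.ratio_le_one hn
    _ = (((1 - c) / v) ^ 2) ^ t := by
        rw [← Real.rpow_natCast, ← Real.rpow_mul hμ.le]; norm_num
    _ ≤ _ := Real.rpow_le_rpow (by positivity) (h.rate_sq_le hv) ht

lemma branchScale_le_rate (h : PullData s c v a α l c') {v' : ℝ} (hv' : v' ∈ Icc (0 : ℝ) 1)
    (hv : √(1 - c) / 4 ≤ v) {n : ℕ} {t : ℝ} (ht : 0 ≤ t) (hn : 2 * t ≤ n * s) :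
    branchScale s c v a α l c' n v'
      ≤ (3 * (3 / 4) ^ n) ^ s * (16 * (1 - c)) ^ t * c ^ (1 - s) := by
  have hc := h.c_pos
  have hc1 : 0 < 1 - c := by linarith [h.c_lt]
  have hv0 := h.v_pos
  have h1 := Real.rpow_le_rpow (h.scale_base_nonneg hv' n) (h.scale_base_le hv' n) h.s_pos.le
  unfold branchScale
  calc _ ≤ (3 * (3 / 4) ^ n * ((1 - c) / v) ^ n / c) ^ s * c := by gcongr
    _ = (3 * (3 / 4) ^ n) ^ s * (((1 - c) / v) ^ n) ^ s * (c / c ^ s) := by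
        rw [Real.div_rpow (by positivity) hc.le, Real.mul_rpow (by positivity) (by positivity)]
        ring
    _ = (3 * (3 / 4) ^ n) ^ s * (((1 - c) / v) ^ n) ^ s * c ^ (1 - s) := by
        rw [Real.rpow_sub hc, Real.rpow_one]
    _ ≤ _ := by
        have := h.rate_rpow_le hv ht hn
        gcongr

/-- The contribution of a branch is small compared with the product of the two lengths. -/
lemma branchScale_le (h : PullData s c v a α l c') {v' : ℝ} (hv' : v' ∈ Icc (0 : ℝ) 1)
    (hv : √(1 - c) / 4 ≤ v) {n : ℕ} (hn : 2 * (1 - s) ≤ n * s)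
    (hsmall : 2 * ((3 * (3 / 4) ^ n) ^ s * 16 ^ (1 - s)) ≤ (1 / 1000000000 : ℝ) ^ (1 - s)) :
    2 * branchScale s c v a α l c' n v' ≤ (1 / 1000000000 * (c * (1 - c))) ^ (1 - s) := by
  have hc := h.c_pos
  have hc1 : 0 < 1 - c := by linarith [h.c_lt]
  have h1 := h.branchScale_le_rate hv' hv (by linarith [h.s_lt]) hn
  have hp : 0 ≤ (c * (1 - c)) ^ (1 - s) := by positivity
  calc 2 * branchScale s c v a α l c' n v'
      ≤ 2 * ((3 * (3 / 4) ^ n) ^ s * (16 * (1 - c)) ^ (1 - s) * c ^ (1 - s)) := by gcongr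
    _ = 2 * ((3 * (3 / 4) ^ n) ^ s * 16 ^ (1 - s)) * (c * (1 - c)) ^ (1 - s) := by
        rw [Real.mul_rpow (by norm_num) hc1.le, Real.mul_rpow hc.le hc1.le]; ring
    _ ≤ (1 / 1000000000 : ℝ) ^ (1 - s) * (c * (1 - c)) ^ (1 - s) := by gcongr
    _ = _ := by rw [← Real.mul_rpow (by norm_num) (by positivity)]

lemma branchScale_le_of_near_one (h : PullData s c v a α l c') {v' : ℝ}
    (hv' : v' ∈ Icc (0 : ℝ) 1) (hv : √(1 - c) / 4 ≤ v) {n : ℕ} (hn : 2 * (2 + s) ≤ n * s) :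
    branchScale s c v a α l c' n v' ≤ 3 ^ s * (16 * (1 - c)) ^ (2 + s) := by
  have hc := h.c_pos
  have hs := h.s_pos
  have hc1 : 0 < 1 - c := by linarith [h.c_lt]
  have h1 := h.branchScale_le_rate hv' hv (by linarith) hn
  have h2 : c ^ (1 - s) ≤ 1 := Real.rpow_le_one hc.le h.c_lt.le (by linarith [h.s_lt])
  have h3 : ((3 : ℝ) * (3 / 4) ^ n) ^ s ≤ 3 ^ s := by
    apply Real.rpow_le_rpow (by positivity) _ hs.le
    have : ((3 : ℝ) / 4) ^ n ≤ 1 := pow_le_one₀ (by norm_num) (by norm_num)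
    linarith
  calc _ ≤ _ := h1
    _ ≤ 3 ^ s * (16 * (1 - c)) ^ (2 + s) * 1 := by gcongr
    _ = _ := mul_one _

lemma branchScale_ge (h : PullData s c v a α l c') {v' w : ℝ} (hv' : v' ∈ Icc (0 : ℝ) 1)
    (hw0 : 0 ≤ w) (hw : w ≤ v') (n : ℕ) :
    (w * (4 / 10 * (9 / 10 * s * (1 - c)) ^ n)) ^ s * c ≤ branchScale s c v a α l c' n v' := by
  have hc := h.c_pos
  have hs := h.s_pos
  have hl := h.l_pos
  have hc1 : 0 < 1 - c := by linarith [h.c_lt]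
  have h1 := h.newV_pos hv' n
  have h2 := (h.newV_bounds hv' n).2
  have h3 : 4 / 10 * (9 / 10 * s * (1 - c)) ^ n
      ≤ (pullR s c v a α l c' n 1 - pullR s c v a α l c' n 0) / l := by
    rw [le_div_iff₀ hl]; exact h.gap_ge n
  unfold branchScale
  gcongr
  rw [le_div_iff₀ h1]
  calc w * (4 / 10 * (9 / 10 * s * (1 - c)) ^ n) * newV s c v a α l c' n v'
      ≤ w * (4 / 10 * (9 / 10 * s * (1 - c)) ^ n) * 1 := by gcongr
    _ = w * (4 / 10 * (9 / 10 * s * (1 - c)) ^ n) := mul_one _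
    _ ≤ _ := by
        have := hv'.1
        gcongr

end PullData

lemma exists_eta {s : ℝ} (hs : 0 < s) (M : ℕ) :
    ∃ η : ℝ, 0 < η ∧ η ≤ 1 / 100 ∧ 256 * 48 ^ s * √η ^ s ≤ (1 / 10 * (9 / 20 * s) ^ M) ^ s := by
  set K := (1 / 10 * (9 / 20 * s) ^ M) ^ s / (256 * 48 ^ s) with hK
  have hKpos : 0 < K := by positivity
  set t := K ^ s⁻¹ with ht
  have htpos : 0 < t := by positivity
  refine ⟨min (1 / 100) (t ^ 2), by positivity, min_le_left _ _, ?_⟩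
  have h1 : √(min (1 / 100) (t ^ 2)) ≤ t := by
    calc _ ≤ √(t ^ 2) := Real.sqrt_le_sqrt (min_le_right _ _)
      _ = t := Real.sqrt_sq htpos.le
  have h2 : √(min (1 / 100) (t ^ 2)) ^ s ≤ K := by
    calc _ ≤ t ^ s := Real.rpow_le_rpow (Real.sqrt_nonneg _) h1 hs.le
      _ = K := by rw [ht, ← Real.rpow_mul hKpos.le, inv_mul_cancel₀ hs.ne', Real.rpow_one]
  calc 256 * 48 ^ s * _ ≤ 256 * 48 ^ s * K := by gcongr
    _ = _ := by rw [hK]; field_simp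

lemma exists_length_threshold {s : ℝ} (hs : 0 < s) :
    ∃ N : ℕ, 60 ≤ N ∧ ∀ n : ℕ, N ≤ n → 2 * (1 - s) ≤ n * s ∧ 2 * (2 + s) ≤ n * s ∧
      2 * ((3 * (3 / 4) ^ n) ^ s * 16 ^ (1 - s)) ≤ (1 / 1000000000 : ℝ) ^ (1 - s) := by
  have h1 : Filter.Tendsto (fun n : ℕ => 2 * ((3 * (3 / 4 : ℝ) ^ n) ^ s * 16 ^ (1 - s)))
      Filter.atTop (nhds 0) := by
    have h2 : Filter.Tendsto (fun n : ℕ => 3 * (3 / 4 : ℝ) ^ n) Filter.atTop (nhds 0) := by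
      simpa using (tendsto_pow_atTop_nhds_zero_of_lt_one (r := (3 / 4 : ℝ)) (by norm_num)
        (by norm_num)).const_mul 3
    have h3 := h2.rpow_const (p := s) (Or.inr hs.le)
    rw [Real.zero_rpow hs.ne'] at h3
    simpa using (h3.mul_const ((16 : ℝ) ^ (1 - s))).const_mul 2
  have h4 : ∀ᶠ n : ℕ in Filter.atTop,
      2 * ((3 * (3 / 4 : ℝ) ^ n) ^ s * 16 ^ (1 - s)) ≤ (1 / 1000000000 : ℝ) ^ (1 - s) :=
    h1.eventually_le_const (by positivity)
  obtain ⟨N₁, hN₁⟩ := Filter.eventually_atTop.1 h4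
  obtain ⟨N₂, hN₂⟩ := exists_nat_ge (2 * (2 + s) / s)
  refine ⟨max 60 (max N₁ N₂), le_max_left _ _, fun n hn => ?_⟩
  have hn1 : N₁ ≤ n := (le_max_left _ _).trans ((le_max_right _ _).trans hn)
  have hn2 : N₂ ≤ n := (le_max_right _ _).trans ((le_max_right _ _).trans hn)
  have h5 : 2 * (2 + s) ≤ n * s := by
    have : (N₂ : ℝ) ≤ n := by exact_mod_cast hn2
    rw [div_le_iff₀ hs] at hN₂
    nlinarith
  exact ⟨by linarith, h5, hN₁ n hn1⟩

end Scale

section RenormalizationSystem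

/-- The coordinates of the finite chain of Lorenz maps: critical points, scaling ratios, critical
values and power series coefficients. -/
inductive Coord (I : Type*)
  | c (i : I) : Coord I
  | l (i : I) : Coord I
  | v (i : I) (σ : Bool) : Coord I
  | a (i : I) (σ : Bool) (j : ℕ) : Coord I

namespace Coord

variable {I : Type*}

/-- Lower corner of the parameter box. -/
noncomputable def lo (η : ℝ) : Coord I → ℝ
  | c _ => η
  | l _ => 0
  | v _ _ => 0
  | a _ _ j => -(1 / 20000 * (1 / 4) ^ (j + 2))

/-- Upper corner of the parameter box. -/
noncomputable def hi (η : ℝ) : Coord I → ℝ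
  | c _ => 1 - η
  | l _ => 1
  | v _ _ => 1
  | a _ _ j => 1 / 20000 * (1 / 4) ^ (j + 2)

/-- The critical point seen from the side `σ`. -/
def cen (x : Coord I → ℝ) (i : I) (σ : Bool) : ℝ := if σ then x (c i) else 1 - x (c i)

/-- The smallest admissible critical value parameter. -/
noncomputable def vmin (c : ℝ) : ℝ := max ((1 - c) / (1 - 9 / 10 * c)) (√(1 - c) / 4)

/-- The truncated critical value parameter. -/
noncomputable def vel (x : Coord I → ℝ) (i : I) (σ : Bool) : ℝ :=
  max (x (v i σ)) (vmin (cen x i σ))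

/-- The truncated scaling ratio. -/
noncomputable def len (lm : ℝ) (x : Coord I → ℝ) (i : I) : ℝ :=
  max lm (min (x (l i)) (1 / 1000000000 * (cen x i true * cen x i false)))

/-- The power series coefficients. -/
def coe (x : Coord I → ℝ) (i : I) (σ : Bool) (j : ℕ) : ℝ := x (a i σ j)

lemma cen_not (x : Coord I → ℝ) (i : I) (σ : Bool) : cen x i (!σ) = 1 - cen x i σ := by
  cases σ <;> simp [cen]

/-- Membership in the parameter box. -/
def InBox (η : ℝ) (x : Coord I → ℝ) : Prop := ∀ j, x j ∈ Icc (lo η j) (hi η j)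

section

variable {η : ℝ} {x : Coord I → ℝ}

lemma InBox.cen_mem (hx : InBox η x) (i : I) (σ : Bool) : cen x i σ ∈ Icc η (1 - η) := by
  have h : x (c i) ∈ Icc η (1 - η) := hx (c i)
  cases σ
  · simp only [cen]
    constructor <;> simp <;> linarith [h.1, h.2]
  · simpa [cen] using h

lemma InBox.small (hx : InBox η x) (i : I) (σ : Bool) : SmallCoeff (coe x i σ) := by
  intro j
  have h : x (a i σ j) ∈ Icc (-(1 / 20000 * (1 / 4 : ℝ) ^ (j + 2))) (1 / 20000 * (1 / 4) ^ (j + 2)) :=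
    hx (a i σ j)
  exact abs_le.2 h

lemma vmin_le_one {c : ℝ} (hc0 : 0 < c) (hc1 : c < 1) : vmin c ≤ 1 := by
  refine max_le ?_ ?_
  · rw [div_le_one (by linarith)]; linarith
  · have : √(1 - c) ≤ 1 := Real.sqrt_le_one.2 (by linarith)
    linarith

lemma le_mul_of_vmin_le {c v : ℝ} (hc1 : c < 1) (hv : vmin c ≤ v) :
    1 - c ≤ v * (1 - 9 / 10 * c) := by
  have := (le_max_left _ _).trans hv
  rwa [div_le_iff₀ (by linarith)] at this

lemma vmin_le_of_le_mul {c v : ℝ} (hc1 : c < 1) (h1 : 1 - c ≤ v * (1 - 9 / 10 * c))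
    (h2 : √(1 - c) / 4 ≤ v) : vmin c ≤ v :=
  max_le (by rwa [div_le_iff₀ (by linarith)]) h2

lemma vmin_pos {c : ℝ} (hc1 : c < 1) : 0 < vmin c :=
  lt_of_lt_of_le (div_pos (by linarith) (by linarith)) (le_max_left _ _)

lemma InBox.vel_mem (hη : 0 < η) (hx : InBox η x) (i : I) (σ : Bool) : vel x i σ ∈ Icc (0 : ℝ) 1 := by
  have hc := hx.cen_mem i σ
  have h : x (v i σ) ∈ Icc (0 : ℝ) 1 := hx (v i σ)
  exact ⟨h.1.trans (le_max_left _ _), max_le h.2 (vmin_le_one (by linarith [hc.1])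
    (by linarith [hc.2]))⟩

lemma InBox.branchData (hη : 0 < η) (hx : InBox η x) {s : ℝ} (hs : 0 < s) (hs2 : s < 1 / 2) (i : I)
    (σ : Bool) : BranchData s (cen x i σ) (vel x i σ) (coe x i σ) := by
  have hc := hx.cen_mem i σ
  have hc1 : cen x i σ < 1 := by linarith [hc.2]
  exact
    { s_pos := hs
      s_lt := hs2
      c_pos := by linarith [hc.1]
      c_lt := hc1
      v_pos := lt_of_lt_of_le (vmin_pos hc1) (le_max_right _ _)
      v_le := (hx.vel_mem hη i σ).2
      v_ge := le_mul_of_vmin_le hc1 (le_max_right _ _)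
      small := hx.small i σ }

lemma InBox.prod_ge (hx : InBox η x) (i : I) :
    η * (1 - η) ≤ cen x i true * cen x i false := by
  have h := hx.cen_mem i true
  have h2 : cen x i false = 1 - cen x i true := cen_not x i true
  rw [h2]
  nlinarith [h.1, h.2]

lemma prod_eq (x : Coord I → ℝ) (i : I) (σ : Bool) :
    cen x i true * cen x i false = cen x i (!σ) * (1 - cen x i (!σ)) := by
  cases σ
  · have : cen x i false = 1 - cen x i true := cen_not x i true
    rw [this]; rfl
  · have : cen x i true = 1 - cen x i false := cen_not x i false
    rw [this]; simp; ring

lemma InBox.pullData (hη : 0 < η) {lm : ℝ} (hlm : 0 < lm)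
    (hlm' : lm ≤ 1 / 1000000000 * (η * (1 - η))) (hx : InBox η x) {s : ℝ} (hs : 0 < s)
    (hs2 : s < 1 / 2) (nxt : I ≃ I) (i : I) (σ : Bool) :
    PullData s (cen x i (!σ)) (vel x i (!σ)) (coe x i (!σ)) (coe x i σ) (len lm x i)
      (cen x (nxt i) σ) where
  toBranchData := hx.branchData hη hs hs2 i (!σ)
  small' := hx.small i σ
  l_pos := lt_of_lt_of_le hlm (le_max_left _ _)
  l_le := by
    rw [← prod_eq x i σ]
    refine max_le (hlm'.trans ?_) (min_le_right _ _)
    have := hx.prod_ge i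
    linarith
  c'_nonneg := by linarith [(hx.cen_mem (nxt i) σ).1]
  c'_le := by linarith [(hx.cen_mem (nxt i) σ).2]

end

section Field

variable (s lm : ℝ) (nxt : I ≃ I) (ν : I → Bool → ℕ) (x : Coord I → ℝ)

/-- The renormalized critical value of the side `σ`. -/
noncomputable def vnew (i : I) (σ : Bool) : ℝ :=
  newV s (cen x i (!σ)) (vel x i (!σ)) (coe x i (!σ)) (coe x i σ) (len lm x i)
    (cen x (nxt i) σ) (ν i (!σ)) (vel x (nxt i) σ)

/-- The contribution of the side `σ` to the scaling ratio. -/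
noncomputable def scale (i : I) (σ : Bool) : ℝ :=
  branchScale s (cen x i (!σ)) (vel x i (!σ)) (coe x i (!σ)) (coe x i σ) (len lm x i)
    (cen x (nxt i) σ) (ν i (!σ)) (vel x (nxt i) σ)

/-- The defect of the renormalized diffeomorphism. -/
noncomputable def defect (i : I) (σ : Bool) : ℂ → ℂ :=
  pullDefect s (cen x i (!σ)) (vel x i (!σ)) (coe x i (!σ)) (coe x i σ) (len lm x i)
    (cen x (nxt i) σ) (ν i (!σ))

/-- The vector field whose zeros are the periodic points of renormalization. -/
noncomputable def field : Coord I → ℝ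
  | c i => cen x (nxt i) false * scale s lm nxt ν x i false
      - cen x (nxt i) true * scale s lm nxt ν x i true
  | l i => scale s lm nxt ν x i false + scale s lm nxt ν x i true - x (l i) ^ (1 - s)
  | v i σ => vnew s lm nxt ν x i σ - x (v i σ)
  | a i σ j => (taylorCoeff (defect s lm nxt ν x (nxt.symm i) σ) (j + 2)).re - x (a i σ j)

end Field

section Continuity

variable {η s lm : ℝ} {nxt : I ≃ I} {ν : I → Bool → ℕ}

lemma continuous_cen (i : I) (σ : Bool) : Continuous fun x : Coord I → ℝ => cen x i σ := by
  cases σ <;> simp only [cen] <;> simp <;> fun_prop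

lemma continuous_vel (hη : 0 < η) (i : I) (σ : Bool) :
    Continuous fun x : {x : Coord I → ℝ // InBox η x} => vel x.1 i σ := by
  have h := (continuous_cen i σ).comp (continuous_subtype_val (p := InBox (I := I) η))
  have h1 : Continuous fun x : {x : Coord I → ℝ // InBox η x} => 1 - cen x.1 i σ :=
    continuous_const.sub h
  have h2 : Continuous fun x : {x : Coord I → ℝ // InBox η x} => 1 - 9 / 10 * cen x.1 i σ :=
    continuous_const.sub (continuous_const.mul h)
  have h3 : Continuous fun x : {x : Coord I → ℝ // InBox η x} => x.1 (v i σ) :=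
    (continuous_apply _).comp continuous_subtype_val
  unfold vel vmin
  refine h3.max ((h1.div h2 fun x => ?_).max (h1.sqrt.div_const 4))
  have := (x.2.cen_mem i σ).2
  linarith

lemma continuous_len (i : I) : Continuous fun x : Coord I → ℝ => len lm x i := by
  have h1 := continuous_cen i true
  have h0 := continuous_cen i false
  unfold len
  fun_prop

lemma continuous_coe (i : I) (σ : Bool) : Continuous fun x : Coord I → ℝ => coe x i σ := by
  unfold coe
  fun_prop


end Continuity

/-- The compatibility conditions between the constants of the construction. -/
structure Consts (η s lm : ℝ) (M : ℕ) (ν : I → Bool → ℕ) : Prop where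
  eta_pos : 0 < η
  eta_le : η ≤ 1 / 100
  s_pos : 0 < s
  s_lt : s < 1 / 2
  lm_pos : 0 < lm
  lm_le : lm ≤ 1 / 1000000000 * (η * (1 - η))
  lm_rpow : lm ^ (1 - s) ≤ (√η / 4 * (4 / 10 * (9 / 10 * s * η) ^ M)) ^ s * η
  eta_small : 256 * 48 ^ s * √η ^ s ≤ (1 / 10 * (9 / 20 * s) ^ M) ^ s
  ge_sixty : ∀ i σ, 60 ≤ ν i σ
  le_bound : ∀ i σ, ν i σ ≤ M
  mul_ge : ∀ i σ, 2 * (1 - s) ≤ ν i σ * s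
  mul_ge' : ∀ i σ, 2 * (2 + s) ≤ ν i σ * s
  contr : ∀ i σ, 2 * ((3 * (3 / 4) ^ ν i σ) ^ s * 16 ^ (1 - s)) ≤ (1 / 1000000000 : ℝ) ^ (1 - s)

namespace Consts

variable {η s lm : ℝ} {M : ℕ} {ν : I → Bool → ℕ} {x : Coord I → ℝ}

lemma pullData (h : Consts η s lm M ν) (nxt : I ≃ I) (hx : InBox η x) (i : I) (σ : Bool) :
    PullData s (cen x i (!σ)) (vel x i (!σ)) (coe x i (!σ)) (coe x i σ) (len lm x i)
    (cen x (nxt i) σ) :=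
  hx.pullData h.eta_pos h.lm_pos h.lm_le h.s_pos h.s_lt nxt i σ

lemma sqrt_le_vel (i : I) (σ : Bool) : √(1 - cen x i σ) / 4 ≤ vel x i σ :=
  (le_max_right _ _).trans (le_max_right _ _)

lemma sqrt_eta_le_vel (hx : InBox η x) (i : I) (σ : Bool) : √η / 4 ≤ vel x i σ := by
  refine le_trans ?_ (sqrt_le_vel i σ)
  have h1 := Real.sqrt_le_sqrt (show η ≤ 1 - cen x i σ by linarith [(hx.cen_mem i σ).2])
  linarith

lemma vnew_mem (h : Consts η s lm M ν) (nxt : I ≃ I) (hx : InBox η x) (i : I) (σ : Bool) :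
    vnew s lm nxt ν x i σ ∈ Icc (0 : ℝ) 1 :=
  ⟨((h.pullData nxt hx i σ).newV_pos (hx.vel_mem h.eta_pos (nxt i) σ) _).le,
    ((h.pullData nxt hx i σ).newV_bounds (hx.vel_mem h.eta_pos (nxt i) σ) _).2⟩

lemma vmin_le_vnew (h : Consts η s lm M ν) (nxt : I ≃ I) (hx : InBox η x) (i : I) (σ : Bool) :
    vmin (cen x i σ) ≤ vnew s lm nxt ν x i σ := by
  have hp := h.pullData nxt hx i σ
  have hv := hx.vel_mem h.eta_pos (nxt i) σ
  have h60 := h.ge_sixty i (!σ)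
  have h1 := hp.le_newV_mul hv h60
  have h2 := hp.newV_ge_sqrt hv (n := ν i (!σ)) (by omega)
  rw [cen_not] at h1 h2
  apply vmin_le_of_le_mul (by linarith [(hx.cen_mem i σ).2, h.eta_pos])
  · unfold vnew
    rw [cen_not]
    convert h1 using 2
    ring
  · unfold vnew
    rw [cen_not]
    have := Real.sqrt_nonneg (1 - cen x i σ)
    linarith

lemma scale_nonneg (h : Consts η s lm M ν) (nxt : I ≃ I) (hx : InBox η x) (i : I) (σ : Bool) :
    0 ≤ scale s lm nxt ν x i σ :=
  (h.pullData nxt hx i σ).branchScale_nonneg (hx.vel_mem h.eta_pos (nxt i) σ) _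

lemma scale_le (h : Consts η s lm M ν) (nxt : I ≃ I) (hx : InBox η x) (i : I) (σ : Bool) :
    2 * scale s lm nxt ν x i σ
    ≤ (1 / 1000000000 * (cen x i true * cen x i false)) ^ (1 - s) := by
  rw [prod_eq x i σ]
  exact (h.pullData nxt hx i σ).branchScale_le (hx.vel_mem h.eta_pos (nxt i) σ)
    (sqrt_le_vel i (!σ)) (h.mul_ge i (!σ)) (h.contr i (!σ))

lemma scale_ge (h : Consts η s lm M ν) (nxt : I ≃ I) (hx : InBox η x) (i : I) (σ : Bool) :
    lm ^ (1 - s) ≤ scale s lm nxt ν x i σ := by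
  have hp := h.pullData nxt hx i σ
  have hs := h.s_pos
  have hη := h.eta_pos
  have hc := hx.cen_mem i (!σ)
  refine h.lm_rpow.trans (le_trans ?_ (hp.branchScale_ge (hx.vel_mem h.eta_pos (nxt i) σ)
    (w := √η / 4) (by positivity) (sqrt_eta_le_vel hx (nxt i) σ) _))
  have h1 : (9 / 10 * s * η) ^ M ≤ (9 / 10 * s * (1 - cen x i (!σ))) ^ ν i (!σ) := by
    calc _ ≤ (9 / 10 * s * η) ^ ν i (!σ) :=
          pow_le_pow_of_le_one (by positivity) (by nlinarith [h.s_lt, h.eta_le]) (h.le_bound _ _)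
      _ ≤ _ := by
          gcongr
          linarith [hc.2]
  have h2 : 0 ≤ 1 - cen x i (!σ) := by linarith [hc.2]
  gcongr
  exact hc.1

lemma face_c (h : Consts η s lm M ν) (nxt : I ≃ I) (hx : InBox η x) (i : I) (σ : Bool)
    (hc : cen x i σ = η) : cen x (nxt i) σ * scale s lm nxt ν x i σ
    ≤ cen x (nxt i) (!σ) * scale s lm nxt ν x i (!σ) := by
  have hs := h.s_pos
  have hη := h.eta_pos
  have hηle := h.eta_le
  have h1 : scale s lm nxt ν x i σ ≤ 3 ^ s * (16 * η) ^ (2 + s) := by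
    have := (h.pullData nxt hx i σ).branchScale_le_of_near_one (hx.vel_mem h.eta_pos (nxt i) σ)
      (sqrt_le_vel i (!σ)) (h.mul_ge' i (!σ))
    rw [show 1 - cen x i (!σ) = η by rw [cen_not, hc]; ring] at this
    exact this
  have h2 : (√η / 4 * (4 / 10 * (9 / 20 * s) ^ M)) ^ s * η ≤ scale s lm nxt ν x i (!σ) := by
    have := (h.pullData nxt hx i (!σ)).branchScale_ge (hx.vel_mem h.eta_pos (nxt i) (!σ))
      (w := √η / 4) (by positivity) (sqrt_eta_le_vel hx (nxt i) (!σ)) (ν i (!!σ))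
    refine le_trans ?_ this
    rw [Bool.not_not, hc]
    have h3 : (9 / 20 * s) ^ M ≤ (9 / 10 * s * (1 - η)) ^ ν i σ := by
      calc _ ≤ (9 / 20 * s) ^ ν i σ :=
            pow_le_pow_of_le_one (by positivity) (by nlinarith [h.s_lt]) (h.le_bound _ _)
        _ ≤ _ := by
            gcongr (?_ : ℝ) ^ _
            nlinarith
    have h4 : 0 ≤ 1 - η := by linarith
    gcongr
  have h3 : 3 ^ s * (16 * η) ^ (2 + s) ≤ η * ((√η / 4 * (4 / 10 * (9 / 20 * s) ^ M)) ^ s * η) := by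
    have h4 : (16 * η) ^ (2 + s) = 256 * η ^ 2 * (16 ^ s * (√η ^ s * √η ^ s)) := by
      rw [Real.rpow_add (by positivity), ← Real.mul_rpow (Real.sqrt_nonneg _) (Real.sqrt_nonneg _),
        Real.mul_self_sqrt hη.le, ← Real.mul_rpow (by norm_num) hη.le,
        show (2 : ℝ) = ((2 : ℕ) : ℝ) by norm_num, Real.rpow_natCast]
      norm_num
      left
      ring
    have h5 : (48 : ℝ) ^ s = 3 ^ s * 16 ^ s := by
      rw [← Real.mul_rpow (by norm_num) (by norm_num)]; norm_num
    have h6 : (√η / 4 * (4 / 10 * (9 / 20 * s) ^ M)) ^ s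
        = √η ^ s * (1 / 10 * (9 / 20 * s) ^ M) ^ s := by
      rw [← Real.mul_rpow (Real.sqrt_nonneg _) (by positivity)]
      congr 1
      ring
    have h7 := h.eta_small
    rw [h4, h6]
    rw [h5] at h7
    calc _ = η ^ 2 * √η ^ s * (256 * (3 ^ s * 16 ^ s) * √η ^ s) := by ring
      _ ≤ η ^ 2 * √η ^ s * (1 / 10 * (9 / 20 * s) ^ M) ^ s := by gcongr
      _ = _ := by ring
  have h4 := hx.cen_mem (nxt i) σ
  have h5 := hx.cen_mem (nxt i) (!σ)
  have h6 := h.scale_nonneg nxt hx i σ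
  have h7 := h.scale_nonneg nxt hx i (!σ)
  calc cen x (nxt i) σ * scale s lm nxt ν x i σ ≤ 1 * scale s lm nxt ν x i σ := by
        gcongr
        linarith [h4.2]
    _ ≤ η * scale s lm nxt ν x i (!σ) := by
        rw [one_mul]
        exact h1.trans (h3.trans (by gcongr))
    _ ≤ _ := by
        gcongr
        exact h5.1

lemma abs_taylorCoeff_le (h : Consts η s lm M ν) (nxt : I ≃ I) (hx : InBox η x) (i : I) (σ : Bool) (j : ℕ) :
    |(taylorCoeff (defect s lm nxt ν x i σ) j).re| ≤ 1 / 20000 * (1 / 4) ^ j :=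
  (Complex.abs_re_le_norm _).trans (norm_taylorCoeff_le
    (fun _ hz => (h.pullData nxt hx i σ).norm_normalized_pull_sub_le hz _) j)

lemma continuous_field (h : Consts η s lm M ν) (nxt : I ≃ I) (j : Coord I) :
    Continuous fun x : {x : Coord I → ℝ // InBox η x} => field s lm nxt ν x.1 j := by
  have hcen : ∀ i σ, Continuous fun x : {x : Coord I → ℝ // InBox η x} => cen x.1 i σ :=
    fun i σ => (continuous_cen i σ).comp continuous_subtype_val
  have hlen : ∀ i, Continuous fun x : {x : Coord I → ℝ // InBox η x} => len lm x.1 i :=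
    fun i => (continuous_len i).comp continuous_subtype_val
  have hcoe : ∀ i σ, Continuous fun x : {x : Coord I → ℝ // InBox η x} => coe x.1 i σ :=
    fun i σ => (continuous_coe i σ).comp continuous_subtype_val
  have hvel : ∀ i σ, Continuous fun x : {x : Coord I → ℝ // InBox η x} => vel x.1 i σ :=
    continuous_vel h.eta_pos
  have happ : ∀ j, Continuous fun x : {x : Coord I → ℝ // InBox η x} => x.1 j :=
    fun j => (continuous_apply j).comp continuous_subtype_val
  have hpull : ∀ i σ {y : ℝ}, y ∈ Icc (0 : ℝ) 1 →
      Continuous fun x : {x : Coord I → ℝ // InBox η x} =>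
        pullR s (cen x.1 i (!σ)) (vel x.1 i (!σ)) (coe x.1 i (!σ)) (coe x.1 i σ) (len lm x.1 i)
          (cen x.1 (nxt i) σ) (ν i (!σ)) y := fun i σ y hy =>
    (hcen i (!σ)).pullR_comp (hvel i (!σ)) (hlen i) (hcen (nxt i) σ) (hcoe i (!σ)) (hcoe i σ) hy
      (fun x => h.pullData nxt x.2 i σ) _
  have hvnew : ∀ i σ, Continuous fun x : {x : Coord I → ℝ // InBox η x} =>
      vnew s lm nxt ν x.1 i σ := fun i σ => by
    have h1 := hpull i σ (y := 1) (by simp)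
    have h0 := hpull i σ (y := 0) (by simp)
    have hv := hvel (nxt i) σ
    unfold vnew newV
    exact continuous_const.sub (((continuous_const.sub hv).mul h1).add (hv.mul h0))
  have hscale : ∀ i σ, Continuous fun x : {x : Coord I → ℝ // InBox η x} =>
      scale s lm nxt ν x.1 i σ := fun i σ => by
    have h1 := hpull i σ (y := 1) (by simp)
    have h0 := hpull i σ (y := 0) (by simp)
    have hv := hvel (nxt i) σ
    unfold scale branchScale
    refine Continuous.mul (Continuous.rpow_const ?_ fun _ => Or.inr h.s_pos.le) (hcen i (!σ))
    exact (hv.mul ((h1.sub h0).div (hlen i) fun x => (h.pullData nxt x.2 i σ).l_pos.ne')).div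
      (hvnew i σ) fun x => ((h.pullData nxt x.2 i σ).newV_pos
        (x.2.vel_mem h.eta_pos (nxt i) σ) _).ne'
  cases j with
  | c i => exact ((hcen _ _).mul (hscale _ _)).sub ((hcen _ _).mul (hscale _ _))
  | l i =>
    exact ((hscale _ _).add (hscale _ _)).sub
      ((happ _).rpow_const fun _ => Or.inr (by linarith [h.s_lt]))
  | v i σ => exact (hvnew _ _).sub (happ _)
  | a i σ j =>
    refine (Complex.continuous_re.comp ?_).sub (happ _)
    exact (hcen _ _).taylorCoeff_pullDefect (hvel _ _) (hlen _) (hcen _ _) (hcoe _ _) (hcoe _ _)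
      (fun x => h.pullData nxt x.2 _ σ) _ _

lemma exists_zero (h : Consts η s lm M ν) (nxt : I ≃ I) :
    ∃ x : Coord I → ℝ, InBox η x ∧ ∀ j, field s lm nxt ν x j = 0 := by
  have hη := h.eta_pos
  have hηle := h.eta_le
  refine exists_zero_of_box (lo := lo η) (hi := hi η) ?_ (fun j => ?_) ?_ ?_
  · intro j
    cases j with
    | c i => simp only [lo, hi]; linarith
    | l i => simp only [lo, hi]; norm_num
    | v i σ => simp only [lo, hi]; norm_num
    | a i σ j =>
      have : (0 : ℝ) < (1 / 4) ^ (j + 2) := by positivity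
      simp only [lo, hi]
      linarith
  · rw [continuousOn_iff_continuous_domRestrict]
    exact h.continuous_field nxt j
  · intro x hx j hj
    replace hx : InBox η x := hx
    cases j with
    | c i =>
      have h1 := h.face_c nxt hx i true (by simpa [cen, lo] using hj)
      simp only [field]
      rw [Bool.not_true] at h1
      linarith
    | l i =>
      have h0 := h.scale_nonneg nxt hx i false
      have h1 := h.scale_nonneg nxt hx i true
      simp only [field, hj, lo]
      rw [Real.zero_rpow (by linarith [h.s_lt])]
      linarith
    | v i σ =>
      have := (h.vnew_mem nxt hx i σ).1
      simp only [field, hj, lo]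
      linarith
    | a i σ j =>
      have := (abs_le.1 (h.abs_taylorCoeff_le nxt hx (nxt.symm i) σ (j + 2))).1
      simp only [field, hj, lo]
      linarith
  · intro x hx j hj
    replace hx : InBox η x := hx
    cases j with
    | c i =>
      have h1 := h.face_c nxt hx i false (by simp [cen, hj, hi])
      simp only [field]
      rw [Bool.not_false] at h1
      linarith
    | l i =>
      have h0 := h.scale_le nxt hx i false
      have h1 := h.scale_le nxt hx i true
      have h2 : (1 / 1000000000 * (cen x i true * cen x i false)) ^ (1 - s) ≤ 1 := by
        have hc := hx.cen_mem i true
        have hc' := hx.cen_mem i false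
        refine Real.rpow_le_one ?_ ?_ (by linarith [h.s_lt])
        · have := mul_nonneg (hη.le.trans hc.1) (hη.le.trans hc'.1)
          linarith
        · nlinarith [hc.1, hc.2, hc'.1, hc'.2]
      simp only [field, hj, hi]
      rw [Real.one_rpow]
      linarith
    | v i σ =>
      have := (h.vnew_mem nxt hx i σ).2
      simp only [field, hj, hi]
      linarith
    | a i σ j =>
      have := (abs_le.1 (h.abs_taylorCoeff_le nxt hx (nxt.symm i) σ (j + 2))).2
      simp only [field, hj, hi]
      linarith

end Consts

end Coord

end RenormalizationSystem

section Chain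

/-- The relations between a branch of a Lorenz map and the corresponding branch of its
renormalization: `c, v, a` describe the opposite branch, `α, w` the branch itself and
`c', v', α'` the renormalized branch. -/
structure SideStep (s c v : ℝ) (a α : ℕ → ℝ) (l c' : ℝ) (n : ℕ) (w v' : ℝ) (α' : ℕ → ℝ) : Prop
    extends PullData s c v a α l c' where
  n_ge : 60 ≤ n
  conj : ∀ z ∈ Icc (0 : ℝ) 1, betaR α' z * (pullR s c v a α l c' n 1 - pullR s c v a α l c' n 0)
    = pullR s c v a α l c' n z - pullR s c v a α l c' n 0
  value : w = newV s c v a α l c' n v'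
  scaling : (v' * (pullR s c v a α l c' n 1 - pullR s c v a α l c' n 0) / w) ^ s * c = (1 - c') * l

lemma PullData.betaR_taylorCoeff_pullDefect {s c v : ℝ} {a α : ℕ → ℝ} {l c' : ℝ}
    (h : PullData s c v a α l c') (n : ℕ) {z : ℝ} (hz : z ∈ Icc (0 : ℝ) 1) :
    betaR (fun j => (taylorCoeff (pullDefect s c v a α l c' n) (j + 2)).re) z
      * (pullR s c v a α l c' n 1 - pullR s c v a α l c' n 0)
      = pullR s c v a α l c' n z - pullR s c v a α l c' n 0 := by
  have hgap := h.pull_gap_ne_zero n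
  have h1 : pullC s c v a α l c' n 1 = pullR s c v a α l c' n 1 := by
    simpa using h.pull_ofReal (x := 1) (by norm_num) n
  have h0 : pullC s c v a α l c' n 0 = pullR s c v a α l c' n 0 := by
    simpa using h.pull_ofReal (x := 0) (by norm_num) n
  have hgapR : pullR s c v a α l c' n 1 - pullR s c v a α l c' n 0 ≠ 0 := by
    rw [h1, h0] at hgap
    exact_mod_cast hgap
  have key : betaR (fun j => (taylorCoeff (pullDefect s c v a α l c' n) (j + 2)).re) z
      = z + ((pullR s c v a α l c' n z - pullR s c v a α l c' n 0)
        / (pullR s c v a α l c' n 1 - pullR s c v a α l c' n 0) - z) := by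
    refine betaR_taylorCoeff (fun w hw => ?_) ?_ ?_ hz ?_
    · unfold pullDefect
      exact (((h.differentiableAt_pull hw n).sub_const _).div_const _).sub differentiableAt_id
    · simp [pullDefect]
    · simp [pullDefect, div_self hgap]
    · rw [pullDefect, h1, h0, h.pull_ofReal (PullData.abs_le_five hz)]
      push_cast
      rfl
  rw [key]
  field_simp
  ring

namespace Coord

variable {I : Type*} {η s lm : ℝ} {M : ℕ} {ν : I → Bool → ℕ} {x : Coord I → ℝ}

lemma Consts.vel_eq (h : Consts η s lm M ν) (nxt : I ≃ I) (hx : InBox η x)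
    (h0 : ∀ j, field s lm nxt ν x j = 0) (i : I) (σ : Bool) :
    vel x i σ = vnew s lm nxt ν x i σ := by
  have h1 : vnew s lm nxt ν x i σ - x (v i σ) = 0 := h0 (v i σ)
  have h2 := h.vmin_le_vnew nxt hx i σ
  rw [vel, max_eq_left (by linarith)]
  linarith

lemma Consts.len_rpow (h : Consts η s lm M ν) (nxt : I ≃ I) (hx : InBox η x)
    (h0 : ∀ j, field s lm nxt ν x j = 0) (i : I) :
    len lm x i ^ (1 - s) = scale s lm nxt ν x i false + scale s lm nxt ν x i true := by
  have h1 : scale s lm nxt ν x i false + scale s lm nxt ν x i true - x (l i) ^ (1 - s) = 0 :=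
    h0 (l i)
  have hl : x (l i) ∈ Icc (0 : ℝ) 1 := hx (l i)
  have hs : 0 < 1 - s := by linarith [h.s_lt]
  have hprod : 0 ≤ 1 / 1000000000 * (cen x i true * cen x i false) := by
    have := mul_nonneg (h.eta_pos.le.trans (hx.cen_mem i true).1)
      (h.eta_pos.le.trans (hx.cen_mem i false).1)
    linarith
  have h2 : x (l i) ≤ 1 / 1000000000 * (cen x i true * cen x i false) := by
    rw [← Real.rpow_le_rpow_iff hl.1 hprod hs]
    linarith [h.scale_le nxt hx i false, h.scale_le nxt hx i true]
  have h3 : lm ≤ x (l i) := by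
    rw [← Real.rpow_le_rpow_iff h.lm_pos.le hl.1 hs]
    linarith [h.scale_ge nxt hx i false, h.scale_nonneg nxt hx i true]
  rw [len, min_eq_left h2, max_eq_right h3]
  linarith

lemma Consts.scale_eq (h : Consts η s lm M ν) (nxt : I ≃ I) (hx : InBox η x)
    (h0 : ∀ j, field s lm nxt ν x j = 0) (i : I) (σ : Bool) :
    scale s lm nxt ν x i σ = (1 - cen x (nxt i) σ) * len lm x i ^ (1 - s) := by
  have h1 : cen x (nxt i) false * scale s lm nxt ν x i false
      - cen x (nxt i) true * scale s lm nxt ν x i true = 0 := h0 (c i)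
  have h2 := h.len_rpow nxt hx h0 i
  have h3 : cen x (nxt i) false = 1 - cen x (nxt i) true := cen_not x (nxt i) true
  rw [h2]
  cases σ
  · rw [h3] at h1 ⊢
    linear_combination h1
  · rw [h3] at h1
    linear_combination -h1

lemma Consts.sideStep (h : Consts η s lm M ν) (nxt : I ≃ I) (hx : InBox η x)
    (h0 : ∀ j, field s lm nxt ν x j = 0) (i : I) (σ : Bool) :
    SideStep s (cen x i (!σ)) (vel x i (!σ)) (coe x i (!σ)) (coe x i σ) (len lm x i)
      (cen x (nxt i) σ) (ν i (!σ)) (vel x i σ) (vel x (nxt i) σ) (coe x (nxt i) σ) := by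
  have hp := h.pullData nxt hx i σ
  have hv := hx.vel_mem h.eta_pos (nxt i) σ
  refine ⟨hp, h.ge_sixty _ _, fun z hz => ?_, h.vel_eq nxt hx h0 i σ, ?_⟩
  · have h1 : coe x (nxt i) σ = fun j => (taylorCoeff (defect s lm nxt ν x i σ) (j + 2)).re := by
      ext j
      have h2 : (taylorCoeff (defect s lm nxt ν x (nxt.symm (nxt i)) σ) (j + 2)).re
        - x (a (nxt i) σ j) = 0 := h0 (a (nxt i) σ j)
      rw [Equiv.symm_apply_apply] at h2
      unfold coe
      linarith
    rw [h1]
    exact hp.betaR_taylorCoeff_pullDefect _ hz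
  · have h1 := h.scale_eq nxt hx h0 i σ
    rw [h.vel_eq nxt hx h0 i σ]
    have hl := hp.l_pos
    have h2 := hp.scale_base_nonneg hv (ν i (!σ))
    unfold scale branchScale at h1
    rw [Real.rpow_sub hl, Real.rpow_one] at h1
    have h3 : 0 < len lm x i ^ s := Real.rpow_pos_of_pos hl s
    unfold vnew
    set g := pullR s (cen x i !σ) (vel x i !σ) (coe x i !σ) (coe x i σ) (len lm x i)
      (cen x (nxt i) σ) (ν i !σ) 1 - pullR s (cen x i !σ) (vel x i !σ) (coe x i !σ) (coe x i σ)
        (len lm x i) (cen x (nxt i) σ) (ν i !σ) 0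
    set w := newV s (cen x i !σ) (vel x i !σ) (coe x i !σ) (coe x i σ) (len lm x i)
      (cen x (nxt i) σ) (ν i !σ) (vel x (nxt i) σ)
    rw [show vel x (nxt i) σ * g / w = vel x (nxt i) σ * (g / len lm x i) / w * len lm x i by
      field_simp, Real.mul_rpow h2 hl.le, mul_right_comm, h1]
    field_simp

end Coord

lemma exists_consts {I : Type*} [Finite I] {s : ℝ} (hs : 0 < s) (hs2 : s < 1 / 2)
    {ν : I → Bool → ℕ} (h60 : ∀ i σ, 60 ≤ ν i σ)
    (hν : ∀ i σ, 2 * (1 - s) ≤ ν i σ * s ∧ 2 * (2 + s) ≤ ν i σ * s ∧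
      2 * ((3 * (3 / 4) ^ ν i σ) ^ s * 16 ^ (1 - s)) ≤ (1 / 1000000000 : ℝ) ^ (1 - s)) :
    ∃ (η lm : ℝ) (M : ℕ), Coord.Consts η s lm M ν := by
  obtain ⟨M, hM⟩ := (Set.finite_range fun p : I × Bool => ν p.1 p.2).bddAbove
  obtain ⟨η, hη, hη1, hη2⟩ := exists_eta hs M
  set T : ℝ := (√η / 4 * (4 / 10 * (9 / 10 * s * η) ^ M)) ^ s * η with hT
  have hTpos : 0 < T := by
    have : 0 < √η := Real.sqrt_pos.2 hη
    positivity
  have h1s : 0 < 1 - s := by linarith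
  have hB : 0 < 1 / 1000000000 * (η * (1 - η)) := by
    have : 0 < 1 - η := by linarith
    positivity
  refine ⟨η, min (1 / 1000000000 * (η * (1 - η))) (T ^ (1 - s)⁻¹), M, ?_⟩
  have hlm : 0 < min (1 / 1000000000 * (η * (1 - η))) (T ^ (1 - s)⁻¹) :=
    lt_min hB (Real.rpow_pos_of_pos hTpos _)
  exact
    { eta_pos := hη
      eta_le := hη1
      s_pos := hs
      s_lt := hs2
      lm_pos := hlm
      lm_le := min_le_left _ _
      lm_rpow := by
        refine (Real.rpow_le_rpow hlm.le (min_le_right _ _) h1s.le).trans ?_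
        rw [← Real.rpow_mul hTpos.le, inv_mul_cancel₀ h1s.ne', Real.rpow_one]
      eta_small := hη2
      ge_sixty := h60
      le_bound := fun i σ => hM ⟨(i, σ), rfl⟩
      mul_ge := fun i σ => (hν i σ).1
      mul_ge' := fun i σ => (hν i σ).2.1
      contr := fun i σ => (hν i σ).2.2 }

/-- A periodic chain of Lorenz maps related by renormalization. -/
theorem exists_chain {I : Type*} [Finite I] {s : ℝ} (hs : 0 < s) (hs2 : s < 1 / 2) (nxt : I ≃ I)
    {ν : I → Bool → ℕ} (h60 : ∀ i σ, 60 ≤ ν i σ)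
    (hν : ∀ i σ, 2 * (1 - s) ≤ ν i σ * s ∧ 2 * (2 + s) ≤ ν i σ * s ∧
      2 * ((3 * (3 / 4) ^ ν i σ) ^ s * 16 ^ (1 - s)) ≤ (1 / 1000000000 : ℝ) ^ (1 - s)) :
    ∃ (C V : I → Bool → ℝ) (A : I → Bool → ℕ → ℝ) (l : I → ℝ),
      (∀ i σ, C i (!σ) = 1 - C i σ) ∧ (∀ i σ, BranchData s (C i σ) (V i σ) (A i σ)) ∧
      ∀ i σ, SideStep s (C i (!σ)) (V i (!σ)) (A i (!σ)) (A i σ) (l i) (C (nxt i) σ) (ν i (!σ))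
        (V i σ) (V (nxt i) σ) (A (nxt i) σ) := by
  obtain ⟨η, lm, M, h⟩ := exists_consts hs hs2 h60 hν
  obtain ⟨x, hx, h0⟩ := h.exists_zero nxt
  exact ⟨Coord.cen x, Coord.vel x, Coord.coe x, Coord.len lm x, Coord.cen_not x,
    hx.branchData h.eta_pos hs hs2, h.sideStep nxt hx h0⟩

end Chain

section InverseDiffeo

/-- The real derivatives of `betaR`. -/
noncomputable def betaD1 (a : ℕ → ℝ) (x : ℝ) : ℝ := (deriv (betaC a) x).re

/-- The second derivative of `betaR`. -/
noncomputable def betaD2 (a : ℕ → ℝ) (x : ℝ) : ℝ := (deriv (deriv (betaC a)) x).re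

/-- The third derivative of `betaR`. -/
noncomputable def betaD3 (a : ℕ → ℝ) (x : ℝ) : ℝ := (deriv (deriv (deriv (betaC a))) x).re

variable {a : ℕ → ℝ}

lemma betaR_eq_re (a : ℕ → ℝ) : betaR a = fun x : ℝ => (betaC a x).re := by
  ext x
  rw [betaC_ofReal, Complex.ofReal_re]

lemma norm_ofReal_lt {x r : ℝ} (hx : |x| < r) : ‖(x : ℂ)‖ < r := by
  rwa [Complex.norm_real, Real.norm_eq_abs]

lemma hasDerivAt_betaR (ha : SmallCoeff a) {x : ℝ} (hx : |x| < 2) :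
    HasDerivAt (betaR a) (betaD1 a x) x := by
  rw [betaR_eq_re]
  exact (differentiableAt_betaC ha
    ((norm_ofReal_lt hx).trans (by norm_num))).hasDerivAt.real_of_complex

lemma hasDerivAt_betaD1 (ha : SmallCoeff a) {x : ℝ} (hx : |x| < 2) :
    HasDerivAt (betaD1 a) (betaD2 a x) x :=
  (differentiableAt_deriv_betaC ha
    ((norm_ofReal_lt hx).trans (by norm_num))).hasDerivAt.real_of_complex

lemma hasDerivAt_betaD2 (ha : SmallCoeff a) {x : ℝ} (hx : |x| < 2) :
    HasDerivAt (betaD2 a) (betaD3 a x) x :=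
  (differentiableAt_deriv_deriv_betaC ha
    ((norm_ofReal_lt hx).trans (by norm_num))).hasDerivAt.real_of_complex

lemma abs_betaD1_sub_one_le (ha : SmallCoeff a) {x : ℝ} (hx : |x| < 2) :
    |betaD1 a x - 1| ≤ 1 / 1000 := by
  have h := (Complex.abs_re_le_norm _).trans (norm_deriv_betaC_sub_one_le ha (norm_ofReal_lt hx))
  simpa [betaD1] using h

lemma abs_betaD2_le (ha : SmallCoeff a) {x : ℝ} (hx : |x| < 2) : |betaD2 a x| ≤ 1 / 1000 :=
  (Complex.abs_re_le_norm _).trans (norm_deriv_deriv_betaC_le ha (norm_ofReal_lt hx))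

lemma abs_betaD3_le (ha : SmallCoeff a) {x : ℝ} (hx : |x| < 2) : |betaD3 a x| ≤ 1 / 1000 :=
  (Complex.abs_re_le_norm _).trans (norm_deriv_deriv_deriv_betaC_le ha (norm_ofReal_lt hx))

lemma betaD1_pos (ha : SmallCoeff a) {x : ℝ} (hx : |x| < 2) : 0 < betaD1 a x := by
  linarith [(abs_le.1 (abs_betaD1_sub_one_le ha hx)).1]

lemma contDiffAt_betaR (ha : SmallCoeff a) {x : ℝ} (hx : |x| < 2) (n : WithTop ℕ∞) :
    ContDiffAt ℝ n (betaR a) x := by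
  rw [betaR_eq_re]
  refine ((contDiffOn_betaC ha n).contDiffAt (Metric.isOpen_ball.mem_nhds ?_)).real_of_complex
  rw [mem_ball_zero_iff]
  exact (norm_ofReal_lt hx).trans (by norm_num)

lemma abs_lt_two_of_mem {x : ℝ} (hx : x ∈ Ioo (-(3 / 2) : ℝ) (3 / 2)) : |x| < 2 :=
  abs_lt.2 ⟨by linarith [hx.1], by linarith [hx.2]⟩

lemma strictMonoOn_betaR (ha : SmallCoeff a) : StrictMonoOn (betaR a) (Ioo (-(3 / 2)) (3 / 2)) := by
  intro x hx y hy hxy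
  have := betaR_sub_ge ha (abs_lt_two_of_mem hy) (abs_lt_two_of_mem hx) hxy.le
  linarith

/-- The inverse diffeomorphism of `betaR`. -/
noncomputable def betaInv (a : ℕ → ℝ) : ℝ → ℝ :=
  Function.invFunOn (betaR a) (Ioo (-(3 / 2)) (3 / 2))

lemma betaInv_betaR (ha : SmallCoeff a) {x : ℝ} (hx : x ∈ Ioo (-(3 / 2) : ℝ) (3 / 2)) :
    betaInv a (betaR a x) = x :=
  (strictMonoOn_betaR ha).injOn.leftInvOn_invFunOn hx

lemma exists_betaR_eq (ha : SmallCoeff a) {y : ℝ} (hy : y ∈ Ioo (-(14 / 10) : ℝ) (14 / 10)) :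
    ∃ x ∈ Ioo (-(3 / 2) : ℝ) (3 / 2), betaR a x = y := by
  have hb : ∀ x : ℝ, |x| < 2 → |betaR a x - x| ≤ 1 / 8000 := fun x hx => by
    have h := norm_betaC_sub_le ha (z := x) ((norm_ofReal_lt hx).le.trans (by norm_num))
    rw [betaC_ofReal, ← Complex.ofReal_sub, Complex.norm_real, Real.norm_eq_abs] at h
    exact h
  have h1 := abs_le.1 (hb (-(145 / 100)) (by norm_num [abs_lt]))
  have h2 := abs_le.1 (hb (145 / 100) (by norm_num [abs_lt]))
  have hc : ContinuousOn (betaR a) (Icc (-(145 / 100)) (145 / 100)) := fun x hx =>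
    (hasDerivAt_betaR ha
      (abs_lt.2 ⟨by linarith [hx.1], by linarith [hx.2]⟩)).continuousAt.continuousWithinAt
  obtain ⟨x, hx, hxy⟩ := intermediate_value_Icc (by norm_num) hc
    (show y ∈ Icc _ _ from ⟨by linarith [hy.1], by linarith [hy.2]⟩)
  exact ⟨x, ⟨by linarith [hx.1], by linarith [hx.2]⟩, hxy⟩

lemma betaInv_mem (ha : SmallCoeff a) {y : ℝ} (hy : y ∈ Ioo (-(14 / 10) : ℝ) (14 / 10)) :
    betaInv a y ∈ Ioo (-(3 / 2) : ℝ) (3 / 2) :=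
  Function.invFunOn_mem (exists_betaR_eq ha hy)

lemma betaR_betaInv (ha : SmallCoeff a) {y : ℝ} (hy : y ∈ Ioo (-(14 / 10) : ℝ) (14 / 10)) :
    betaR a (betaInv a y) = y :=
  Function.invFunOn_eq (exists_betaR_eq ha hy)

lemma betaInv_zero (ha : SmallCoeff a) : betaInv a 0 = 0 := by
  have := betaInv_betaR ha (x := 0) (by norm_num)
  rwa [betaR_zero] at this

lemma betaInv_one (ha : SmallCoeff a) : betaInv a 1 = 1 := by
  have := betaInv_betaR ha (x := 1) (by norm_num)
  rwa [betaR_one] at this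

lemma betaInv_lt_betaInv (ha : SmallCoeff a) {x y : ℝ} (hx : x ∈ Ioo (-(14 / 10) : ℝ) (14 / 10))
    (hy : y ∈ Ioo (-(14 / 10) : ℝ) (14 / 10)) (hxy : x < y) : betaInv a x < betaInv a y := by
  by_contra! h
  have := (strictMonoOn_betaR ha).monotoneOn (betaInv_mem ha hy) (betaInv_mem ha hx) h
  rw [betaR_betaInv ha hx, betaR_betaInv ha hy] at this
  linarith

lemma betaInv_mem_Icc (ha : SmallCoeff a) {y : ℝ} (hy : y ∈ Icc (0 : ℝ) 1) :
    betaInv a y ∈ Icc (0 : ℝ) 1 := by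
  have hm : ∀ {y : ℝ}, y ∈ Icc (0 : ℝ) 1 → y ∈ Ioo (-(14 / 10) : ℝ) (14 / 10) := fun hy =>
    ⟨by linarith [hy.1], by linarith [hy.2]⟩
  constructor
  · rcases hy.1.eq_or_lt with h | h
    · rw [← h, betaInv_zero ha]
    · have := betaInv_lt_betaInv ha (hm (by simp)) (hm hy) h
      rw [betaInv_zero ha] at this
      exact this.le
  · rcases hy.2.eq_or_lt with h | h
    · rw [h, betaInv_one ha]
    · have := betaInv_lt_betaInv ha (hm hy) (hm (by simp)) h
      rw [betaInv_one ha] at this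
      exact this.le

lemma contDiffAt_betaInv (ha : SmallCoeff a) {y : ℝ} (hy : y ∈ Ioo (-(14 / 10) : ℝ) (14 / 10)) :
    ContDiffAt ℝ 3 (betaInv a) y := by
  set x := betaInv a y with hx
  have hxm := betaInv_mem ha hy
  have hxa := abs_lt_two_of_mem hxm
  have hc := contDiffAt_betaR ha hxa 3
  have hd := hasDerivAt_betaR ha hxa
  set e : ℝ ≃L[ℝ] ℝ := ContinuousLinearEquiv.unitsEquivAut ℝ (Units.mk0 _ (betaD1_pos ha hxa).ne')
    with he
  have hd' : HasFDerivAt (betaR a) (e : ℝ →L[ℝ] ℝ) x := by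
    have h := hd.hasFDerivAt
    rwa [show ContinuousLinearMap.toSpanSingleton ℝ (betaD1 a (betaInv a y)) = (e : ℝ →L[ℝ] ℝ) by
      ext; simp [he]] at h
  have hinv := hc.to_localInverse hd' (by norm_num)
  rw [betaR_betaInv ha hy] at hinv
  refine hinv.congr_of_eventuallyEq ?_
  have hcont := hinv.continuousAt
  have h1 : hc.localInverse hd' (by norm_num) (betaR a x) = x :=
    hc.localInverse_apply_image hd' (by norm_num)
  rw [betaR_betaInv ha hy] at h1
  have h2 : ∀ᶠ z in nhds y, hc.localInverse hd' (by norm_num) z ∈ Ioo (-(3 / 2) : ℝ) (3 / 2) := by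
    apply hcont.eventually_mem
    rw [h1]
    exact isOpen_Ioo.mem_nhds hxm
  have h3 := (hc.hasStrictFDerivAt' hd' (by norm_num)).eventually_right_inverse
  rw [betaR_betaInv ha hy] at h3
  filter_upwards [h2, h3] with z hz2 hz3
  have := betaInv_betaR ha hz2
  rw [← this]
  congr 1
  exact hz3.symm

lemma hasDerivAt_betaInv (ha : SmallCoeff a) {y : ℝ} (hy : y ∈ Ioo (-(14 / 10) : ℝ) (14 / 10)) :
    HasDerivAt (betaInv a) (betaD1 a (betaInv a y))⁻¹ y := by
  have hxa := abs_lt_two_of_mem (betaInv_mem ha hy)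
  refine HasDerivAt.of_local_left_inverse (contDiffAt_betaInv ha hy).continuousAt
    (hasDerivAt_betaR ha hxa) (betaD1_pos ha hxa).ne' ?_
  filter_upwards [isOpen_Ioo.mem_nhds hy] with z hz using betaR_betaInv ha hz

end InverseDiffeo

section BranchDerivatives

/-- The right branch of the standard family. -/
noncomputable def branchQ (ρ c v x : ℝ) : ℝ := 1 + v * (-1 + ((x - c) / (1 - c)) ^ ρ)

/-- The first derivative of `branchQ`. -/
noncomputable def branchQ1 (ρ c v x : ℝ) : ℝ := v * ρ / (1 - c) * ((x - c) / (1 - c)) ^ (ρ - 1)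

/-- The second derivative of `branchQ`. -/
noncomputable def branchQ2 (ρ c v x : ℝ) : ℝ :=
  v * ρ * (ρ - 1) / (1 - c) ^ 2 * ((x - c) / (1 - c)) ^ (ρ - 2)

/-- The third derivative of `branchQ`. -/
noncomputable def branchQ3 (ρ c v x : ℝ) : ℝ :=
  v * ρ * (ρ - 1) * (ρ - 2) / (1 - c) ^ 3 * ((x - c) / (1 - c)) ^ (ρ - 3)

/-- A right branch of a Lorenz map. -/
noncomputable def branchF (ρ c v : ℝ) (a : ℕ → ℝ) (x : ℝ) : ℝ := betaInv a (branchQ ρ c v x)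

/-- The first derivative of `branchF`. -/
noncomputable def branchF1 (ρ c v : ℝ) (a : ℕ → ℝ) (x : ℝ) : ℝ :=
  branchQ1 ρ c v x / betaD1 a (branchF ρ c v a x)

/-- The second derivative of `branchF`. -/
noncomputable def branchF2 (ρ c v : ℝ) (a : ℕ → ℝ) (x : ℝ) : ℝ :=
  (branchQ2 ρ c v x - betaD2 a (branchF ρ c v a x) * branchF1 ρ c v a x ^ 2)
    / betaD1 a (branchF ρ c v a x)

/-- The third derivative of `branchF`. -/
noncomputable def branchF3 (ρ c v : ℝ) (a : ℕ → ℝ) (x : ℝ) : ℝ :=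
  (branchQ3 ρ c v x - betaD3 a (branchF ρ c v a x) * branchF1 ρ c v a x ^ 3
      - 3 * betaD2 a (branchF ρ c v a x) * branchF1 ρ c v a x * branchF2 ρ c v a x)
    / betaD1 a (branchF ρ c v a x)

variable {ρ c v : ℝ} {a : ℕ → ℝ} {x : ℝ}

lemma hasDerivAt_power (hc : c < 1) (hx : c < x) (p : ℝ) :
    HasDerivAt (fun x => ((x - c) / (1 - c)) ^ p)
      (p / (1 - c) * ((x - c) / (1 - c)) ^ (p - 1)) x := by
  have hd : 0 < 1 - c := by linarith
  have h1 : HasDerivAt (fun x => (x - c) / (1 - c)) (1 / (1 - c)) x :=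
    ((hasDerivAt_id x).sub_const c).div_const _
  have h2 := h1.rpow_const (p := p) (Or.inl (div_pos (by linarith) hd).ne')
  convert h2 using 1
  ring

lemma hasDerivAt_branchQ (hc : c < 1) (hx : c < x) :
    HasDerivAt (branchQ ρ c v) (branchQ1 ρ c v x) x := by
  have h := (((hasDerivAt_power hc hx ρ).const_add (-1)).const_mul v).const_add 1
  refine h.congr_deriv (Eq.symm ?_)
  unfold branchQ1
  ring

lemma hasDerivAt_branchQ1 (hc : c < 1) (hx : c < x) :
    HasDerivAt (branchQ1 ρ c v) (branchQ2 ρ c v x) x := by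
  have h := (hasDerivAt_power hc hx (ρ - 1)).const_mul (v * ρ / (1 - c))
  refine h.congr_deriv (Eq.symm ?_)
  rw [branchQ2, show ρ - 1 - 1 = ρ - 2 by ring]
  have hd : 1 - c ≠ 0 := by linarith
  generalize ((x - c) / (1 - c)) ^ (ρ - 2) = T
  field_simp

lemma hasDerivAt_branchQ2 (hc : c < 1) (hx : c < x) :
    HasDerivAt (branchQ2 ρ c v) (branchQ3 ρ c v x) x := by
  have h := (hasDerivAt_power hc hx (ρ - 2)).const_mul (v * ρ * (ρ - 1) / (1 - c) ^ 2)
  refine h.congr_deriv (Eq.symm ?_)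
  rw [branchQ3, show ρ - 2 - 1 = ρ - 3 by ring]
  have hd : 1 - c ≠ 0 := by linarith
  generalize ((x - c) / (1 - c)) ^ (ρ - 3) = T
  field_simp

lemma branchQ_mem_Icc (hρ : 2 < ρ) (hc : c < 1) (hv0 : 0 < v)
    (hx : x ∈ Icc c 1) : branchQ ρ c v x ∈ Icc (1 - v) 1 := by
  have hd : 0 < 1 - c := by linarith
  have h0 : 0 ≤ (x - c) / (1 - c) := div_nonneg (by linarith [hx.1]) hd.le
  have h1 : (x - c) / (1 - c) ≤ 1 := by rw [div_le_one hd]; linarith [hx.2]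
  have h2 := Real.rpow_nonneg h0 ρ
  have h3 := Real.rpow_le_one h0 h1 (by linarith : 0 ≤ ρ)
  unfold branchQ
  constructor <;> nlinarith

lemma mem_wide {y : ℝ} (hy : y ∈ Icc (0 : ℝ) 1) : y ∈ Ioo (-(14 / 10) : ℝ) (14 / 10) :=
  ⟨by linarith [hy.1], by linarith [hy.2]⟩

lemma branchQ_mem_unit (hρ : 2 < ρ) (hc : c < 1) (hv0 : 0 < v) (hv1 : v ≤ 1)
    (hx : x ∈ Icc c 1) : branchQ ρ c v x ∈ Icc (0 : ℝ) 1 := by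
  have h := branchQ_mem_Icc hρ hc hv0 hx
  exact ⟨by linarith [h.1], h.2⟩

lemma abs_branchF_lt (ha : SmallCoeff a) (hQ : branchQ ρ c v x ∈ Icc (0 : ℝ) 1) :
    |branchF ρ c v a x| < 2 :=
  abs_lt_two_of_mem (betaInv_mem ha (mem_wide hQ))

lemma hasDerivAt_branchF (ha : SmallCoeff a) (hc : c < 1) (hx : c < x)
    (hQ : branchQ ρ c v x ∈ Icc (0 : ℝ) 1) :
    HasDerivAt (branchF ρ c v a) (branchF1 ρ c v a x) x := by
  have h := (hasDerivAt_betaInv ha (mem_wide hQ)).comp x (hasDerivAt_branchQ hc hx)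
  refine h.congr_deriv (Eq.symm ?_)
  unfold branchF1 branchF
  rw [div_eq_inv_mul]

lemma hasDerivAt_branchF1 (ha : SmallCoeff a) (hc : c < 1) (hx : c < x)
    (hQ : branchQ ρ c v x ∈ Icc (0 : ℝ) 1) :
    HasDerivAt (branchF1 ρ c v a) (branchF2 ρ c v a x) x := by
  have hF := abs_branchF_lt ha hQ
  have hB := (betaD1_pos ha hF).ne'
  have h1 := (hasDerivAt_betaD1 ha hF).comp x (hasDerivAt_branchF ha hc hx hQ)
  have h := (hasDerivAt_branchQ1 (ρ := ρ) (v := v) hc hx).div h1 hB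
  refine h.congr_deriv (Eq.symm ?_)
  unfold branchF2 branchF1
  simp only [Function.comp_apply]
  field_simp

lemma hasDerivAt_branchF2 (ha : SmallCoeff a) (hc : c < 1) (hx : c < x)
    (hQ : branchQ ρ c v x ∈ Icc (0 : ℝ) 1) :
    HasDerivAt (branchF2 ρ c v a) (branchF3 ρ c v a x) x := by
  have hF := abs_branchF_lt ha hQ
  have hB := (betaD1_pos ha hF).ne'
  have h0 := hasDerivAt_branchF ha hc hx hQ
  have h1 := (hasDerivAt_betaD1 ha hF).comp x h0
  have h2 := (hasDerivAt_betaD2 ha hF).comp x h0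
  have h3 := (hasDerivAt_branchF1 ha hc hx hQ).pow 2
  have h := ((hasDerivAt_branchQ2 (ρ := ρ) (v := v) hc hx).sub (h2.mul h3)).div h1 hB
  refine h.congr_deriv (Eq.symm ?_)
  have h4 : branchQ2 ρ c v x = branchF2 ρ c v a x * betaD1 a (branchF ρ c v a x)
      + betaD2 a (branchF ρ c v a x) * branchF1 ρ c v a x ^ 2 := by
    rw [branchF2]
    field_simp
    ring
  unfold branchF3
  simp only [Pi.pow_apply, Pi.mul_apply, Pi.sub_apply, Function.comp_apply, h4]
  field_simp
  push_cast
  ring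

lemma contDiffAt_branchF (ha : SmallCoeff a) (hc : c < 1) (hx : c < x)
    (hQ : branchQ ρ c v x ∈ Icc (0 : ℝ) 1) : ContDiffAt ℝ 3 (branchF ρ c v a) x := by
  have h1 : ContDiffAt ℝ 3 (fun x => (x - c) / (1 - c)) x := by fun_prop
  have h2 : ContDiffAt ℝ 3 (branchQ ρ c v) x := by
    unfold branchQ
    exact contDiffAt_const.add (contDiffAt_const.mul (contDiffAt_const.add
      (h1.rpow_const_of_ne (div_pos (by linarith) (by linarith)).ne')))
  exact (contDiffAt_betaInv ha (mem_wide hQ)).comp x h2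

lemma branchF1_pos (hρ : 2 < ρ) (ha : SmallCoeff a) (hc : c < 1) (hv0 : 0 < v)
    (hx : c < x) (hQ : branchQ ρ c v x ∈ Icc (0 : ℝ) 1) : 0 < branchF1 ρ c v a x := by
  have hB := betaD1_pos ha (abs_branchF_lt ha hQ)
  have hd : 0 < 1 - c := by linarith
  have ht : 0 < (x - c) / (1 - c) := div_pos (by linarith) hd
  have := Real.rpow_pos_of_pos ht (ρ - 1)
  unfold branchF1 branchQ1
  positivity

/-- The right branch has negative Schwarzian derivative. -/
lemma branch_schwarzian_neg (hρ : 2 < ρ) (ha : SmallCoeff a) (hc : c < 1) (hv0 : 0 < v)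
    (hv1 : v ≤ 1) (hx : x ∈ Ioc c 1) :
    branchF3 ρ c v a x / branchF1 ρ c v a x
      - 3 / 2 * (branchF2 ρ c v a x / branchF1 ρ c v a x) ^ 2 < 0 := by
  have hQ := branchQ_mem_unit hρ hc hv0 hv1 ⟨hx.1.le, hx.2⟩
  have hF := abs_branchF_lt ha hQ
  have hB := betaD1_pos ha hF
  have hX := branchF1_pos hρ ha hc hv0 hx.1 hQ
  have hd : 0 < 1 - c := by linarith
  have ht : 0 < (x - c) / (1 - c) := div_pos (by linarith [hx.1]) hd
  have ht1 : (x - c) / (1 - c) ≤ 1 := by rw [div_le_one hd]; linarith [hx.2]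
  have b1 := abs_le.1 (abs_betaD1_sub_one_le ha hF)
  have b2 := abs_le.1 (abs_betaD2_le ha hF)
  have b3 := abs_le.1 (abs_betaD3_le ha hF)
  have e1 : branchF1 ρ c v a x * betaD1 a (branchF ρ c v a x) = branchQ1 ρ c v x := by
    rw [branchF1]; field_simp
  have e2 : branchF2 ρ c v a x * betaD1 a (branchF ρ c v a x)
      = branchQ2 ρ c v x - betaD2 a (branchF ρ c v a x) * branchF1 ρ c v a x ^ 2 := by
    rw [branchF2]; field_simp
  have e3 : branchF3 ρ c v a x * betaD1 a (branchF ρ c v a x)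
      = branchQ3 ρ c v x - betaD3 a (branchF ρ c v a x) * branchF1 ρ c v a x ^ 3
      - 3 * betaD2 a (branchF ρ c v a x) * branchF1 ρ c v a x * branchF2 ρ c v a x := by
    rw [branchF3]; field_simp
  set t := (x - c) / (1 - c) with htdef
  set T := t ^ (ρ - 2) with hT
  have hT0 : 0 < T := Real.rpow_pos_of_pos ht _
  have hT1 : T ≤ 1 := Real.rpow_le_one ht.le ht1 (by linarith)
  have q1 : branchQ1 ρ c v x = v * ρ / (1 - c) * (T * t) := by
    rw [branchQ1, ← htdef, hT, ← Real.rpow_add_one ht.ne']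
    congr 2
    ring
  have q2 : branchQ2 ρ c v x = v * ρ * (ρ - 1) / (1 - c) ^ 2 * T := rfl
  have q3 : branchQ3 ρ c v x * t = v * ρ * (ρ - 1) * (ρ - 2) / (1 - c) ^ 3 * T := by
    rw [branchQ3, ← htdef, mul_assoc, ← Real.rpow_add_one ht.ne']
    congr 2
    ring
  have q13 : branchQ1 ρ c v x * branchQ3 ρ c v x - 3 / 2 * branchQ2 ρ c v x ^ 2
      = -(v ^ 2 * ρ ^ 2 * (ρ ^ 2 - 1) / (2 * (1 - c) ^ 4) * T ^ 2) := by
    have : branchQ1 ρ c v x * branchQ3 ρ c v x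
        = v * ρ / (1 - c) * T * (v * ρ * (ρ - 1) * (ρ - 2) / (1 - c) ^ 3 * T) := by
      rw [q1, ← q3]; ring
    rw [this, q2]
    field_simp
    ring
  generalize betaD1 a (branchF ρ c v a x) = B1 at *
  generalize betaD2 a (branchF ρ c v a x) = B2 at *
  generalize betaD3 a (branchF ρ c v a x) = B3 at *
  generalize branchF1 ρ c v a x = X at *
  generalize branchF2 ρ c v a x = Y at *
  generalize branchF3 ρ c v a x = Z at *
  have hX4 : X ^ 4 ≤ 2 * (v ^ 2 * ρ ^ 4 / (1 - c) ^ 4 * T ^ 2) := by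
    have h1 : (X * B1) ^ 4 ≤ v ^ 2 * ρ ^ 4 / (1 - c) ^ 4 * T ^ 2 := by
      rw [e1, q1]
      have hv2 : v ^ 2 ≤ 1 := pow_le_one₀ hv0.le hv1
      have hTt : T ^ 2 * t ^ 4 ≤ 1 :=
        mul_le_one₀ (pow_le_one₀ hT0.le hT1) (by positivity) (pow_le_one₀ ht.le ht1)
      calc (v * ρ / (1 - c) * (T * t)) ^ 4
          = v ^ 2 * ρ ^ 4 / (1 - c) ^ 4 * T ^ 2 * (v ^ 2 * (T ^ 2 * t ^ 4)) := by
            field_simp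
        _ ≤ v ^ 2 * ρ ^ 4 / (1 - c) ^ 4 * T ^ 2 * 1 := by
            gcongr
            exact mul_le_one₀ hv2 (by positivity) hTt
        _ = _ := mul_one _
    have h2 : (1 / 2 : ℝ) ≤ B1 ^ 4 := by
      calc (1 / 2 : ℝ) ≤ (999 / 1000) ^ 4 := by norm_num
        _ ≤ B1 ^ 4 := by gcongr; linarith
    have h3 : X ^ 4 * (1 / 2) ≤ X ^ 4 * B1 ^ 4 := by gcongr
    rw [mul_pow] at h1
    linarith
  have hnum : B1 ^ 2 * (Z * X - 3 / 2 * Y ^ 2) < 0 := by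
    have h1 : B1 ^ 2 * (Z * X - 3 / 2 * Y ^ 2)
        = branchQ1 ρ c v x * branchQ3 ρ c v x - 3 / 2 * branchQ2 ρ c v x ^ 2
          + (3 / 2 * B2 ^ 2 - B1 * B3) * X ^ 4 := by
      rw [← e1]
      have e2' : branchQ2 ρ c v x = Y * B1 + B2 * X ^ 2 := by linarith
      have e3' : branchQ3 ρ c v x = Z * B1 + B3 * X ^ 3 + 3 * B2 * X * Y := by linarith
      rw [e2', e3']
      ring
    have h2 : 3 / 2 * B2 ^ 2 - B1 * B3 ≤ 1 / 100 := by nlinarith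
    have h3 : (3 / 2 * B2 ^ 2 - B1 * B3) * X ^ 4
        ≤ 1 / 100 * (2 * (v ^ 2 * ρ ^ 4 / (1 - c) ^ 4 * T ^ 2)) :=
      (mul_le_mul_of_nonneg_right h2 (by positivity)).trans (by gcongr)
    have h4 : v ^ 2 * ρ ^ 2 * (ρ ^ 2 - 1) / (2 * (1 - c) ^ 4) * T ^ 2
        - 1 / 100 * (2 * (v ^ 2 * ρ ^ 4 / (1 - c) ^ 4 * T ^ 2))
        = v ^ 2 * ρ ^ 2 / (1 - c) ^ 4 * T ^ 2 * ((ρ ^ 2 - 1) / 2 - 1 / 50 * ρ ^ 2) := by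
      field_simp
      ring
    have h5 : 0 < v ^ 2 * ρ ^ 2 / (1 - c) ^ 4 * T ^ 2 * ((ρ ^ 2 - 1) / 2 - 1 / 50 * ρ ^ 2) := by
      have : 0 < (ρ ^ 2 - 1) / 2 - 1 / 50 * ρ ^ 2 := by nlinarith
      positivity
    rw [h1, q13]
    linarith
  have h6 : Z * X - 3 / 2 * Y ^ 2 < 0 := by
    by_contra! h
    have := mul_nonneg (sq_nonneg B1) h
    linarith
  have h7 : Z / X - 3 / 2 * (Y / X) ^ 2 = (Z * X - 3 / 2 * Y ^ 2) / X ^ 2 := by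
    field_simp
  rw [h7]
  exact div_neg_of_neg_of_pos h6 (by positivity)

end BranchDerivatives

section LorenzMaps

/-- The left diffeomorphism, obtained by the reflection `x ↦ 1 - x`. -/
noncomputable def leftDiffeo (a : ℕ → ℝ) (z : ℝ) : ℝ := 1 - betaInv a (1 - z)

lemma derivWithin_eq_of_eqOn {S V : Set ℝ} (hS : UniqueDiffOn ℝ S) (hV : IsOpen V) {g g₀ g₁ : ℝ → ℝ}
    (hg : ∀ x ∈ S ∩ V, g x = g₀ x) (hd : ∀ x ∈ S ∩ V, HasDerivAt g₀ (g₁ x) x) :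
    ∀ x ∈ S ∩ V, derivWithin g S x = g₁ x := by
  intro x hx
  have h1 : g =ᶠ[nhdsWithin x S] g₀ := by
    filter_upwards [self_mem_nhdsWithin, mem_nhdsWithin_of_mem_nhds (hV.mem_nhds hx.2)] with y hy hyV
      using hg y ⟨hy, hyV⟩
  exact ((hd x hx).hasDerivWithinAt.congr_of_eventuallyEq h1 (hg x hx)).derivWithin (hS x hx.1)

variable {ρ u v c : ℝ} {a₀ a₁ : ℕ → ℝ}

lemma lorenzF_of_ge {x : ℝ} (hx : c ≤ x) :
    lorenzF ρ u v c (leftDiffeo a₀) (betaInv a₁) x = branchF ρ c v a₁ x := by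
  rw [lorenzF, if_neg (not_lt.2 hx)]
  rfl

lemma lorenzF_of_lt {x : ℝ} (hx : x < c) :
    lorenzF ρ u v c (leftDiffeo a₀) (betaInv a₁) x = 1 - branchF ρ (1 - c) u a₀ (1 - x) := by
  rw [lorenzF, if_pos hx, leftDiffeo, branchF, branchQ]
  congr 2
  rw [show 1 - x - (1 - c) = c - x by ring, show 1 - (1 - c) = c by ring]
  ring

lemma derivWithin_betaInv_pos {a : ℕ → ℝ} (ha : SmallCoeff a) {x : ℝ} (hx : x ∈ Icc (0 : ℝ) 1) :
    0 < derivWithin (betaInv a) (Icc 0 1) x := by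
  have hm := mem_wide hx
  rw [(hasDerivAt_betaInv ha hm).hasDerivWithinAt.derivWithin (uniqueDiffOn_Icc zero_lt_one x hx)]
  exact inv_pos.2 (betaD1_pos ha (abs_lt_two_of_mem (betaInv_mem ha hm)))

lemma one_sub_mem_unit {x : ℝ} (hx : x ∈ Icc (0 : ℝ) 1) : 1 - x ∈ Icc (0 : ℝ) 1 :=
  ⟨by linarith [hx.2], by linarith [hx.1]⟩

lemma isLorenz_of_small (hρ : 2 < ρ) (hu0 : 0 < u) (hu1 : u ≤ 1) (hv0 : 0 < v) (hv1 : v ≤ 1)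
    (hc0 : 0 < c) (hc1 : c < 1) (h0 : SmallCoeff a₀) (h1 : SmallCoeff a₁) :
    IsLorenz 3 ρ u v c (leftDiffeo a₀) (betaInv a₁) where
  one_lt_rho := by linarith
  u_pos := hu0
  u_le_one := hu1
  v_pos := hv0
  v_le_one := hv1
  c_pos := hc0
  c_lt_one := hc1
  phi_smooth := by
    intro x hx
    have h := contDiffAt_betaInv h0 (mem_wide (one_sub_mem_unit hx))
    have h2 : ContDiffAt ℝ 3 (fun z : ℝ => 1 - z) x := by fun_prop
    exact (contDiffAt_const.sub (h.comp x h2)).contDiffWithinAt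
  psi_smooth := fun x hx => (contDiffAt_betaInv h1 (mem_wide hx)).contDiffWithinAt
  phi_zero := by simp [leftDiffeo, betaInv_one h0]
  phi_one := by simp [leftDiffeo, betaInv_zero h0]
  psi_zero := betaInv_zero h1
  psi_one := betaInv_one h1
  phi_deriv_pos := by
    intro x hx
    have hm := mem_wide (one_sub_mem_unit hx)
    have h := ((hasDerivAt_betaInv h0 hm).comp x ((hasDerivAt_id x).const_sub 1)).const_sub 1
    have h' : HasDerivAt (leftDiffeo a₀) (betaD1 a₀ (betaInv a₀ (1 - x)))⁻¹ x :=
      h.congr_deriv (by simp)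
    rw [h'.hasDerivWithinAt.derivWithin (uniqueDiffOn_Icc zero_lt_one x hx)]
    exact inv_pos.2 (betaD1_pos h0 (abs_lt_two_of_mem (betaInv_mem h0 hm)))
  psi_deriv_pos := fun x hx => derivWithin_betaInv_pos h1 hx

/-- A Lorenz map with nearly affine diffeomorphisms has negative Schwarzian derivative. -/
lemma negSchwarzian_of_small (hρ : 2 < ρ) (hu0 : 0 < u) (hu1 : u ≤ 1) (hv0 : 0 < v) (hv1 : v ≤ 1)
    (hc0 : 0 < c) (hc1 : c < 1) (h0 : SmallCoeff a₀) (h1 : SmallCoeff a₁) :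
    NegSchwarzian (lorenzF ρ u v c (leftDiffeo a₀) (betaInv a₁)) c := by
  set f := lorenzF ρ u v c (leftDiffeo a₀) (betaInv a₁) with hf
  set S : Set ℝ := Icc 0 1 \ {c} with hSdef
  have hS : UniqueDiffOn ℝ S := by
    rw [hSdef, sdiff_eq]
    exact (uniqueDiffOn_Icc zero_lt_one).inter isOpen_compl_singleton
  have hc1' : 1 - c < 1 := by linarith
  have hR : ∀ x ∈ S ∩ Ioi c, c < x ∧ branchQ ρ c v x ∈ Icc (0 : ℝ) 1 := fun x hx =>
    ⟨hx.2, branchQ_mem_unit hρ hc1 hv0 hv1 ⟨(mem_Ioi.1 hx.2).le, hx.1.1.2⟩⟩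
  have hL : ∀ x ∈ S ∩ Iio c, 1 - c < 1 - x ∧ branchQ ρ (1 - c) u (1 - x) ∈ Icc (0 : ℝ) 1 :=
    fun x hx => by
      have h := mem_Iio.1 hx.2
      exact ⟨by linarith, branchQ_mem_unit hρ hc1' hu0 hu1 ⟨by linarith, by linarith [hx.1.1.1]⟩⟩
  have fR : ∀ x ∈ S ∩ Ioi c, f x = branchF ρ c v a₁ x := fun x hx =>
    lorenzF_of_ge (mem_Ioi.1 hx.2).le
  have fL : ∀ x ∈ S ∩ Iio c, f x = 1 - branchF ρ (1 - c) u a₀ (1 - x) := fun x hx =>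
    lorenzF_of_lt hx.2
  have hflip : ∀ x : ℝ, HasDerivAt (fun z : ℝ => 1 - z) (-1) x := fun x =>
    (hasDerivAt_id x).const_sub 1
  have hcase : ∀ x ∈ S, x ∈ S ∩ Ioi c ∨ x ∈ S ∩ Iio c := fun x hx => by
    rcases lt_trichotomy x c with h | h | h
    · exact Or.inr ⟨hx, h⟩
    · exact absurd h hx.2
    · exact Or.inl ⟨hx, h⟩
  constructor
  · intro x hx
    rcases hcase x hx with hx | hx
    · obtain ⟨hcx, hQ⟩ := hR x hx
      refine ((contDiffAt_branchF h1 hc1 hcx hQ).congr_of_eventuallyEq ?_).contDiffWithinAt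
      filter_upwards [isOpen_Ioi.mem_nhds hx.2] with y hy using lorenzF_of_ge (mem_Ioi.1 hy).le
    · obtain ⟨hcx, hQ⟩ := hL x hx
      have h2 : ContDiffAt ℝ 3 (fun z : ℝ => 1 - z) x := by fun_prop
      have h3 : ContDiffAt ℝ 3 (fun z => 1 - branchF ρ (1 - c) u a₀ (1 - z)) x :=
        contDiffAt_const.sub ((contDiffAt_branchF h0 hc1' hcx hQ).comp x h2)
      refine (h3.congr_of_eventuallyEq ?_).contDiffWithinAt
      filter_upwards [isOpen_Iio.mem_nhds hx.2] with y hy using lorenzF_of_lt hy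
  · intro x hx
    rcases hcase x hx with hx | hx
    · have d1 := derivWithin_eq_of_eqOn hS isOpen_Ioi fR (g₁ := branchF1 ρ c v a₁) fun y hy =>
        hasDerivAt_branchF h1 hc1 (hR y hy).1 (hR y hy).2
      have d2 := derivWithin_eq_of_eqOn hS isOpen_Ioi d1 (g₁ := branchF2 ρ c v a₁) fun y hy =>
        hasDerivAt_branchF1 h1 hc1 (hR y hy).1 (hR y hy).2
      have d3 := derivWithin_eq_of_eqOn hS isOpen_Ioi d2 (g₁ := branchF3 ρ c v a₁) fun y hy =>
        hasDerivAt_branchF2 h1 hc1 (hR y hy).1 (hR y hy).2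
      rw [d1 x hx, d2 x hx, d3 x hx]
      exact branch_schwarzian_neg hρ h1 hc1 hv0 hv1 ⟨hx.2, hx.1.1.2⟩
    · have d1 := derivWithin_eq_of_eqOn hS isOpen_Iio fL
        (g₁ := fun y => branchF1 ρ (1 - c) u a₀ (1 - y)) fun y hy =>
          (((hasDerivAt_branchF h0 hc1' (hL y hy).1 (hL y hy).2).comp y (hflip y)).const_sub
            1).congr_deriv (by ring)
      have d2 := derivWithin_eq_of_eqOn hS isOpen_Iio d1
        (g₁ := fun y => -branchF2 ρ (1 - c) u a₀ (1 - y)) fun y hy =>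
          ((hasDerivAt_branchF1 h0 hc1' (hL y hy).1 (hL y hy).2).comp y (hflip y)).congr_deriv
            (by ring)
      have d3 := derivWithin_eq_of_eqOn hS isOpen_Iio d2
        (g₁ := fun y => branchF3 ρ (1 - c) u a₀ (1 - y)) fun y hy =>
          (((hasDerivAt_branchF2 h0 hc1' (hL y hy).1 (hL y hy).2).comp y (hflip y)).neg).congr_deriv
            (by ring)
      rw [d1 x hx, d2 x hx, d3 x hx, neg_div, neg_sq]
      exact branch_schwarzian_neg hρ h0 hc1' hu0 hu1 ⟨(hL x hx).1, by linarith [hx.1.1.1]⟩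

end LorenzMaps

section Dynamics

lemma iterate_eq_of_backward {X : Type*} {g : X → X} {P : ℕ → X} (h : ∀ j, g (P (j + 1)) = P j)
    (k n : ℕ) (hk : k ≤ n) : g^[k] (P n) = P (n - k) := by
  induction k with
  | zero => simp
  | succ k ih =>
    rw [Function.iterate_succ_apply', ih (by omega), show n - k = n - (k + 1) + 1 by omega, h]

lemma branchF_mem_Icc {ρ c v : ℝ} {a : ℕ → ℝ} (hρ : 2 < ρ) (ha : SmallCoeff a) (hc : c < 1)
    (hv0 : 0 < v) (hv1 : v ≤ 1) {x : ℝ} (hx : x ∈ Icc c 1) :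
    branchF ρ c v a x ∈ Icc (0 : ℝ) 1 :=
  betaInv_mem_Icc ha (branchQ_mem_unit hρ hc hv0 hv1 hx)

lemma betaR_branchF {ρ c v : ℝ} {a : ℕ → ℝ} (hρ : 2 < ρ) (ha : SmallCoeff a) (hc : c < 1)
    (hv0 : 0 < v) (hv1 : v ≤ 1) {x : ℝ} (hx : x ∈ Icc c 1) :
    betaR a (branchF ρ c v a x) = branchQ ρ c v x :=
  betaR_betaInv ha (mem_wide (branchQ_mem_unit hρ hc hv0 hv1 hx))

lemma branchF_one {ρ c v : ℝ} {a : ℕ → ℝ} (ha : SmallCoeff a) (hc : c < 1) :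
    branchF ρ c v a 1 = 1 := by
  rw [branchF, branchQ, div_self (by linarith), Real.one_rpow]
  simp [betaInv_one ha]

lemma branchF_center {ρ c v : ℝ} {a : ℕ → ℝ} (hρ : 2 < ρ) :
    branchF ρ c v a c = betaInv a (1 - v) := by
  rw [branchF, branchQ, sub_self, zero_div, Real.zero_rpow (by linarith)]
  congr 1
  ring

lemma BranchData.branchF_center_lt {s c v ρ : ℝ} {a : ℕ → ℝ} (h : BranchData s c v a)
    (hρ : 2 < ρ) : branchF ρ c v a c < c := by
  have hl := h.level_pos le_rfl h.c_lt.le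
  have hv := h.v_pos
  rw [levelR, sub_pos, div_lt_one hv] at hl
  have hv1 := h.v_le
  have hc : c ∈ Ioo (-(3 / 2) : ℝ) (3 / 2) := ⟨by linarith [h.c_pos], by linarith [h.c_lt]⟩
  rw [branchF_center hρ]
  by_contra! hle
  have hm : 1 - v ∈ Ioo (-(14 / 10) : ℝ) (14 / 10) := ⟨by linarith, by linarith⟩
  have := (strictMonoOn_betaR h.small).monotoneOn hc (betaInv_mem h.small hm) hle
  rw [betaR_betaInv h.small hm] at this
  linarith

lemma branchF_invR {s c v ρ : ℝ} {a : ℕ → ℝ} (hρ : s * ρ = 1) (hc : c < 1) (hv : v ≠ 0)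
    (ha : SmallCoeff a) {x : ℝ} (hx : x ∈ Icc (0 : ℝ) 1) (hl : 0 < levelR v a x) :
    branchF ρ c v a (invR s c v a x) = x := by
  have hd : 1 - c ≠ 0 := by linarith
  have h1 : (invR s c v a x - c) / (1 - c) = levelR v a x ^ s := by
    rw [invR, add_sub_cancel_left, mul_div_cancel_left₀ _ hd]
  have h2 : branchQ ρ c v (invR s c v a x) = betaR a x := by
    rw [branchQ, h1, ← Real.rpow_mul hl.le, hρ, Real.rpow_one, levelR]
    field_simp
    ring
  rw [branchF, h2]
  exact betaInv_betaR ha ⟨by linarith [hx.1], by linarith [hx.2]⟩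

namespace PullData

variable {s c v : ℝ} {a α : ℕ → ℝ} {l c' : ℝ}

lemma pre_mem_unit (h : PullData s c v a α l c') {z : ℝ} (hz : z ∈ Icc (0 : ℝ) 1) (n : ℕ) :
    preR s c v a l c' n z ∈ Icc (0 : ℝ) 1 :=
  ⟨(h.pre_pos hz n).le, (h.pre_bounds hz n).2.le⟩

lemma branchF_pre (h : PullData s c v a α l c') {ρ : ℝ} (hρ : s * ρ = 1) {z : ℝ}
    (hz : z ∈ Icc (0 : ℝ) 1) (n : ℕ) :
    branchF ρ c v a (preR s c v a l c' (n + 1) z) = preR s c v a l c' n z := by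
  rw [pre_succ]
  exact branchF_invR hρ h.c_lt h.v_pos.ne' h.small (h.pre_mem_unit hz n)
    (h.pre_ofReal (abs_le_five hz) n).2

/-- The inverse orbits leave the renormalization interval after one step. -/
lemma lt_pre (h : PullData s c v a α l c') {z : ℝ} (hz : z ∈ Icc (0 : ℝ) 1) (n : ℕ) :
    c + l < preR s c v a l c' (n + 1) z := by
  have hc0 := h.c_pos
  have hc1 : 0 < 1 - c := by linarith [h.c_lt]
  have hv := h.v_pos
  have hb := h.pre_bounds hz n
  have hx0 := h.pre_pos hz n
  have hl0 := (h.pre_ofReal (abs_le_five hz) n).2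
  have hl1 := h.level_le_one hx0.le hb.2.le
  rw [pre_succ, invR]
  set x := preR s c v a l c' n z with hx
  have hlow : 8 / 10 * c ≤ levelR v a x := by
    rcases le_total c x with hcx | hcx
    · linarith [h.level_ge hcx hb.2.le]
    · have hlc := h.level_ge le_rfl h.c_lt.le
      have hn : n = 0 ∨ ∃ k, n = k + 1 := by cases n <;> simp
      have hclose : c - x ≤ 1 / 1000000000 * (c * (1 - c)) := by
        rcases hn with rfl | ⟨k, rfl⟩
        · rw [hx, preR, Function.iterate_zero, id]
          have h1 := h.l_le
          have h2 := h.l_pos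
          have h3 := h.c'_nonneg
          nlinarith [hz.2]
        · have hp := (h.pre_ofReal (abs_le_five hz) k).2
          have : c ≤ x := by
            rw [hx, pre_succ, invR]
            have := Real.rpow_nonneg hp.le s
            nlinarith
          have h0 : 0 < c * (1 - c) := by positivity
          linarith
      have hb2 := betaR_sub_le h.small (x := c) (y := x) (abs_lt.2 ⟨by linarith, by linarith⟩)
        (abs_lt.2 ⟨by linarith, by linarith⟩) hcx
      have hv2 : 1 - c ≤ v := by nlinarith [h.v_ge]
      have hdiff : levelR v a c - levelR v a x = (betaR a c - betaR a x) / v := by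
        rw [levelR, levelR]; field_simp; ring
      have hq : (betaR a c - betaR a x) / v ≤ 2 / 1000000000 * c := by
        rw [div_le_iff₀ hv]
        nlinarith
      linarith
  have hpow : levelR v a x ≤ levelR v a x ^ s := by
    calc levelR v a x = levelR v a x ^ (1 : ℝ) := (Real.rpow_one _).symm
      _ ≤ _ := Real.rpow_le_rpow_of_exponent_ge hl0 hl1 (by linarith [h.s_lt])
  have h1 := h.l_le
  have h0 : 0 < c * (1 - c) := by positivity
  nlinarith

lemma l_lt (h : PullData s c v a α l c') : l < c ∧ l < 1 - c := by
  have hc0 := h.c_pos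
  have hc1 : 0 < 1 - c := by linarith [h.c_lt]
  have h1 := h.l_le
  constructor <;> nlinarith

end PullData

/-- Passing the critical branch conjugates to the renormalized branch. -/
lemma SideStep.branchF_eq {s c v : ℝ} {a α : ℕ → ℝ} {l c' : ℝ} {n : ℕ} {w v' : ℝ} {α' : ℕ → ℝ}
    (h : SideStep s c v a α l c' n w v' α') (h' : BranchData s c' v' α') {ρ d : ℝ} (hρ2 : 2 < ρ)
    (hρ : s * ρ = 1) (hd : c = 1 - d) {y : ℝ} (hy : y ∈ Icc c' 1) :
    branchF ρ d w α (d + l * (y - c'))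
      = 1 - preR s c v a l c' n (branchF ρ c' v' α' y) := by
  have hz := branchF_mem_Icc hρ2 h'.small h'.c_lt h'.v_pos h'.v_le hy
  have hβ := betaR_branchF hρ2 h'.small h'.c_lt h'.v_pos h'.v_le hy
  set z := branchF ρ c' v' α' y with hzdef
  have hconj := h.conj z hz
  have hval := h.value
  have hw : 0 < w := by
    rw [hval]; exact h.newV_pos ⟨h'.v_pos.le, h'.v_le⟩ n
  have hgap : 0 < pullR s c v a α l c' n 1 - pullR s c v a α l c' n 0 := by
    have := h.pull_strictMono (z := 0) (w := 1) (by simp) (by simp) one_pos n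
    linarith
  have hs := h.scaling
  have hc0 := h.c_pos
  have hc1' : 0 < 1 - c' := by linarith [h'.c_lt]
  have key : branchQ ρ d w (d + l * (y - c')) = pullR s c v a α l c' n z := by
    rw [newV] at hval
    rw [hβ] at hconj
    rw [branchQ] at hconj ⊢
    set g := pullR s c v a α l c' n 1 - pullR s c v a α l c' n 0 with hg
    have hbase : 0 ≤ v' * g / w := by
      have := h'.v_pos
      positivity
    have e1 : (d + l * (y - c') - d) / (1 - d) = (y - c') / (1 - c') * (v' * g / w) ^ s := by
      rw [← hd, add_sub_cancel_left]
      have : (v' * g / w) ^ s = (1 - c') * l / c := by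
        rw [← hs]; field_simp
      rw [this]
      field_simp
    have e2 : ((v' * g / w) ^ s) ^ ρ = v' * g / w := by
      rw [← Real.rpow_mul hbase, hρ, Real.rpow_one]
    rw [e1, Real.mul_rpow (div_nonneg (by linarith [hy.1]) hc1'.le) (Real.rpow_nonneg hbase _), e2]
    generalize ((y - c') / (1 - c')) ^ ρ = Y at *
    have e3 : w * (-1 + Y * (v' * g / w)) = -w + Y * (v' * g) := by
      field_simp
    rw [e3, hval]
    have hg' : pullR s c v a α l c' n 1 = g + pullR s c v a α l c' n 0 := by rw [hg]; ring
    rw [hg']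
    linear_combination hconj
  rw [branchF, key, pullR]
  have hp := h.pre_mem_unit hz n
  exact betaInv_betaR h.small' ⟨by linarith [hp.2], by linarith [hp.1]⟩

end Dynamics

section Renormalization

/-- Two consecutive Lorenz maps of the chain, the second one being the rescaled first return map
of the first one to an interval of length `l` around its critical point. -/
structure RenormStep (ρ c u v : ℝ) (a₀ a₁ : ℕ → ℝ) (l : ℝ) (n m : ℕ) (c' u' v' : ℝ)
    (a₀' a₁' : ℕ → ℝ) : Prop where
  two_lt : 2 < ρ
  left : SideStep (1 / ρ) c v a₁ a₀ l (1 - c') n u u' a₀'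
  right : SideStep (1 / ρ) (1 - c) u a₀ a₁ l c' m v v' a₁'
  left' : BranchData (1 / ρ) (1 - c') u' a₀'
  right' : BranchData (1 / ρ) c' v' a₁'

namespace RenormStep

variable {ρ c u v : ℝ} {a₀ a₁ : ℕ → ℝ} {l : ℝ} {n m : ℕ} {c' u' v' : ℝ} {a₀' a₁' : ℕ → ℝ}

lemma inv_mul (h : RenormStep ρ c u v a₀ a₁ l n m c' u' v' a₀' a₁') : 1 / ρ * ρ = 1 :=
  one_div_mul_cancel (by linarith [h.two_lt])

lemma left_value_mem (h : RenormStep ρ c u v a₀ a₁ l n m c' u' v' a₀' a₁') {y : ℝ}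
    (hy : y ∈ Icc 0 c') : branchF ρ (1 - c') u' a₀' (1 - y) ∈ Icc (0 : ℝ) 1 :=
  branchF_mem_Icc h.two_lt h.left'.small h.left'.c_lt h.left'.v_pos h.left'.v_le
    ⟨by linarith [hy.2], by linarith [hy.1]⟩

lemma right_value_mem (h : RenormStep ρ c u v a₀ a₁ l n m c' u' v' a₀' a₁') {y : ℝ}
    (hy : y ∈ Icc c' 1) : branchF ρ c' v' a₁' y ∈ Icc (0 : ℝ) 1 :=
  branchF_mem_Icc h.two_lt h.right'.small h.right'.c_lt h.right'.v_pos h.right'.v_le hy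

lemma left_backward (h : RenormStep ρ c u v a₀ a₁ l n m c' u' v' a₀' a₁') {z : ℝ}
    (hz : z ∈ Icc (0 : ℝ) 1) (j : ℕ) :
    lorenzF ρ u v c (leftDiffeo a₀) (betaInv a₁) (preR (1 / ρ) c v a₁ l (1 - c') (j + 1) z)
      = preR (1 / ρ) c v a₁ l (1 - c') j z := by
  have h1 := h.left.lt_pre hz j
  have h2 := h.left.l_pos
  rw [lorenzF_of_ge (by linarith), h.left.branchF_pre h.inv_mul hz]

lemma right_backward (h : RenormStep ρ c u v a₀ a₁ l n m c' u' v' a₀' a₁') {z : ℝ}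
    (hz : z ∈ Icc (0 : ℝ) 1) (j : ℕ) :
    lorenzF ρ u v c (leftDiffeo a₀) (betaInv a₁)
        (1 - preR (1 / ρ) (1 - c) u a₀ l c' (j + 1) z)
      = 1 - preR (1 / ρ) (1 - c) u a₀ l c' j z := by
  have h1 := h.right.lt_pre hz j
  have h2 := h.right.l_pos
  rw [lorenzF_of_lt (by linarith), sub_sub_cancel, h.right.branchF_pre h.inv_mul hz]

lemma left_orbit (h : RenormStep ρ c u v a₀ a₁ l n m c' u' v' a₀' a₁') {y : ℝ}
    (hy : y ∈ Ico 0 c') {k : ℕ} (hk : k ≤ n) :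
    (lorenzF ρ u v c (leftDiffeo a₀) (betaInv a₁))^[k + 1] (c + l * (y - c'))
      = preR (1 / ρ) c v a₁ l (1 - c') (n - k) (branchF ρ (1 - c') u' a₀' (1 - y)) := by
  have hz := h.left_value_mem ⟨hy.1, hy.2.le⟩
  have hlt : l * (y - c') < 0 := mul_neg_of_pos_of_neg h.left.l_pos (by linarith [hy.2])
  have hF := h.left.branchF_eq h.left' h.two_lt h.inv_mul (sub_sub_cancel 1 c).symm (y := 1 - y)
    ⟨by linarith [hy.2], by linarith [hy.1]⟩
  rw [Function.iterate_succ_apply, lorenzF_of_lt (by linarith),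
    show 1 - (c + l * (y - c')) = 1 - c + l * (1 - y - (1 - c')) by ring, hF, sub_sub_cancel]
  exact iterate_eq_of_backward (P := fun j => preR (1 / ρ) c v a₁ l (1 - c') j _)
    (fun j => h.left_backward hz j) k n hk

lemma right_orbit (h : RenormStep ρ c u v a₀ a₁ l n m c' u' v' a₀' a₁') {y : ℝ}
    (hy : y ∈ Icc c' 1) {k : ℕ} (hk : k ≤ m) :
    (lorenzF ρ u v c (leftDiffeo a₀) (betaInv a₁))^[k + 1] (c + l * (y - c'))
      = 1 - preR (1 / ρ) (1 - c) u a₀ l c' (m - k) (branchF ρ c' v' a₁' y) := by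
  have hz := h.right_value_mem hy
  have hle : 0 ≤ l * (y - c') := mul_nonneg h.left.l_pos.le (by linarith [hy.1])
  rw [Function.iterate_succ_apply, lorenzF_of_ge (by linarith),
    h.right.branchF_eq h.right' h.two_lt h.inv_mul rfl hy]
  exact iterate_eq_of_backward (P := fun j => 1 - preR (1 / ρ) (1 - c) u a₀ l c' j _)
    (fun j => h.right_backward hz j) k m hk

lemma left_return_eq (h : RenormStep ρ c u v a₀ a₁ l n m c' u' v' a₀' a₁') {y : ℝ}
    (hy : y ∈ Ico 0 c') :
    (lorenzF ρ u v c (leftDiffeo a₀) (betaInv a₁))^[n + 1] (c + l * (y - c'))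
      = c + l * (1 - c' - branchF ρ (1 - c') u' a₀' (1 - y)) := by
  rw [h.left_orbit hy le_rfl, Nat.sub_self]
  rfl

lemma right_return_eq (h : RenormStep ρ c u v a₀ a₁ l n m c' u' v' a₀' a₁') {y : ℝ}
    (hy : y ∈ Icc c' 1) :
    (lorenzF ρ u v c (leftDiffeo a₀) (betaInv a₁))^[m + 1] (c + l * (y - c'))
      = c + l * (branchF ρ c' v' a₁' y - c') := by
  rw [h.right_orbit hy le_rfl, Nat.sub_self]
  change 1 - (1 - c + l * (c' - _)) = _
  ring

lemma c'_mem (h : RenormStep ρ c u v a₀ a₁ l n m c' u' v' a₀' a₁') : c' ∈ Ioo (0 : ℝ) 1 :=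
  ⟨h.right'.c_pos, h.right'.c_lt⟩

lemma mem_left (h : RenormStep ρ c u v a₀ a₁ l n m c' u' v' a₀' a₁') {x : ℝ}
    (hx : x ∈ Ico (c - c' * l) c) : ∃ y ∈ Ico 0 c', x = c + l * (y - c') := by
  have hl := h.left.l_pos
  refine ⟨c' + (x - c) / l, ⟨?_, ?_⟩, by field_simp; ring⟩
  · have : -c' ≤ (x - c) / l := (le_div_iff₀ hl).2 (by linarith [hx.1])
    linarith
  · have : (x - c) / l < 0 := div_neg_of_neg_of_pos (by linarith [hx.2]) hl
    linarith

lemma mem_right (h : RenormStep ρ c u v a₀ a₁ l n m c' u' v' a₀' a₁') {x : ℝ}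
    (hx : x ∈ Ioc c (c + (1 - c') * l)) : ∃ y ∈ Icc c' 1, x = c + l * (y - c') := by
  have hl := h.left.l_pos
  refine ⟨c' + (x - c) / l, ⟨?_, ?_⟩, by field_simp; ring⟩
  · have : 0 ≤ (x - c) / l := div_nonneg (by linarith [hx.1]) hl.le
    linarith
  · have : (x - c) / l ≤ 1 - c' := (div_le_iff₀ hl).2 (by linarith [hx.2])
    linarith

lemma affine_mem (h : RenormStep ρ c u v a₀ a₁ l n m c' u' v' a₀' a₁') {y : ℝ}
    (hy : y ∈ Icc (0 : ℝ) 1) : c + l * (y - c') ∈ Icc (c - c' * l) (c + (1 - c') * l) := by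
  have hl := h.left.l_pos
  constructor <;> nlinarith [mul_nonneg hl.le hy.1, mul_nonneg hl.le (sub_nonneg.2 hy.2)]

lemma left_pre_gt (h : RenormStep ρ c u v a₀ a₁ l n m c' u' v' a₀' a₁') {z : ℝ}
    (hz : z ∈ Icc (0 : ℝ) 1) {j : ℕ} (hj : 1 ≤ j) :
    c + (1 - c') * l < preR (1 / ρ) c v a₁ l (1 - c') j z := by
  obtain ⟨j, rfl⟩ := Nat.exists_eq_add_of_le' hj
  have h1 := h.left.lt_pre hz j
  nlinarith [mul_pos h.c'_mem.1 h.left.l_pos]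

lemma right_pre_lt (h : RenormStep ρ c u v a₀ a₁ l n m c' u' v' a₀' a₁') {z : ℝ}
    (hz : z ∈ Icc (0 : ℝ) 1) {j : ℕ} (hj : 1 ≤ j) :
    1 - preR (1 / ρ) (1 - c) u a₀ l c' j z < c - c' * l := by
  obtain ⟨j, rfl⟩ := Nat.exists_eq_add_of_le' hj
  have h1 := h.right.lt_pre hz j
  nlinarith [mul_pos (sub_pos.2 h.c'_mem.2) h.left.l_pos]

lemma left_critical_value (h : RenormStep ρ c u v a₀ a₁ l n m c' u' v' a₀' a₁') :
    leftDiffeo a₀ u = preR (1 / ρ) c v a₁ l (1 - c') n (branchF ρ (1 - c') u' a₀' (1 - c')) := by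
  have hF := h.left.branchF_eq h.left' h.two_lt h.inv_mul (sub_sub_cancel 1 c).symm (y := 1 - c')
    ⟨le_rfl, h.left'.c_lt.le⟩
  rw [sub_self, mul_zero, add_zero, branchF_center h.two_lt] at hF
  rw [leftDiffeo, hF, sub_sub_cancel]

lemma right_critical_value (h : RenormStep ρ c u v a₀ a₁ l n m c' u' v' a₀' a₁') :
    betaInv a₁ (1 - v) = 1 - preR (1 / ρ) (1 - c) u a₀ l c' m (branchF ρ c' v' a₁' c') := by
  have hF := h.right.branchF_eq h.right' h.two_lt h.inv_mul rfl (y := c')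
    ⟨le_rfl, h.right'.c_lt.le⟩
  rwa [sub_self, mul_zero, add_zero, branchF_center h.two_lt] at hF

theorem monotoneRenorm (h : RenormStep ρ c u v a₀ a₁ l n m c' u' v' a₀' a₁') :
    MonotoneRenorm ρ u v c (leftDiffeo a₀) (betaInv a₁) n m (c - c' * l) (c + (1 - c') * l) := by
  have hl := h.left.l_pos
  have hc' := h.c'_mem
  have hlc := h.left.l_lt
  refine
    { n_pos := by have := h.left.n_ge; omega
      m_pos := by have := h.right.n_ge; omega
      p_pos := by nlinarith [hlc.1, hc'.2]
      p_lt_c := by nlinarith [mul_pos hc'.1 hl]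
      c_lt_q := by nlinarith [mul_pos (sub_pos.2 hc'.2) hl]
      q_lt_one := by nlinarith [hlc.2, hc'.1]
      left_return := ?_
      left_fix := ?_
      right_return := ?_
      right_fix := ?_
      left_iter := ?_
      right_iter := ?_
      nontrivial_left := ?_
      nontrivial_right := ?_ }
  · intro x hx
    obtain ⟨y, hy, rfl⟩ := h.mem_left hx
    have hz := one_sub_mem_unit (h.left_value_mem ⟨hy.1, hy.2.le⟩)
    rw [h.left_return_eq hy, sub_right_comm]
    exact h.affine_mem hz
  · have h1 := h.left_return_eq (y := 0) ⟨le_rfl, hc'.1⟩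
    rw [sub_zero, branchF_one h.left'.small h.left'.c_lt] at h1
    rw [show c - c' * l = c + l * (0 - c') by ring, h1]
    ring
  · intro x hx
    obtain ⟨y, hy, rfl⟩ := h.mem_right hx
    rw [h.right_return_eq hy]
    exact h.affine_mem (h.right_value_mem hy)
  · have h1 := h.right_return_eq (y := 1) ⟨hc'.2.le, le_rfl⟩
    rw [branchF_one h.right'.small h.right'.c_lt] at h1
    rw [show c + (1 - c') * l = c + l * (1 - c') by ring, h1]
  · intro k hk1 hkn
    obtain ⟨k, rfl⟩ := Nat.exists_eq_add_of_le' hk1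
    have key : ∀ x ∈ Ico (c - c' * l) c,
        c + (1 - c') * l < (lorenzF ρ u v c (leftDiffeo a₀) (betaInv a₁))^[k + 1] x ∧
          (lorenzF ρ u v c (leftDiffeo a₀) (betaInv a₁))^[k + 1] x ≤ 1 := by
      intro x hx
      obtain ⟨y, hy, rfl⟩ := h.mem_left hx
      have hz := h.left_value_mem ⟨hy.1, hy.2.le⟩
      rw [h.left_orbit hy (by omega)]
      exact ⟨h.left_pre_gt hz (by omega), (h.left.pre_mem_unit hz _).2⟩
    constructor
    · rintro _ ⟨x, hx, rfl⟩
      exact ⟨by nlinarith [(key x hx).1, mul_pos (sub_pos.2 hc'.2) hl], (key x hx).2⟩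
    · rw [Set.disjoint_left]
      rintro _ ⟨x, hx, rfl⟩ hmem
      linarith [(key x hx).1, hmem.2]
  · intro k hk1 hkn
    obtain ⟨k, rfl⟩ := Nat.exists_eq_add_of_le' hk1
    have key : ∀ x ∈ Ioc c (c + (1 - c') * l),
        0 ≤ (lorenzF ρ u v c (leftDiffeo a₀) (betaInv a₁))^[k + 1] x ∧
          (lorenzF ρ u v c (leftDiffeo a₀) (betaInv a₁))^[k + 1] x < c - c' * l := by
      intro x hx
      obtain ⟨y, hy, rfl⟩ := h.mem_right hx
      have hz := h.right_value_mem hy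
      rw [h.right_orbit hy (by omega)]
      exact ⟨(one_sub_mem_unit (h.right.pre_mem_unit hz _)).1, h.right_pre_lt hz (by omega)⟩
    constructor
    · rintro _ ⟨x, hx, rfl⟩
      exact ⟨(key x hx).1, by nlinarith [(key x hx).2, mul_pos hc'.1 hl]⟩
    · rw [Set.disjoint_left]
      rintro _ ⟨x, hx, rfl⟩ hmem
      linarith [(key x hx).2, hmem.1]
  · have hz := h.left_value_mem ⟨hc'.1.le, le_rfl⟩
    have h1 := iterate_eq_of_backward
      (P := fun j => preR (1 / ρ) c v a₁ l (1 - c') j (branchF ρ (1 - c') u' a₀' (1 - c')))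
      (fun j => h.left_backward hz j) n n le_rfl
    have h2 := h.left'.branchF_center_lt h.two_lt
    rw [h.left_critical_value, h1, Nat.sub_self]
    change c < c + l * (1 - c' - _)
    linarith [mul_pos hl (sub_pos.2 h2)]
  · have hz := h.right_value_mem ⟨le_rfl, hc'.2.le⟩
    have h1 := iterate_eq_of_backward
      (P := fun j => 1 - preR (1 / ρ) (1 - c) u a₀ l c' j (branchF ρ c' v' a₁' c'))
      (fun j => h.right_backward hz j) m m le_rfl
    have h2 := h.right'.branchF_center_lt h.two_lt
    rw [h.right_critical_value, h1, Nat.sub_self]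
    change 1 - (1 - c + l * (c' - _)) < c
    linarith [mul_pos hl (sub_pos.2 h2)]

theorem center_eq (h : RenormStep ρ c u v a₀ a₁ l n m c' u' v' a₀' a₁') :
    c' = (c - (c - c' * l)) / (c + (1 - c') * l - (c - c' * l)) := by
  rw [show c + (1 - c') * l - (c - c' * l) = l by ring, sub_sub_cancel,
    mul_div_cancel_right₀ _ h.left.l_pos.ne']

theorem eqOn_renormF (h : RenormStep ρ c u v a₀ a₁ l n m c' u' v' a₀' a₁') :
    EqOn (lorenzF ρ u' v' c' (leftDiffeo a₀') (betaInv a₁'))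
      (renormF (lorenzF ρ u v c (leftDiffeo a₀) (betaInv a₁)) n m (c - c' * l)
        (c + (1 - c') * l) c) (Icc 0 1) := by
  intro y hy
  have hl := h.left.l_pos
  have hA : c - c' * l + (c + (1 - c') * l - (c - c' * l)) * y = c + l * (y - c') := by ring
  have hq : c + (1 - c') * l - (c - c' * l) = l := by ring
  rw [renormF, hA, hq]
  rcases lt_or_ge y c' with hlt | hge
  · rw [if_pos (by nlinarith), h.left_return_eq ⟨hy.1, hlt⟩, lorenzF_of_lt hlt, eq_div_iff hl.ne']
    ring
  · rw [if_neg (by nlinarith), h.right_return_eq ⟨hge, hy.2⟩, lorenzF_of_ge hge,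
      eq_div_iff hl.ne']
    ring

end RenormStep

end Renormalization

/-- Renormalization periodic points: for every `ρ > 2` there is `N > 1` such that
for every `k ≥ 1` and every finite sequence of monotone combinatorial types
`ω_i = (0 1^{n_i}, 1 0^{m_i})`, `i < k`, with all word lengths `n_i + 1 ≥ N`,
`m_i + 1 ≥ N`, there is a C³ Lorenz map `f₀` with negative Schwarzian derivative
which is `k` times renormalizable with successive types `ω_0, …, ω_{k-1}` (each
`f_i = R^i[f₀]` is `ω_i`-renormalizable and `f_{i+1} = R[f_i]`) and is a periodic
point of the renormalization operator: `R^k[f₀] = f₀`. -/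
theorem renormalization_periodic_points (ρ : ℝ) (hρ : 2 < ρ) :
    ∃ N : ℕ, 1 < N ∧
      ∀ k : ℕ, 1 ≤ k →
      ∀ nseq mseq : ℕ → ℕ, (∀ i < k, N ≤ nseq i + 1 ∧ N ≤ mseq i + 1) →
      ∃ (uu vv cc pp qq : ℕ → ℝ) (Φ Ψ : ℕ → ℝ → ℝ),
        (∀ i < k,
          IsLorenz 3 ρ (uu i) (vv i) (cc i) (Φ i) (Ψ i) ∧
          NegSchwarzian (lorenzF ρ (uu i) (vv i) (cc i) (Φ i) (Ψ i)) (cc i) ∧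
          MonotoneRenorm ρ (uu i) (vv i) (cc i) (Φ i) (Ψ i)
            (nseq i) (mseq i) (pp i) (qq i) ∧
          cc (i + 1) = (cc i - pp i) / (qq i - pp i) ∧
          Set.EqOn
            (lorenzF ρ (uu (i + 1)) (vv (i + 1)) (cc (i + 1)) (Φ (i + 1)) (Ψ (i + 1)))
            (renormF (lorenzF ρ (uu i) (vv i) (cc i) (Φ i) (Ψ i))
              (nseq i) (mseq i) (pp i) (qq i) (cc i))
            (Icc 0 1 \ {cc (i + 1)})) ∧
        uu k = uu 0 ∧ vv k = vv 0 ∧ cc k = cc 0 ∧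
        Set.EqOn (Φ k) (Φ 0) (Icc 0 1) ∧ Set.EqOn (Ψ k) (Ψ 0) (Icc 0 1) := by
  have hρ0 : 0 < ρ := by linarith
  have hs : 0 < 1 / ρ := one_div_pos.2 hρ0
  have hs2 : 1 / ρ < 1 / 2 := one_div_lt_one_div_of_lt two_pos hρ
  obtain ⟨N, hN, hbound⟩ := exists_length_threshold hs
  refine ⟨N + 1, by omega, fun k hk nseq mseq hseq => ?_⟩
  have : NeZero k := ⟨by omega⟩
  let ν : ZMod k → Bool → ℕ := fun i σ => if σ then nseq i.val else mseq i.val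
  have hνN : ∀ i σ, N ≤ ν i σ := by
    intro i σ
    have hi := hseq i.val (ZMod.val_lt i)
    cases σ
    · exact Nat.le_of_succ_le_succ hi.2
    · exact Nat.le_of_succ_le_succ hi.1
  obtain ⟨C, V, A, l, hC, hB, hS⟩ := exists_chain hs hs2 (Equiv.addRight (1 : ZMod k))
    (fun i σ => hN.trans (hνN i σ)) (fun i σ => hbound _ (hνN i σ))
  have hCf : ∀ i, C i false = 1 - C i true := fun i => hC i true
  have step : ∀ i : ℕ, i < k → RenormStep ρ (C i true) (V i false) (V i true) (A i false)
      (A i true) (l i) (nseq i) (mseq i) (C (i + 1 : ℕ) true) (V (i + 1 : ℕ) false)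
      (V (i + 1 : ℕ) true) (A (i + 1 : ℕ) false) (A (i + 1 : ℕ) true) := by
    intro i hi
    have hval : (i : ZMod k).val = i := ZMod.val_natCast_of_lt hi
    have hL := hS i false
    have hR := hS i true
    have hB0 := hB (i + 1 : ℕ) false
    simp only [ν, Equiv.coe_addRight, Bool.not_false, Bool.not_true, hCf, hval, if_true,
      Bool.false_eq_true, if_false] at hL hR hB0
    rw [← Nat.cast_add_one] at hL hR
    exact ⟨hρ, hL, hR, hB0, hB _ _⟩
  refine ⟨fun i => V i false, fun i => V i true, fun i => C i true,
    fun i => C i true - C (i + 1 : ℕ) true * l i,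
    fun i => C i true + (1 - C (i + 1 : ℕ) true) * l i,
    fun i => leftDiffeo (A i false), fun i => betaInv (A i true), ?_, ?_⟩
  · intro i hi
    have h0 := hB i false
    have h1 := hB i true
    exact ⟨isLorenz_of_small hρ h0.v_pos h0.v_le h1.v_pos h1.v_le h1.c_pos h1.c_lt h0.small h1.small,
      negSchwarzian_of_small hρ h0.v_pos h0.v_le h1.v_pos h1.v_le h1.c_pos h1.c_lt h0.small
        h1.small,
      (step i hi).monotoneRenorm, (step i hi).center_eq,
      (step i hi).eqOn_renormF.mono sdiff_subset⟩
  · simp [EqOn]
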